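/- Let N ≥ 3 be an integer, let a, b > −2, and let p ≥ q > 0 with pq > 1. Assume that N/(p+1) + N/(q+1) > N−2 and that 2(p+1)/(pq−1) > N−3. Then there exists a constant C > 0, depending only on N, p, q, a, b, such that: (i) for every ρ > 0, every positive solution (u, v) of the Hardy–Hénon system on the punctured ball {x ∈ ℝ^N : 0 < |x| < ρ} satisfies |∇u(x)| ≤ C |x|^{−α − 1 − (a+bp)/(pq−1)} and |∇v(x)| ≤ C |x|^{−β − 1 − (b+aq)/(pq−1)} for all x with 0 < |x| < ρ/2; and (ii) for every ρ ≥ 0, every positive solution (u, v) of the Hardy–Hénon system on the exterior domain {x ∈ ℝ^N : |x| > ρ} satisfies the same two gradient bounds for all x with |x| > 2ρ. -/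

import Mathlib

open MeasureTheory Metric Set Filter

/-- The Euclidean Laplacian of `u : ℝ^N → ℝ`, as the sum of the second derivatives
along the standard coordinate directions. -/
noncomputable def lap {N : ℕ} (u : EuclideanSpace ℝ (Fin N) → ℝ)
    (x : EuclideanSpace ℝ (Fin N)) : ℝ :=
  ∑ i : Fin N, iteratedFDeriv ℝ 2 u x ![EuclideanSpace.single i 1, EuclideanSpace.single i 1]

/-- `(u, v)` is a positive solution of the Hardy–Hénon system
`-Δu = |x|^a v^p`, `-Δv = |x|^b u^q` on the set `Ω`:
`u, v` are continuous on `Ω`, `C²` on `Ω \ {0}`, positive on `Ω`, and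
the equations hold on `Ω \ {0}`. -/
def IsHHSol {N : ℕ} (a b p q : ℝ) (Ω : Set (EuclideanSpace ℝ (Fin N)))
    (u v : EuclideanSpace ℝ (Fin N) → ℝ) : Prop :=
  ContinuousOn u Ω ∧ ContinuousOn v Ω ∧
  ContDiffOn ℝ 2 u (Ω \ {0}) ∧ ContDiffOn ℝ 2 v (Ω \ {0}) ∧
  (∀ x ∈ Ω, 0 < u x) ∧ (∀ x ∈ Ω, 0 < v x) ∧
  (∀ x ∈ Ω \ {0}, -lap u x = ‖x‖ ^ a * v x ^ p) ∧
  (∀ x ∈ Ω \ {0}, -lap v x = ‖x‖ ^ b * u x ^ q)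

open scoped Topology

section Calculus

variable {N : ℕ}

/-- Euclidean `N`-space. -/
abbrev EN (N : ℕ) := EuclideanSpace ℝ (Fin N)

/-- The `i`-th partial derivative. -/
noncomputable def pd (i : Fin N) (f : EN N → ℝ) (x : EN N) : ℝ :=
  fderiv ℝ f x (EuclideanSpace.single i 1)

/-- The Laplacian, written as a sum of iterated partial derivatives. -/
noncomputable def lapl (f : EN N → ℝ) (x : EN N) : ℝ := ∑ i, pd i (pd i f) x

lemma lap_eq_lapl {u : EN N → ℝ} {x : EN N} (hu : ContDiffAt ℝ 2 u x) : lap u x = lapl u x := by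
  unfold lap lapl
  refine Finset.sum_congr rfl fun i _ => ?_
  rw [iteratedFDeriv_two_apply]
  have h1 : DifferentiableAt ℝ (fderiv ℝ u) x :=
    (hu.fderiv_right (m := 1) (by norm_num)).differentiableAt (by norm_num)
  have h2 : pd i u = fun y => (fderiv ℝ u y) (EuclideanSpace.single i 1) := rfl
  rw [h2, pd, fderiv_clm_apply h1 (by fun_prop)]
  simp

lemma pd_contDiff {n m : WithTop ℕ∞} {f : EN N → ℝ} (i : Fin N) (hf : ContDiff ℝ n f)
    (h : m + 1 ≤ n) : ContDiff ℝ m (pd i f) :=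
  (hf.fderiv_right h).clm_apply contDiff_const

lemma pd_contDiff1 {f : EN N → ℝ} (i : Fin N) (hf : ContDiff ℝ 2 f) : ContDiff ℝ 1 (pd i f) :=
  pd_contDiff i hf (by norm_num)

lemma pd_continuous {f : EN N → ℝ} (i : Fin N) (hf : ContDiff ℝ 1 f) : Continuous (pd i f) :=
  (pd_contDiff (m := 0) i hf (by norm_num)).continuous

lemma lapl_continuous {f : EN N → ℝ} (hf : ContDiff ℝ 2 f) : Continuous (lapl f) :=
  continuous_finsetSum _ fun i _ => pd_continuous i (pd_contDiff1 i hf)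

lemma pd_add {f g : EN N → ℝ} {i : Fin N} {x : EN N} (hf : DifferentiableAt ℝ f x)
    (hg : DifferentiableAt ℝ g x) : pd i (fun y => f y + g y) x = pd i f x + pd i g x := by
  simp [pd, fderiv_fun_add hf hg]

lemma pd_sub {f g : EN N → ℝ} {i : Fin N} {x : EN N} (hf : DifferentiableAt ℝ f x)
    (hg : DifferentiableAt ℝ g x) : pd i (fun y => f y - g y) x = pd i f x - pd i g x := by
  simp [pd, fderiv_fun_sub hf hg]

lemma pd_mul {f g : EN N → ℝ} {i : Fin N} {x : EN N} (hf : DifferentiableAt ℝ f x)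
    (hg : DifferentiableAt ℝ g x) :
    pd i (fun y => f y * g y) x = f x * pd i g x + g x * pd i f x := by
  simp [pd, fderiv_fun_mul hf hg]

lemma pd_const_mul {f : EN N → ℝ} {i : Fin N} {x : EN N} (c : ℝ) (hf : DifferentiableAt ℝ f x) :
    pd i (fun y => c * f y) x = c * pd i f x := by
  simp [pd, fderiv_const_mul hf]

lemma pd_const (i : Fin N) (c : ℝ) (x : EN N) : pd i (fun _ => c) x = 0 := by simp [pd]

lemma pd_sum {ι : Type*} (s : Finset ι) {f : ι → EN N → ℝ} {i : Fin N} {x : EN N}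
    (hf : ∀ j ∈ s, DifferentiableAt ℝ (f j) x) :
    pd i (fun y => ∑ j ∈ s, f j y) x = ∑ j ∈ s, pd i (f j) x := by
  simp [pd, fderiv_fun_sum hf]

lemma pd_comp {h : ℝ → ℝ} {f : EN N → ℝ} {i : Fin N} {x : EN N} (hh : DifferentiableAt ℝ h (f x))
    (hf : DifferentiableAt ℝ f x) : pd i (fun y => h (f y)) x = deriv h (f x) * pd i f x := by
  have := (hh.hasDerivAt.comp_hasFDerivAt x hf.hasFDerivAt).fderiv
  simp only [pd]
  rw [show (fun y => h (f y)) = h ∘ f from rfl, this]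
  simp

lemma pd_comp_affine {f : EN N → ℝ} {i : Fin N} (hf : Differentiable ℝ f) (z : EN N) (s : ℝ)
    (x : EN N) : pd i (fun y => f (z + s • y)) x = s * pd i f (z + s • x) := by
  have h1 : HasFDerivAt (fun y : EN N => z + s • y) (s • ContinuousLinearMap.id ℝ (EN N)) x :=
    ((hasFDerivAt_id x).const_smul s).const_add z
  have := ((hf (z + s • x)).hasFDerivAt.comp x h1).fderiv
  simp only [pd]
  rw [show (fun y => f (z + s • y)) = f ∘ (fun y => z + s • y) from rfl, this]
  simp

lemma lapl_comp_affine {f : EN N → ℝ} (hf : ContDiff ℝ 2 f) (l : ℝ) (z : EN N) (s : ℝ)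
    (x : EN N) : lapl (fun y => l * f (z + s • y)) x = l * s ^ 2 * lapl f (z + s • x) := by
  unfold lapl
  rw [Finset.mul_sum]
  refine Finset.sum_congr rfl fun i _ => ?_
  have hd : Differentiable ℝ f := hf.differentiable (by norm_num)
  have h1 : pd i (fun y => l * f (z + s • y)) = fun y => (l * s) * pd i f (z + s • y) := by
    funext y
    rw [pd_const_mul l (by fun_prop), pd_comp_affine hd]; ring
  have hd2 : Differentiable ℝ (pd i f) := (pd_contDiff1 i hf).differentiable (by norm_num)
  rw [h1, pd_const_mul _ (by fun_prop), pd_comp_affine hd2]; ring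

lemma lapl_mul {f g : EN N → ℝ} (hf : ContDiff ℝ 2 f) (hg : ContDiff ℝ 2 g) (x : EN N) :
    lapl (fun y => f y * g y) x
      = f x * lapl g x + 2 * ∑ i, pd i f x * pd i g x + g x * lapl f x := by
  unfold lapl
  rw [Finset.mul_sum, Finset.mul_sum, Finset.mul_sum, ← Finset.sum_add_distrib,
    ← Finset.sum_add_distrib]
  refine Finset.sum_congr rfl fun i _ => ?_
  have hfd : Differentiable ℝ f := hf.differentiable (by norm_num)
  have hgd : Differentiable ℝ g := hg.differentiable (by norm_num)
  have hfd' : Differentiable ℝ (pd i f) := (pd_contDiff1 i hf).differentiable (by norm_num)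
  have hgd' : Differentiable ℝ (pd i g) := (pd_contDiff1 i hg).differentiable (by norm_num)
  have h1 : pd i (fun y => f y * g y) = fun y => f y * pd i g y + g y * pd i f y := by
    funext y; exact pd_mul (hfd y) (hgd y)
  rw [h1, pd_add ((hfd x).fun_mul (hgd' x)) ((hgd x).fun_mul (hfd' x)), pd_mul (hfd x) (hgd' x),
    pd_mul (hgd x) (hfd' x)]
  ring

lemma lapl_comp {h : ℝ → ℝ} {f : EN N → ℝ} (hh : ContDiff ℝ 2 h) (hf : ContDiff ℝ 2 f)
    (x : EN N) :
    lapl (fun y => h (f y)) x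
      = deriv (deriv h) (f x) * ∑ i, pd i f x ^ 2 + deriv h (f x) * lapl f x := by
  unfold lapl
  rw [Finset.mul_sum, Finset.mul_sum, ← Finset.sum_add_distrib]
  refine Finset.sum_congr rfl fun i _ => ?_
  have hfd : Differentiable ℝ f := hf.differentiable (by norm_num)
  have hfd' : Differentiable ℝ (pd i f) := (pd_contDiff1 i hf).differentiable (by norm_num)
  have hhd : Differentiable ℝ h := hh.differentiable (by norm_num)
  have hhd' : Differentiable ℝ (deriv h) :=
    ((contDiff_succ_iff_deriv (n := 1)).1 (by
      rw [one_add_one_eq_two]; exact hh)).2.2.differentiable (by norm_num)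
  have h1 : pd i (fun y => h (f y)) = fun y => deriv h (f y) * pd i f y := by
    funext y; exact pd_comp (hhd _) (hfd y)
  rw [h1, pd_mul (by fun_prop) (hfd' x), pd_comp (hhd' _) (hfd x)]
  ring

lemma pd_coord (i j : Fin N) (x : EN N) :
    pd i (fun y : EN N => y j) x = if i = j then 1 else 0 := by
  have : (fun y : EN N => y j) = fun y => (EuclideanSpace.proj j : EN N →L[ℝ] ℝ) y := rfl
  rw [pd, this, ContinuousLinearMap.fderiv]
  simp [eq_comm]

lemma pd_normSq (i : Fin N) (z x : EN N) :
    pd i (fun y : EN N => ‖y - z‖ ^ 2) x = 2 * (x i - z i) := by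
  have h := ((hasFDerivAt_id x).sub_const z).norm_sq.fderiv
  simp only [id] at h
  rw [pd, h]
  simp [EuclideanSpace.inner_single_right]

lemma contDiff_normSq {n : WithTop ℕ∞} (z : EN N) : ContDiff ℝ n (fun y : EN N => ‖y - z‖ ^ 2) :=
  (contDiff_id.sub contDiff_const).norm_sq ℝ

lemma lapl_normSq (z x : EN N) : lapl (fun y : EN N => ‖y - z‖ ^ 2) x = 2 * N := by
  unfold lapl
  have : ∀ i : Fin N, pd i (pd i (fun y : EN N => ‖y - z‖ ^ 2)) x = 2 := by
    intro i
    have h1 : pd i (fun y : EN N => ‖y - z‖ ^ 2) = fun y : EN N => 2 * (y i - z i) := by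
      funext y; exact pd_normSq i z y
    rw [h1, pd_const_mul _ (by fun_prop), pd_sub (by fun_prop) (by fun_prop), pd_coord, pd_const]
    simp
  simp [this, mul_comm]

lemma sum_pd_normSq_sq (z x : EN N) :
    ∑ i, pd i (fun y : EN N => ‖y - z‖ ^ 2) x ^ 2 = 4 * ‖x - z‖ ^ 2 := by
  simp_rw [pd_normSq, EuclideanSpace.norm_sq_eq, Finset.mul_sum]
  refine Finset.sum_congr rfl fun i _ => ?_
  simp
  ring

lemma pd_eq_zero_of_notMem {f : EN N → ℝ} {i : Fin N} {x : EN N} (hx : x ∉ tsupport f) :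
    pd i f x = 0 := by
  rw [pd, fderiv_of_notMem_tsupport ℝ hx]; simp

lemma tsupport_pd_subset (i : Fin N) (f : EN N → ℝ) : tsupport (pd i f) ⊆ tsupport f := by
  refine closure_minimal (fun x hx => ?_) (isClosed_tsupport f)
  by_contra h
  exact hx (pd_eq_zero_of_notMem h)

lemma hasCompactSupport_pd {f : EN N → ℝ} (i : Fin N) (hf : HasCompactSupport f) :
    HasCompactSupport (pd i f) :=
  IsCompact.of_isClosed_subset hf (isClosed_tsupport _) (tsupport_pd_subset i f)

lemma lapl_eq_zero_of_notMem {f : EN N → ℝ} {x : EN N} (hx : x ∉ tsupport f) : lapl f x = 0 :=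
  Finset.sum_eq_zero fun i _ => pd_eq_zero_of_notMem fun h => hx (tsupport_pd_subset i f h)

lemma integral_pd_eq_zero {f : EN N → ℝ} (i : Fin N) (hf : ContDiff ℝ 1 f)
    (hc : HasCompactSupport f) : ∫ x, pd i f x = 0 := by
  have h := integral_mul_fderiv_eq_neg_fderiv_mul_of_integrable (μ := (volume : Measure (EN N)))
    (f := fun _ : EN N => (1 : ℝ)) (g := f) (v := EuclideanSpace.single i 1)
    (by simp) ?_ ?_ (fun x _ => by fun_prop) (fun x _ => (hf.differentiable (by norm_num)) x)
  · simpa [pd] using h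
  · simp only [one_mul]
    exact (pd_continuous i hf).integrable_of_hasCompactSupport (hasCompactSupport_pd i hc)
  · simp only [one_mul]
    exact hf.continuous.integrable_of_hasCompactSupport hc

lemma integral_mul_pd {f g : EN N → ℝ} (i : Fin N) (hf : ContDiff ℝ 1 f) (hg : ContDiff ℝ 1 g)
    (hc : HasCompactSupport g) : ∫ x, f x * pd i g x = - ∫ x, g x * pd i f x := by
  have h := integral_pd_eq_zero i (hf.mul hg) (hc.mul_left (f := f))
  have h1 : pd i (fun x => f x * g x) = fun x => f x * pd i g x + g x * pd i f x := by
    funext x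
    exact pd_mul (hf.differentiable (by norm_num) x) (hg.differentiable (by norm_num) x)
  rw [h1, integral_add] at h
  · linarith
  · exact (hf.continuous.mul (pd_continuous i hg)).integrable_of_hasCompactSupport
      ((hasCompactSupport_pd i hc).mul_left)
  · exact (hg.continuous.mul (pd_continuous i hf)).integrable_of_hasCompactSupport hc.mul_right

/-- Green's identity against a compactly supported test function. -/
lemma integral_mul_lapl {u w : EN N → ℝ} (hu : ContDiff ℝ 2 u) (hw : ContDiff ℝ 2 w)
    (hc : HasCompactSupport w) : ∫ x, u x * lapl w x = ∫ x, w x * lapl u x := by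
  unfold lapl
  simp_rw [Finset.mul_sum]
  have hu1 : ContDiff ℝ 1 u := hu.of_le (by norm_num)
  have hw1 : ContDiff ℝ 1 w := hw.of_le (by norm_num)
  rw [integral_finsetSum, integral_finsetSum]
  · refine Finset.sum_congr rfl fun i _ => ?_
    rw [integral_mul_pd i hu1 (pd_contDiff1 i hw) (hasCompactSupport_pd i hc)]
    have h2 := integral_mul_pd i (pd_contDiff1 i hu) hw1 hc
    simp_rw [mul_comm (pd i w _)]
    linarith
  · intro i _
    exact (hw.continuous.mul (pd_continuous i (pd_contDiff1 i hu))).integrable_of_hasCompactSupport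
      hc.mul_right
  · intro i _
    exact (hu.continuous.mul (pd_continuous i (pd_contDiff1 i hw))).integrable_of_hasCompactSupport
      ((hasCompactSupport_pd i (hasCompactSupport_pd i hc)).mul_left)

end Calculus

section Cutoff

variable {N : ℕ}

lemma smoothTransition_deriv_bounds : ∃ M > 0, ∀ t : ℝ,
    |deriv Real.smoothTransition t| ≤ M ∧ |deriv (deriv Real.smoothTransition) t| ≤ M := by
  have hS : ContDiff ℝ 2 Real.smoothTransition := Real.smoothTransition.contDiff
  have hS1 : ContDiff ℝ 1 (deriv Real.smoothTransition) :=
    ((contDiff_succ_iff_deriv (n := 1)).1 (by rw [one_add_one_eq_two]; exact hS)).2.2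
  have hS2 : Continuous (deriv (deriv Real.smoothTransition)) := hS1.continuous_deriv_one
  have h0 : ∀ t ∉ Icc (0 : ℝ) 1, deriv Real.smoothTransition t = 0 := by
    intro t ht
    rcases lt_or_ge t 0 with h | h
    · have : Real.smoothTransition =ᶠ[nhds t] fun _ => 0 := by
        filter_upwards [Iio_mem_nhds h] with s hs
        exact Real.smoothTransition.zero_of_nonpos hs.le
      rw [this.deriv_eq]; simp
    · have h1 : 1 < t := by
        by_contra h1
        exact ht ⟨h, not_lt.1 h1⟩
      have : Real.smoothTransition =ᶠ[nhds t] fun _ => 1 := by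
        filter_upwards [Ioi_mem_nhds h1] with s hs
        exact Real.smoothTransition.one_of_one_le (le_of_lt hs)
      rw [this.deriv_eq]; simp
  have hc : HasCompactSupport (deriv Real.smoothTransition) :=
    HasCompactSupport.intro isCompact_Icc h0
  obtain ⟨M1, hM1⟩ := hc.exists_bound_of_continuous hS1.continuous
  obtain ⟨M2, hM2⟩ := hc.deriv.exists_bound_of_continuous hS2
  refine ⟨max M1 (max M2 1), by positivity, fun t => ⟨(hM1 t).trans (le_max_left _ _),
    (hM2 t).trans ((le_max_left _ _).trans (le_max_right _ _))⟩⟩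

lemma abs_coord_le_norm (x : EN N) (i : Fin N) : |x i| ≤ ‖x‖ := by
  simpa using PiLp.norm_apply_le x i

/-- Radial cutoff functions with quantitative bounds on their derivatives. -/
lemma exists_cutoff (N : ℕ) : ∃ C > 0, ∀ r ρ : ℝ, 1 / 2 ≤ r → r < ρ → ρ ≤ 3 →
    ∃ ζ : EN N → ℝ, ContDiff ℝ 2 ζ ∧ (∀ y, 0 ≤ ζ y) ∧ (∀ y, ζ y ≤ 1) ∧
      (∀ y, ‖y‖ ≤ r → ζ y = 1) ∧ (∀ y, ρ ≤ ‖y‖ → ζ y = 0) ∧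
      (∀ y i, |pd i ζ y| ≤ C / (ρ - r)) ∧ (∀ y, |lapl ζ y| ≤ C / (ρ - r) ^ 2) ∧
      (∀ y, ‖y‖ < r → lapl ζ y = 0 ∧ ∀ i, pd i ζ y = 0) ∧
      (∀ y, ρ < ‖y‖ → lapl ζ y = 0 ∧ ∀ i, pd i ζ y = 0) := by
  obtain ⟨M, hM, hSb⟩ := smoothTransition_deriv_bounds
  refine ⟨6 * M + (36 * M + 2 * N * M * 3), by positivity, fun r ρ hr hrρ hρ => ?_⟩
  have hS : ContDiff ℝ 2 Real.smoothTransition := Real.smoothTransition.contDiff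
  set D := ρ ^ 2 - r ^ 2 with hD
  have hd : 0 < ρ - r := by linarith
  have hDd : ρ - r ≤ D := by nlinarith
  have hD0 : 0 < D := by linarith
  set h : ℝ → ℝ := fun s => Real.smoothTransition ((ρ ^ 2 - s) * D⁻¹) with hh
  have hh2 : ContDiff ℝ 2 h := hS.comp (by fun_prop)
  have hSd : Differentiable ℝ Real.smoothTransition := hS.differentiable (by norm_num)
  have hS1 : ContDiff ℝ 1 (deriv Real.smoothTransition) :=
    ((contDiff_succ_iff_deriv (n := 1)).1 (by rw [one_add_one_eq_two]; exact hS)).2.2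
  have hSd1 : Differentiable ℝ (deriv Real.smoothTransition) := hS1.differentiable (by norm_num)
  have hin : ∀ s : ℝ, HasDerivAt (fun s => (ρ ^ 2 - s) * D⁻¹) (-D⁻¹) s := by
    intro s
    simpa using ((hasDerivAt_id s).const_sub (ρ ^ 2)).mul_const D⁻¹
  have hh' : deriv h = fun s => deriv Real.smoothTransition ((ρ ^ 2 - s) * D⁻¹) * (-D⁻¹) := by
    funext s
    exact ((hSd _).hasDerivAt.comp s (hin s)).deriv
  have hh'' : deriv (deriv h) = fun s =>
      deriv (deriv Real.smoothTransition) ((ρ ^ 2 - s) * D⁻¹) * (-D⁻¹) * (-D⁻¹) := by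
    rw [hh']
    funext s
    exact (((hSd1 _).hasDerivAt.comp s (hin s)).mul_const _).deriv
  have hb1 : ∀ s, |deriv h s| ≤ M / (ρ - r) := by
    intro s
    rw [hh']
    simp only [abs_mul, abs_neg, abs_inv, abs_of_pos hD0]
    rw [div_eq_mul_inv]
    exact mul_le_mul (hSb _).1 (inv_anti₀ hd hDd) (by positivity) hM.le
  have hb2 : ∀ s, |deriv (deriv h) s| ≤ M / (ρ - r) ^ 2 := by
    intro s
    rw [hh'']
    simp only [abs_mul, abs_neg, abs_inv, abs_of_pos hD0]
    rw [mul_assoc, div_eq_mul_inv, ← mul_inv, ← pow_two]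
    refine mul_le_mul (hSb _).2 (inv_anti₀ (by positivity) (by gcongr)) (by positivity) hM.le
  set f : EN N → ℝ := fun y => ‖y - 0‖ ^ 2 with hf
  have hf2 : ContDiff ℝ 2 f := contDiff_normSq 0
  have hζ2 : ContDiff ℝ 2 (fun y => h (f y)) := hh2.comp hf2
  have hone : ∀ y : EN N, ‖y‖ ≤ r → h (f y) = 1 := by
    intro y hy
    apply Real.smoothTransition.one_of_one_le
    rw [le_mul_inv_iff₀ hD0, hf]
    have : ‖y‖ ^ 2 ≤ r ^ 2 := by gcongr
    simp only [sub_zero]; linarith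
  have hzero : ∀ y : EN N, ρ ≤ ‖y‖ → h (f y) = 0 := by
    intro y hy
    apply Real.smoothTransition.zero_of_nonpos
    have : ρ ^ 2 ≤ ‖y‖ ^ 2 := pow_le_pow_left₀ (by linarith) hy 2
    refine mul_nonpos_of_nonpos_of_nonneg ?_ (by positivity)
    simp only [hf, sub_zero]; linarith
  have hlocal : ∀ (g : EN N → ℝ) (c : ℝ) (y : EN N), (∀ᶠ z in nhds y, g z = c) →
      lapl g y = 0 ∧ ∀ i, pd i g y = 0 := by
    intro g c y hg
    have key : ∀ᶠ z in nhds y, ∀ i, pd i g z = 0 := by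
      filter_upwards [hg.eventually_nhds] with z hz i
      have : g =ᶠ[nhds z] fun _ => c := hz
      rw [pd, this.fderiv_eq]; simp
    refine ⟨Finset.sum_eq_zero fun i _ => ?_, fun i => key.self_of_nhds i⟩
    have : pd i g =ᶠ[nhds y] fun _ => 0 := key.mono fun z hz => hz i
    rw [pd, this.fderiv_eq]; simp
  have hloc1 : ∀ y : EN N, ‖y‖ < r → lapl (fun y => h (f y)) y = 0 ∧
      ∀ i, pd i (fun y => h (f y)) y = 0 := fun y hy => hlocal _ 1 y <| by
    filter_upwards [(isOpen_lt continuous_norm continuous_const).mem_nhds hy] with z hz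
    exact hone z (le_of_lt hz)
  have hloc2 : ∀ y : EN N, ρ < ‖y‖ → lapl (fun y => h (f y)) y = 0 ∧
      ∀ i, pd i (fun y => h (f y)) y = 0 := fun y hy => hlocal _ 0 y <| by
    filter_upwards [(isOpen_lt continuous_const continuous_norm).mem_nhds hy] with z hz
    exact hzero z (le_of_lt hz)
  refine ⟨fun y => h (f y), hζ2, fun y => Real.smoothTransition.nonneg _,
    fun y => Real.smoothTransition.le_one _, hone, hzero, ?_, ?_, hloc1, hloc2⟩
  · intro y i
    rcases lt_or_ge ρ ‖y‖ with hy | hy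
    · rw [(hloc2 y hy).2 i, abs_zero]; positivity
    · rw [pd_comp (hh2.differentiable (by norm_num) _) (hf2.differentiable (by norm_num) _),
        pd_normSq, abs_mul]
      have h1 : |2 * (y i - (0 : EN N) i)| ≤ 6 := by
        have := abs_coord_le_norm y i
        simp only [PiLp.zero_apply, sub_zero, abs_mul, abs_two]; linarith
      calc _ ≤ M / (ρ - r) * 6 := mul_le_mul (hb1 _) h1 (abs_nonneg _) (by positivity)
        _ = (6 * M) / (ρ - r) := by ring
        _ ≤ _ := by
          gcongr
          nlinarith [Nat.cast_nonneg (α := ℝ) N, mul_nonneg (Nat.cast_nonneg (α := ℝ) N) hM.le]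
  · intro y
    rcases lt_or_ge ρ ‖y‖ with hy | hy
    · rw [(hloc2 y hy).1, abs_zero]; positivity
    · rw [lapl_comp hh2 hf2, sum_pd_normSq_sq, lapl_normSq]
      have h1 : 4 * ‖y - 0‖ ^ 2 ≤ 36 := by
        rw [sub_zero]; nlinarith [norm_nonneg y]
      have h3 : 1 / (ρ - r) ≤ 3 / (ρ - r) ^ 2 := by
        rw [div_le_div_iff₀ hd (by positivity)]; nlinarith
      calc _ ≤ |deriv (deriv h) (f y) * (4 * ‖y - 0‖ ^ 2)| + |deriv h (f y) * (2 * N)| :=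
            abs_add_le _ _
        _ ≤ M / (ρ - r) ^ 2 * 36 + M / (ρ - r) * (2 * N) := by
            rw [abs_mul _ (4 * ‖y - 0‖ ^ 2), abs_mul _ (2 * (N : ℝ)),
              abs_of_nonneg (by positivity : 0 ≤ 4 * ‖y - 0‖ ^ 2),
              abs_of_nonneg (by positivity : (0:ℝ) ≤ 2 * N)]
            gcongr
            · exact hb2 _
            · exact hb1 _
        _ = M * 36 / (ρ - r) ^ 2 + (2 * N * M) * (1 / (ρ - r)) := by ring
        _ ≤ M * 36 / (ρ - r) ^ 2 + (2 * N * M) * (3 / (ρ - r) ^ 2) := by gcongr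
        _ = (36 * M + 2 * N * M * 3) / (ρ - r) ^ 2 := by ring
        _ ≤ _ := by
          refine div_le_div_of_nonneg_right ?_ (by positivity)
          linarith

lemma hasCompactSupport_of_zero_outside {f : EN N → ℝ} {R : ℝ} (hf : ∀ y, R ≤ ‖y‖ → f y = 0) :
    HasCompactSupport f :=
  HasCompactSupport.intro (isCompact_closedBall (0 : EN N) R) fun y hy =>
    hf y (by simpa using (not_le.1 (by simpa using hy)).le)

end Cutoff

section Kernel

variable {N : ℕ}

/-- The regularised power kernel `(‖y - z‖² + ε²) ^ (-k)`. -/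
noncomputable def rker (k ε : ℝ) (z y : EN N) : ℝ := (‖y - z‖ ^ 2 + ε ^ 2) ^ (-k)

lemma rker_base_pos {ε : ℝ} (hε : 0 < ε) (z y : EN N) : 0 < ‖y - z‖ ^ 2 + ε ^ 2 := by positivity

lemma rker_pos {k ε : ℝ} (hε : 0 < ε) (z y : EN N) : 0 < rker k ε z y :=
  Real.rpow_pos_of_pos (rker_base_pos hε z y) _

lemma rker_contDiff {n : WithTop ℕ∞} (k : ℝ) {ε : ℝ} (hε : 0 < ε) (z : EN N) :
    ContDiff ℝ n (rker k ε z) :=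
  ((contDiff_normSq z).add contDiff_const).rpow_const_of_ne fun y => (rker_base_pos hε z y).ne'

lemma rker_swap (k ε : ℝ) (z y : EN N) : rker k ε z y = rker k ε y z := by
  simp [rker, norm_sub_rev]

lemma rker_continuous_uncurry (k : ℝ) {ε : ℝ} (hε : 0 < ε) :
    Continuous (fun p : EN N × EN N => rker k ε p.1 p.2) := by
  unfold rker
  refine Continuous.rpow_const (by fun_prop) fun p => Or.inl (rker_base_pos hε _ _).ne'

lemma pd_rker (k : ℝ) {ε : ℝ} (hε : 0 < ε) (z y : EN N) (i : Fin N) :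
    pd i (rker k ε z) y = -(2 * k) * ((y i - z i) * rker (k + 1) ε z y) := by
  have hb := rker_base_pos hε z y
  have hd : DifferentiableAt ℝ (fun y : EN N => ‖y - z‖ ^ 2) y :=
    (contDiff_normSq (n := 1) z).differentiable (by norm_num) y
  have h1 : HasDerivAt (fun s : ℝ => (s + ε ^ 2) ^ (-k))
      (1 * (-k) * (‖y - z‖ ^ 2 + ε ^ 2) ^ (-k - 1)) (‖y - z‖ ^ 2) :=
    ((hasDerivAt_id _).add_const _).rpow_const (Or.inl hb.ne')
  have := pd_comp (i := i) h1.differentiableAt hd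
  rw [h1.deriv, pd_normSq] at this
  have h2 : rker k ε z = fun y => (fun s : ℝ => (s + ε ^ 2) ^ (-k)) (‖y - z‖ ^ 2) := rfl
  rw [h2, this, rker, show -(k + 1) = -k - 1 by ring]
  ring

lemma pd_coord_rker (k : ℝ) {ε : ℝ} (hε : 0 < ε) (z y : EN N) (i j : Fin N) :
    pd i (fun y => (y j - z j) * rker k ε z y) y =
      (y j - z j) * (-(2 * k) * ((y i - z i) * rker (k + 1) ε z y))
        + rker k ε z y * (if i = j then 1 else 0) := by
  have hd := (rker_contDiff (n := 1) k hε z).differentiable (by norm_num)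
  rw [pd_mul (f := fun y : EN N => y j - z j) (by fun_prop) (hd y), pd_rker k hε,
    pd_sub (by fun_prop) (by fun_prop), pd_coord, pd_const]
  simp

lemma pd_pd_rker (k : ℝ) {ε : ℝ} (hε : 0 < ε) (z y : EN N) (i : Fin N) :
    pd i (pd i (rker k ε z)) y = -(2 * k) * rker (k + 1) ε z y
      + 4 * k * (k + 1) * (y i - z i) ^ 2 * rker (k + 2) ε z y := by
  have h1 : pd i (rker k ε z) = fun y => -(2 * k) * ((y i - z i) * rker (k + 1) ε z y) := by
    funext y; exact pd_rker k hε z y i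
  have hd := (rker_contDiff (n := 1) (k + 1) hε z).differentiable (by norm_num)
  rw [h1, pd_const_mul _ (by fun_prop), pd_coord_rker _ hε, if_pos rfl, add_assoc k 1 1,
    one_add_one_eq_two]
  ring

/-- The approximate identity `-Δ` of the regularised fundamental solution. -/
noncomputable def eta (N : ℕ) (ε : ℝ) (z y : EN N) : ℝ :=
  N * (N - 2) * ε ^ 2 * rker ((N + 2) / 2) ε z y

lemma lapl_rker {ε : ℝ} (hε : 0 < ε) (z y : EN N) :
    lapl (rker ((N - 2) / 2) ε z) y = - eta N ε z y := by
  unfold lapl eta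
  simp_rw [pd_pd_rker _ hε]
  rw [Finset.sum_add_distrib, Finset.sum_const, ← Finset.sum_mul, ← Finset.mul_sum]
  have h1 : ∑ i, (y i - z i) ^ 2 = ‖y - z‖ ^ 2 := by
    rw [EuclideanSpace.norm_sq_eq]; simp
  have hb := rker_base_pos hε z y
  have h2 : rker ((N - 2 : ℝ) / 2 + 1) ε z y
      = (‖y - z‖ ^ 2 + ε ^ 2) * rker ((N + 2 : ℝ) / 2) ε z y := by
    unfold rker
    nth_rw 2 [← Real.rpow_one (‖y - z‖ ^ 2 + ε ^ 2)]
    rw [← Real.rpow_add hb]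
    congr 1; ring
  rw [h1, h2, show ((N - 2 : ℝ) / 2 + 2) = (N + 2) / 2 by ring]
  simp only [Finset.card_univ, Fintype.card_fin, nsmul_eq_mul]
  ring

lemma eta_nonneg (hN : 3 ≤ N) {ε : ℝ} (hε : 0 < ε) (z y : EN N) : 0 ≤ eta N ε z y := by
  have : (3 : ℝ) ≤ N := by exact_mod_cast hN
  have := (rker_pos (k := (N + 2 : ℝ) / 2) hε z y).le
  unfold eta
  have h2 : (0 : ℝ) ≤ N - 2 := by linarith
  positivity

lemma eta_continuous {ε : ℝ} (hε : 0 < ε) (z : EN N) : Continuous (eta N ε z) := by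
  unfold eta
  exact continuous_const.mul (rker_contDiff (n := 0) _ hε z).continuous

/-- `eta` is an approximate identity, up to normalisation, uniformly for compactly supported
continuous functions. -/
lemma eta_approx (hN : 3 ≤ N) : ∃ cN > 0, ∀ w : EN N → ℝ, Continuous w → HasCompactSupport w →
    ∀ δ > 0, ∃ ε₀ > 0, ∀ ε, 0 < ε → ε < ε₀ → ∀ x, |(∫ y, eta N ε x y * w y) - cN * w x| ≤ δ := by
  have hN3 : (3 : ℝ) ≤ N := by exact_mod_cast hN
  have hc0 : (0 : ℝ) < N * (N - 2) := by apply mul_pos <;> linarith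
  set e : EN N → ℝ := fun z => N * (N - 2) * (1 + ‖z‖ ^ 2) ^ (-((N : ℝ) + 2) / 2) with he
  have hfin : Module.finrank ℝ (EN N) = N := by simp
  have hei : Integrable e := (integrable_rpow_neg_one_add_norm_sq
      (by rw [hfin]; linarith)).const_mul _
  have hepos : ∀ z, 0 < e z := fun z => by
    have : 0 < (1 + ‖z‖ ^ 2) ^ (-((N : ℝ) + 2) / 2) := Real.rpow_pos_of_pos (by positivity) _
    positivity
  have he1 : Integrable (fun z => e z * ‖z‖) := by
    have h1 : Integrable (fun z : EN N => N * (N - 2) * (1 + ‖z‖ ^ 2) ^ (-((N : ℝ) + 1) / 2)) :=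
      (integrable_rpow_neg_one_add_norm_sq (by rw [hfin]; linarith)).const_mul _
    refine h1.mono' (by fun_prop) (Eventually.of_forall fun z => ?_)
    rw [Real.norm_of_nonneg (by have := hepos z; positivity), he]
    simp only
    rw [mul_assoc]
    refine mul_le_mul_of_nonneg_left ?_ hc0.le
    have hb : 0 < 1 + ‖z‖ ^ 2 := by positivity
    calc (1 + ‖z‖ ^ 2) ^ (-((N : ℝ) + 2) / 2) * ‖z‖
        ≤ (1 + ‖z‖ ^ 2) ^ (-((N : ℝ) + 2) / 2) * (1 + ‖z‖ ^ 2) ^ (1 / 2 : ℝ) := by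
          gcongr
          rw [← Real.sqrt_eq_rpow]
          exact Real.le_sqrt_of_sq_le (by linarith)
      _ = _ := by rw [← Real.rpow_add hb]; congr 1; ring
  have hcN : 0 < ∫ z, e z := by
    rw [integral_pos_iff_support_of_nonneg (fun z => (hepos z).le) hei]
    have : Function.support e = univ := by
      ext z; simp [(hepos z).ne']
    rw [this]; exact isOpen_univ.measure_pos _ univ_nonempty
  have hchange : ∀ (w : EN N → ℝ) (ε : ℝ), 0 < ε → ∀ x,
      ∫ y, eta N ε x y * w y = ∫ z, e z * w (x + ε • z) := by
    intro w ε hε x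
    have h1 : ∫ y, eta N ε x y * w y = ∫ y, eta N ε x (x + y) * w (x + y) :=
      (integral_add_left_eq_self (fun y => eta N ε x y * w y) x).symm
    have h2 := Measure.integral_comp_smul (volume : Measure (EN N))
      (fun y => eta N ε x (x + y) * w (x + y)) ε
    rw [hfin, abs_of_pos (by positivity), smul_eq_mul] at h2
    have h3 : ∫ y, eta N ε x (x + y) * w (x + y)
        = ε ^ N * ∫ z, eta N ε x (x + ε • z) * w (x + ε • z) := by
      rw [h2, ← mul_assoc, mul_inv_cancel₀ (by positivity), one_mul]
    rw [h1, h3, ← integral_const_mul]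
    congr 1
    funext z
    have : ε ^ N * eta N ε x (x + ε • z) = e z := by
      simp only [eta, rker, he, add_sub_cancel_left, norm_smul, Real.norm_eq_abs, abs_of_pos hε]
      have h4 : (ε * ‖z‖) ^ 2 + ε ^ 2 = ε ^ 2 * (1 + ‖z‖ ^ 2) := by ring
      have h5 : (ε ^ 2 : ℝ) ^ (-(((N : ℝ) + 2) / 2)) = (ε ^ (N + 2))⁻¹ := by
        rw [← Real.rpow_natCast ε 2, ← Real.rpow_mul hε.le, ← Real.rpow_natCast ε (N + 2),
          ← Real.rpow_neg hε.le]
        congr 1; push_cast; ring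
      rw [h4, Real.mul_rpow (by positivity) (by positivity), h5, neg_div]
      field_simp
      ring
    rw [← mul_assoc, this]
  refine ⟨∫ z, e z, hcN, fun w hw hwc δ hδ => ?_⟩
  obtain ⟨M, hM⟩ := hwc.exists_bound_of_continuous hw
  have hM0 : 0 ≤ M := (norm_nonneg _).trans (hM 0)
  have huc := hwc.uniformContinuous_of_continuous hw
  set c := ∫ z, e z with hc
  set K := ∫ z, e z * ‖z‖ with hK
  have hK0 : 0 ≤ K := integral_nonneg fun z => by have := hepos z; positivity
  obtain ⟨θ, hθ, hθ'⟩ := Metric.uniformContinuous_iff.1 huc (δ / (2 * c)) (by positivity)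
  refine ⟨δ / 2 / (2 * M / θ * K + 1), by positivity, fun ε hε hε0 x => ?_⟩
  refine (congrArg (fun t => |t - c * w x|) (hchange w ε hε x)).trans_le ?_
  beta_reduce
  rw [hc, ← integral_mul_const, ← integral_sub]
  rotate_left
  · refine (hei.mul_const M).mono' ((hei.aestronglyMeasurable).mul
      (hw.comp (by fun_prop)).aestronglyMeasurable) (Eventually.of_forall fun z => ?_)
    rw [norm_mul, Real.norm_of_nonneg (hepos z).le]
    exact mul_le_mul_of_nonneg_left (hM _) (hepos z).le
  · exact hei.mul_const _
  have hbound : ∀ z, |e z * w (x + ε • z) - e z * w x|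
      ≤ e z * (δ / (2 * c)) + e z * ‖z‖ * (2 * M / θ * ε) := by
    intro z
    rw [← mul_sub, abs_mul, abs_of_pos (hepos z), mul_assoc (e z), ← mul_add]
    refine mul_le_mul_of_nonneg_left ?_ (hepos z).le
    rcases lt_or_ge (ε * ‖z‖) θ with h | h
    · have := hθ' (a := x + ε • z) (b := x)
        (by rw [dist_eq_norm, add_sub_cancel_left, norm_smul, Real.norm_of_nonneg hε.le]; exact h)
      rw [Real.dist_eq] at this
      have h2 : 0 ≤ ‖z‖ * (2 * M / θ * ε) := by positivity
      linarith
    · have h1 : |w (x + ε • z) - w x| ≤ 2 * M := by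
        have := abs_sub_le (w (x + ε • z)) 0 (w x)
        simp only [sub_zero, zero_sub, abs_neg] at this
        have h2 := hM (x + ε • z)
        have h3 := hM x
        rw [Real.norm_eq_abs] at h2 h3
        linarith
      have h2 : 2 * M ≤ ‖z‖ * (2 * M / θ * ε) := by
        have : ‖z‖ * (2 * M / θ * ε) = 2 * M * ((ε * ‖z‖) / θ) := by ring
        rw [this]
        exact le_mul_of_one_le_right (by positivity) ((one_le_div hθ).2 h)
      have h3 : 0 ≤ δ / (2 * c) := by positivity
      linarith
  rw [← Real.norm_eq_abs]
  calc _ ≤ ∫ z, (e z * (δ / (2 * c)) + e z * ‖z‖ * (2 * M / θ * ε)) :=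
        norm_integral_le_of_norm_le ((hei.mul_const _).add (he1.mul_const _))
          (Eventually.of_forall hbound)
    _ = c * (δ / (2 * c)) + K * (2 * M / θ * ε) := by
        rw [integral_add (hei.mul_const _) (he1.mul_const _),
              integral_mul_const, integral_mul_const]
    _ ≤ δ := by
        have h1 : c * (δ / (2 * c)) = δ / 2 := by field_simp
        rw [lt_div_iff₀ (by positivity)] at hε0
        have h2 : K * (2 * M / θ * ε) = ε * (2 * M / θ * K) := by ring
        nlinarith

end Kernel

section Representation

variable {N : ℕ}

/-- The closed annulus on which all boundary contributions live. -/
abbrev ann (N : ℕ) : Set (EN N) := closedBall 0 1 \ ball 0 (1 / 2)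

lemma abs_sub_le_add (s t : ℝ) : |s - t| ≤ |s| + |t| := by
  simpa [sub_eq_add_neg] using abs_add_le s (-t)

lemma measurableSet_ann : MeasurableSet (ann N) := measurableSet_closedBall.diff measurableSet_ball

lemma Continuous.integrableOn_closedBall {g : EN N → ℝ} (hg : Continuous g) (ρ : ℝ) :
    IntegrableOn g (closedBall 0 ρ) :=
  hg.continuousOn.integrableOn_compact (isCompact_closedBall 0 ρ)

lemma Continuous.integrableOn_ann {g : EN N → ℝ} (hg : Continuous g) : IntegrableOn g (ann N) :=
  (hg.integrableOn_closedBall 1).mono_set sdiff_subset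

lemma green_cutoff {u ζ K : EN N → ℝ} (hu : ContDiff ℝ 2 u) (hζ : ContDiff ℝ 2 ζ)
    (hζc : HasCompactSupport ζ) (hK : ContDiff ℝ 2 K) :
    ∫ y, u y * (ζ y * lapl K y) = (∫ y, ζ y * K y * lapl u y)
      - ∫ y, u y * (2 * ∑ i, pd i ζ y * pd i K y + K y * lapl ζ y) := by
  have hg := integral_mul_lapl (u := u) (w := fun y => ζ y * K y) hu (hζ.mul hK) hζc.mul_right
  have hl : ∀ y, u y * lapl (fun y => ζ y * K y) y = u y * (ζ y * lapl K y)
      + u y * (2 * ∑ i, pd i ζ y * pd i K y + K y * lapl ζ y) := by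
    intro y
    rw [lapl_mul hζ hK]; ring
  simp_rw [hl] at hg
  rw [integral_add] at hg
  · linarith
  · exact (hu.continuous.mul (hζ.continuous.mul
        (lapl_continuous hK))).integrable_of_hasCompactSupport
      (HasCompactSupport.mul_left hζc.mul_right)
  · refine Continuous.integrable_of_hasCompactSupport ?_ ?_
    · refine hu.continuous.mul ((continuous_const.mul (continuous_finsetSum _ fun i _ => ?_)).add
        (hK.continuous.mul (lapl_continuous hζ)))
      exact (pd_continuous i (hζ.of_le (by norm_num))).mul (pd_continuous i
          (hK.of_le (by norm_num)))
    · refine HasCompactSupport.intro hζc fun y hy => ?_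
      rw [lapl_eq_zero_of_notMem hy]
      simp [pd_eq_zero_of_notMem hy]

lemma green_cutoff_bound (N : ℕ) : ∃ C > 0, ∀ r ρ : ℝ, 1 / 2 ≤ r → r < ρ → ρ ≤ 1 →
    ∃ ζ : EN N → ℝ, ContDiff ℝ 2 ζ ∧ HasCompactSupport ζ ∧
      (∀ y, ‖y‖ < (r + ρ) / 2 → ζ y = 1 ∧ ∀ i, pd i ζ y = 0) ∧
      ∀ u K : EN N → ℝ, ContDiff ℝ 2 u → ContDiff ℝ 2 K → (∀ y, ‖y‖ < 2 → 0 ≤ u y) →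
      (∀ y, ‖y‖ < 2 → 0 ≤ -lapl u y) → ∀ A : ℝ, 0 ≤ A →
      (∀ y ∈ ann N, (r + ρ) / 2 ≤ ‖y‖ → |K y| ≤ A ∧ ∀ i, |pd i K y| ≤ A) →
      |∫ y, u y * (ζ y * lapl K y)| ≤ (∫ y in closedBall 0 ρ, |K y| * (-lapl u y))
        + C * A * (ρ - r) ^ (-2 : ℝ) * ∫ y in ann N, u y := by
  obtain ⟨C, hC, H⟩ := exists_cutoff N
  refine ⟨(2 * N + 1) * C * 4, by positivity, fun r ρ hr hrρ hρ => ?_⟩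
  obtain ⟨ζ, hζ, h0, h1, hin, hout, hp, hl, hzin, hzout⟩ :=
    H ((r + ρ) / 2) ρ (by linarith) (by linarith) (by linarith)
  have hζc : HasCompactSupport ζ := hasCompactSupport_of_zero_outside hout
  refine ⟨ζ, hζ, hζc, fun y hy => ⟨hin y hy.le, (hzin y hy).2⟩, ?_⟩
  intro u K hu hK hu0 hlu A hA hKA
  rw [green_cutoff hu hζ hζc hK]
  have hd : ρ - (r + ρ) / 2 = (ρ - r) / 2 := by ring
  rw [hd] at hp hl
  have hb1 : |∫ y, ζ y * K y * lapl u y| ≤ ∫ y in closedBall 0 ρ, |K y| * (-lapl u y) := by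
    rw [← integral_indicator measurableSet_closedBall, ← Real.norm_eq_abs]
    have hcont : Continuous fun y => |K y| * (-lapl u y) :=
      hK.continuous.abs.mul (lapl_continuous hu).neg
    refine norm_integral_le_of_norm_le
      ((hcont.integrableOn_closedBall ρ).integrable_indicator measurableSet_closedBall)
      (Eventually.of_forall fun y => ?_)
    by_cases hy : y ∈ closedBall (0 : EN N) ρ
    · rw [indicator_of_mem hy]
      rw [mem_closedBall_zero_iff] at hy
      have h3 := hlu y (by linarith)
      rw [norm_mul, norm_mul, Real.norm_of_nonneg (h0 y), Real.norm_eq_abs, Real.norm_eq_abs,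
        ← abs_neg (lapl u y), abs_of_nonneg h3]
      refine mul_le_mul_of_nonneg_right ?_ h3
      exact mul_le_of_le_one_left (abs_nonneg _) (h1 y)
    · rw [indicator_of_notMem hy]
      rw [mem_closedBall_zero_iff, not_le] at hy
      simp [hout y hy.le]
  have hb2 : |∫ y, u y * (2 * ∑ i, pd i ζ y * pd i K y + K y * lapl ζ y)| ≤
      (2 * N + 1) * C * 4 * A * (ρ - r) ^ (-2 : ℝ) * ∫ y in ann N, u y := by
    rw [← integral_const_mul, ← integral_indicator measurableSet_ann, ← Real.norm_eq_abs]
    refine norm_integral_le_of_norm_le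
      ((integrable_indicator_iff measurableSet_ann).2
          ((hu.continuous.integrableOn_ann).const_mul _))
      (Eventually.of_forall fun y => ?_)
    have hD : 0 < ρ - r := by linarith
    by_cases hy : (r + ρ) / 2 ≤ ‖y‖ ∧ ‖y‖ ≤ ρ
    · have hya : y ∈ ann N := by
        simp only [Set.mem_sdiff, mem_closedBall_zero_iff, mem_ball_zero_iff, not_lt]
        constructor <;> linarith [hy.1, hy.2]
      rw [indicator_of_mem hya, norm_mul, Real.norm_of_nonneg (hu0 y (by linarith [hy.2])),
            mul_comm]
      refine mul_le_mul_of_nonneg_right ?_ (hu0 y (by linarith [hy.2]))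
      obtain ⟨hk, hpk⟩ := hKA y hya hy.1
      have e2 : (ρ - r) ^ (-2 : ℝ) = 1 / (ρ - r) ^ 2 := by
        rw [Real.rpow_neg hD.le, one_div]; norm_cast
      have e1 : C / ((ρ - r) / 2) ≤ C * 4 * (ρ - r) ^ (-2 : ℝ) := by
        rw [e2, div_le_iff₀ (by positivity)]
        have : C * 4 * (1 / (ρ - r) ^ 2) * ((ρ - r) / 2) = C * (2 / (ρ - r)) := by field_simp; ring
        rw [this]
        refine le_mul_of_one_le_right hC.le ((one_le_div hD).2 (by linarith))
      have e3 : C / ((ρ - r) / 2) ^ 2 = C * 4 * (ρ - r) ^ (-2 : ℝ) := by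
        rw [e2]; field_simp; ring
      have hs : |∑ i, pd i ζ y * pd i K y| ≤ N * (C * 4 * (ρ - r) ^ (-2 : ℝ) * A) := by
        refine (Finset.abs_sum_le_sum_abs _ _).trans ?_
        have : ∀ i ∈ Finset.univ, |pd i ζ y * pd i K y| ≤ C * 4 * (ρ - r) ^ (-2 : ℝ) * A := by
          intro i _
          rw [abs_mul]
          exact mul_le_mul ((hp y i).trans e1) (hpk i) (abs_nonneg _) (by positivity)
        refine (Finset.sum_le_card_nsmul _ _ _ this).trans ?_
        simp
      have hq : |K y * lapl ζ y| ≤ A * (C * 4 * (ρ - r) ^ (-2 : ℝ)) := by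
        rw [abs_mul]
        exact mul_le_mul hk ((hl y).trans e3.le) (abs_nonneg _) hA
      rw [Real.norm_eq_abs]
      refine (abs_add_le _ _).trans ?_
      rw [abs_mul, abs_two]
      calc _ ≤ 2 * (N * (C * 4 * (ρ - r) ^ (-2 : ℝ) * A)) + A * (C * 4 * (ρ - r) ^ (-2 : ℝ)) := by
            gcongr
        _ = _ := by ring
    · have : lapl ζ y = 0 ∧ ∀ i, pd i ζ y = 0 := by
        rw [not_and_or, not_le, not_le] at hy
        rcases hy with hy | hy
        · exact hzin y hy
        · exact hzout y hy
      have h3 : ‖u y * (2 * ∑ i, pd i ζ y * pd i K y + K y * lapl ζ y)‖ = 0 := by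
        simp [this.1, this.2]
      rw [h3]
      refine indicator_nonneg (fun z hz => ?_) y
      have : 0 ≤ u z := hu0 z (by
        have := hz.1; rw [mem_closedBall_zero_iff] at this; linarith)
      positivity
  refine (abs_sub_le_add _ _).trans ?_
  gcongr

end Representation

section Representation

variable {N : ℕ}

lemma eta_approx_eventually (hN : 3 ≤ N) : ∃ cN > 0, ∀ w : EN N → ℝ, Continuous w →
    HasCompactSupport w → ∀ δ > 0, ∀ᶠ ε in 𝓝[>] (0 : ℝ), 0 < ε ∧
      ∀ x, |(∫ y, eta N ε x y * w y) - cN * w x| ≤ δ := by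
  obtain ⟨cN, hc, H⟩ := eta_approx hN
  refine ⟨cN, hc, fun w hw hwc δ hδ => ?_⟩
  obtain ⟨ε₀, hε₀, H⟩ := H w hw hwc δ hδ
  filter_upwards [Ioo_mem_nhdsGT hε₀] with ε hε
  exact ⟨hε.1, H ε hε.1 hε.2⟩

lemma rker_le {k ε h : ℝ} (hk : 0 ≤ k) (hh : 0 < h) {z y : EN N} (hy : h ≤ ‖y - z‖) :
    rker k ε z y ≤ h ^ (-(2 * k)) := by
  have h1 : h ^ (-(2 * k)) = (h ^ 2) ^ (-k) := by
    rw [← Real.rpow_natCast, ← Real.rpow_mul hh.le]; congr 1; push_cast; ring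
  rw [h1, rker]
  refine Real.rpow_le_rpow_of_nonpos (by positivity) ?_ (by linarith)
  have : h ^ 2 ≤ ‖y - z‖ ^ 2 := by gcongr
  nlinarith [sq_nonneg ε]

lemma sq_mul_rker_le (k : ℝ) {ε : ℝ} (hε : 0 < ε) (z y : EN N) :
    ‖y - z‖ ^ 2 * rker (k + 1) ε z y ≤ rker k ε z y := by
  have hb := rker_base_pos hε z y
  have : rker k ε z y = (‖y - z‖ ^ 2 + ε ^ 2) * rker (k + 1) ε z y := by
    unfold rker
    nth_rw 2 [← Real.rpow_one (‖y - z‖ ^ 2 + ε ^ 2)]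
    rw [← Real.rpow_add hb]
    congr 1; ring
  rw [this]
  refine mul_le_mul_of_nonneg_right ?_ (rker_pos hε z y).le
  nlinarith [sq_nonneg ε]

lemma norm_mul_rker_le (k : ℝ) {ε : ℝ} (hε : 0 < ε) (z y : EN N) :
    ‖y - z‖ * rker k ε z y ≤ rker (k - 1 / 2) ε z y := by
  have hb := rker_base_pos hε z y
  have : rker (k - 1 / 2) ε z y = (‖y - z‖ ^ 2 + ε ^ 2) ^ (1 / 2 : ℝ) * rker k ε z y := by
    unfold rker
    rw [← Real.rpow_add hb]
    congr 1; ring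
  rw [this]
  refine mul_le_mul_of_nonneg_right ?_ (rker_pos hε z y).le
  rw [← Real.sqrt_eq_rpow]
  exact Real.le_sqrt_of_sq_le (by nlinarith [sq_nonneg ε])

lemma abs_sub_coord_le (z y : EN N) (i : Fin N) : |y i - z i| ≤ ‖y - z‖ := by
  simpa using abs_coord_le_norm (y - z) i

lemma lapl_coord_rker {ε : ℝ} (hε : 0 < ε) (hN : 3 ≤ N) (z y : EN N) (i : Fin N) :
    lapl (fun y => (y i - z i) * rker (N / 2) ε z y) y = (N - 2 : ℝ)⁻¹ * pd i (eta N ε z) y := by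
  have hN3 : (3 : ℝ) ≤ N := by exact_mod_cast hN
  have h1 : ∀ j, pd j (fun y : EN N => y i - z i) = fun _ => if j = i then 1 else 0 := by
    intro j; funext w
    rw [pd_sub (by fun_prop) (by fun_prop), pd_coord, pd_const, sub_zero]
  have h2 : lapl (fun y : EN N => y i - z i) y = 0 := by
    simp [lapl, h1, pd_const]
  have hb := rker_base_pos hε z y
  have h3 : lapl (rker (N / 2) ε z) y = -(2 * (N / 2)) * rker (N / 2 + 1) ε z y * N
      + 4 * (N / 2) * (N / 2 + 1) * (‖y - z‖ ^ 2 * rker (N / 2 + 2) ε z y) := by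
    unfold lapl
    simp_rw [pd_pd_rker _ hε]
    rw [Finset.sum_add_distrib, Finset.sum_const, ← Finset.sum_mul, ← Finset.mul_sum]
    have h1 : ∑ i, (y i - z i) ^ 2 = ‖y - z‖ ^ 2 := by
      rw [EuclideanSpace.norm_sq_eq]; simp
    rw [h1]
    simp only [Finset.card_univ, Fintype.card_fin, nsmul_eq_mul]
    ring
  have h4 : rker ((N : ℝ) / 2 + 1) ε z y
      = (‖y - z‖ ^ 2 + ε ^ 2) * rker ((N : ℝ) / 2 + 2) ε z y := by
    unfold rker
    nth_rw 2 [← Real.rpow_one (‖y - z‖ ^ 2 + ε ^ 2)]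
    rw [← Real.rpow_add hb]
    congr 1; ring
  have h5 : pd i (eta N ε z) y = N * (N - 2) * ε ^ 2 *
      (-(N + 2) * ((y i - z i) * rker (N / 2 + 2) ε z y)) := by
    unfold eta
    rw [pd_const_mul _ ((rker_contDiff (n := 1) _ hε z).differentiable (by norm_num) y),
      pd_rker _ hε]
    rw [show ((N : ℝ) + 2) / 2 + 1 = N / 2 + 2 by ring]
    ring
  rw [lapl_mul (f := fun y : EN N => y i - z i) (by fun_prop) (rker_contDiff _ hε z), h2, h3, h5]
  simp only [h1, ite_mul, one_mul, zero_mul, Finset.sum_ite_eq', Finset.mem_univ, if_true]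
  rw [pd_rker _ hε, h4]
  have : (N : ℝ) - 2 ≠ 0 := by linarith
  field_simp
  ring

set_option maxHeartbeats 1000000 in
lemma representation (hN : 3 ≤ N) : ∃ C > 0, ∀ u : EN N → ℝ, ContDiff ℝ 2 u →
    (∀ y, ‖y‖ < 2 → 0 ≤ u y) → (∀ y, ‖y‖ < 2 → 0 ≤ -lapl u y) →
    ∀ r ρ : ℝ, 1 / 2 ≤ r → r < ρ → ρ ≤ 1 → ∀ᶠ ε in 𝓝[>] (0 : ℝ), 0 < ε ∧ ∀ x, ‖x‖ ≤ r →
      u x ≤ 1 + C * (∫ y in closedBall 0 ρ, rker ((N - 2) / 2) ε x y * (-lapl u y))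
        + C * (ρ - r) ^ (-(N + 2) : ℝ) * (∫ y in ann N, u y) ∧
      ∀ i, |pd i u x| ≤ 1 + C * (∫ y in closedBall 0 ρ, rker ((N - 1) / 2) ε x y * (-lapl u y))
        + C * (ρ - r) ^ (-(N + 2) : ℝ) * (∫ y in ann N, u y) := by
  obtain ⟨c, hc, Heta⟩ := eta_approx_eventually hN
  obtain ⟨C, hC, H⟩ := green_cutoff_bound N
  have hN3 : (3 : ℝ) ≤ N := by exact_mod_cast hN
  have hN2 : (0 : ℝ) < N - 2 := by linarith
  set D : ℝ := C * (2 * N * 2 ^ (N : ℝ)) with hD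
  have hDp : 0 < D := by positivity
  refine ⟨(1 + (N - 2)) * (1 + D) / c, by positivity, fun u hu hu0 hlu r ρ hr hrρ hρ => ?_⟩
  obtain ⟨ζ, hζ, hζc, hζ1, H⟩ := H r ρ hr hrρ hρ
  have hw : ContDiff ℝ 2 (fun y => ζ y * u y) := hζ.mul hu
  have ev1 := Heta (fun y => ζ y * u y) hw.continuous hζc.mul_right c hc
  have ev2 := eventually_all.2 fun i => Heta (pd i (fun y => ζ y * u y))
    (pd_continuous i (hw.of_le (by norm_num))) (hasCompactSupport_pd i hζc.mul_right) c hc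
  filter_upwards [ev1, ev2] with ε ⟨hε, e1⟩ e2
  refine ⟨hε, fun x hx => ?_⟩
  have hd : 0 < ρ - r := by linarith
  set A : ℝ := 2 * N * ((ρ - r) / 2) ^ (-N : ℝ) with hA
  have hA0 : 0 ≤ A := by positivity
  have hAD : C * A * (ρ - r) ^ (-2 : ℝ) = D * (ρ - r) ^ (-(N + 2) : ℝ) := by
    have : ((ρ - r) / 2) ^ (-N : ℝ) = (ρ - r) ^ (-N : ℝ) * 2 ^ (N : ℝ) := by
      rw [Real.div_rpow hd.le (by norm_num), Real.rpow_neg (by norm_num : (0 : ℝ) ≤ 2)]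
      field_simp
    rw [hA, this, hD, show (-(N + 2) : ℝ) = -N + -2 by ring, Real.rpow_add hd]
    ring
  have hIu : 0 ≤ ∫ y in ann N, u y := setIntegral_nonneg measurableSet_ann fun y hy =>
    hu0 y (by have := hy.1; rw [mem_closedBall_zero_iff] at this; linarith)
  have hxn : ‖x‖ < (r + ρ) / 2 := by linarith
  have hfar : ∀ y, (r + ρ) / 2 ≤ ‖y‖ → (ρ - r) / 2 ≤ ‖y - x‖ := by
    intro y hy
    have := norm_sub_norm_le y x
    linarith
  have hsmall : (ρ - r) / 2 ≤ 1 := by linarith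
  have hker : ∀ k : ℝ, 0 ≤ k → k ≤ N / 2 → ∀ y, (r + ρ) / 2 ≤ ‖y‖ →
      rker k ε x y ≤ ((ρ - r) / 2) ^ (-N : ℝ) := by
    intro k hk0 hk y hy
    refine (rker_le hk0 (by linarith) (hfar y hy)).trans ?_
    exact Real.rpow_le_rpow_of_exponent_ge (by linarith) hsmall (by linarith)
  have hnear : ∀ y ∈ ann N, ‖y - x‖ ≤ 2 := by
    intro y hy
    have h1 := hy.1
    rw [mem_closedBall_zero_iff] at h1
    have := norm_sub_le y x
    linarith
  have hIk : ∀ k : ℝ, 0 ≤ ∫ y in closedBall 0 ρ, rker k ε x y * (-lapl u y) := by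
    intro k
    refine setIntegral_nonneg measurableSet_closedBall fun y hy => ?_
    rw [mem_closedBall_zero_iff] at hy
    exact mul_nonneg (rker_pos hε x y).le (hlu y (by linarith))
  have hpow : 0 ≤ (ρ - r) ^ (-(N + 2) : ℝ) := by positivity
  have hpA : 0 ≤ ((ρ - r) / 2) ^ (-N : ℝ) := by positivity
  constructor
  · have hb := H u (rker ((N - 2) / 2) ε x) hu (rker_contDiff _ hε x) hu0 hlu A hA0 (by
      intro y hy hy2
      have hk := hker ((N - 2) / 2) (by linarith) (by linarith) y hy2
      constructor
      · rw [abs_of_pos (rker_pos hε x y)]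
        refine hk.trans ?_
        rw [hA]; nlinarith
      · intro i
        rw [pd_rker _ hε, show ((N : ℝ) - 2) / 2 + 1 = N / 2 by ring, abs_mul, abs_mul,
          abs_of_pos (rker_pos hε x y)]
        have h1 := hker (N / 2) (by linarith) le_rfl y hy2
        have h2 := (abs_sub_coord_le x y i).trans (hnear y hy)
        have h3 : |-(2 * (((N : ℝ) - 2) / 2))| = N - 2 := by
          rw [abs_neg, abs_of_nonneg (by linarith)]; ring
        rw [h3]
        calc (N - 2 : ℝ) * (|y i - x i| * rker (N / 2) ε x y)
            ≤ N * (2 * ((ρ - r) / 2) ^ (-N : ℝ)) := by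
              have := (rker_pos (k := (N : ℝ) / 2) hε x y).le
              gcongr
              linarith
          _ = A := by rw [hA]; ring)
    have h1 := e1 x
    simp only [(hζ1 x hxn).1, one_mul] at h1
    have h2 : ∫ y, u y * (ζ y * lapl (rker ((N - 2) / 2) ε x) y)
        = -∫ y, eta N ε x y * (ζ y * u y) := by
      rw [← integral_neg]
      congr 1; funext y
      rw [lapl_rker hε]; ring
    rw [h2, abs_neg, hAD] at hb
    simp_rw [abs_of_pos (rker_pos hε x _)] at hb
    have h3 := (abs_le.1 h1).1
    have h4 := (le_abs_self _).trans hb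
    have h5 := hIk ((N - 2) / 2)
    set I := ∫ y in closedBall 0 ρ, rker ((N - 2) / 2) ε x y * (-lapl u y)
    set J := ∫ y in ann N, u y
    set P := (ρ - r) ^ (-(N + 2) : ℝ)
    have h6 : c * u x ≤ c + I + D * P * J := by linarith
    have h7 : u x ≤ (c + I + D * P * J) / c := by rw [le_div_iff₀ hc]; linarith
    refine h7.trans ?_
    rw [div_le_iff₀ hc]
    have h8 : (1 + (1 + (N - 2)) * (1 + D) / c * I + (1 + (N - 2)) * (1 + D) / c * P * J) * c
      = c + (1 + (N - 2)) * (1 + D) * I + (1 + (N - 2)) * (1 + D) * (P * J) := by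
      field_simp
    rw [h8]
    have h9 : 0 ≤ P * J := mul_nonneg hpow hIu
    nlinarith [mul_nonneg hDp.le h5, mul_nonneg hN2.le h5, mul_nonneg hN2.le h9,
      mul_nonneg (mul_nonneg hN2.le hDp.le) h5, mul_nonneg (mul_nonneg hN2.le hDp.le) h9]
  · intro i
    set K : EN N → ℝ := fun y => (y i - x i) * rker (N / 2) ε x y with hK
    have hKc : ContDiff ℝ 2 K := ContDiff.mul (by fun_prop) (rker_contDiff _ hε x)
    have hKle : ∀ y, |K y| ≤ rker ((N - 1) / 2) ε x y := by
      intro y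
      rw [hK]
      simp only
      rw [abs_mul, abs_of_pos (rker_pos hε x y)]
      refine (mul_le_mul_of_nonneg_right (abs_sub_coord_le x y i) (rker_pos hε x y).le).trans ?_
      refine (norm_mul_rker_le _ hε x y).trans (le_of_eq ?_)
      congr 1; ring
    have hb := H u K hu hKc hu0 hlu A hA0 (by
      intro y hy hy2
      constructor
      · refine (hKle y).trans ((hker _ (by linarith) (by linarith) y hy2).trans ?_)
        rw [hA]; nlinarith
      · intro j
        rw [hK, pd_coord_rker _ hε]
        have h1 := hker (N / 2) (by linarith) le_rfl y hy2
        have h2 := abs_sub_coord_le x y i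
        have h3 := abs_sub_coord_le x y j
        have hp := (rker_pos (k := (N : ℝ) / 2 + 1) hε x y).le
        have hp2 := (rker_pos (k := (N : ℝ) / 2) hε x y).le
        refine (abs_add_le _ _).trans ?_
        have h4 : |(y i - x i) * (-(2 * ((N : ℝ) / 2)) * ((y j - x j) * rker (N / 2 + 1) ε x y))|
            ≤ N * rker (N / 2) ε x y := by
          have : |(y i - x i) * (-(2 * ((N : ℝ) / 2)) * ((y j - x j) * rker (N / 2 + 1) ε x y))|
            = N * (|y i - x i| * |y j - x j| * rker (N / 2 + 1) ε x y) := by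
            rw [abs_mul, abs_mul, abs_mul, abs_of_nonneg hp, abs_neg,
              abs_of_nonneg (show (0 : ℝ) ≤ 2 * (N / 2) by positivity)]
            ring
          rw [this]
          refine mul_le_mul_of_nonneg_left ?_ (by positivity)
          refine le_trans ?_ (sq_mul_rker_le _ hε x y)
          rw [sq]
          gcongr
        have h5 : |rker ((N : ℝ) / 2) ε x y * (if j = i then 1 else 0)| ≤ rker (N / 2) ε x y := by
          split_ifs
          · rw [mul_one, abs_of_nonneg hp2]
          · simpa using hp2
        calc _ ≤ N * rker (N / 2) ε x y + rker (N / 2) ε x y := add_le_add h4 h5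
          _ = (N + 1) * rker (N / 2) ε x y := by ring
          _ ≤ (2 * N) * ((ρ - r) / 2) ^ (-N : ℝ) := by gcongr; linarith)
    have h1 := (e2 i).2 x
    have hpdx : pd i (fun y => ζ y * u y) x = pd i u x := by
      rw [pd_mul (hζ.differentiable (by norm_num) x) (hu.differentiable (by norm_num) x),
        (hζ1 x hxn).1, (hζ1 x hxn).2 i]
      ring
    rw [hpdx] at h1
    have heC : ContDiff ℝ 1 (eta N ε x) := by
      unfold eta
      exact contDiff_const.mul (rker_contDiff _ hε x)
    have h2 : ∫ y, u y * (ζ y * lapl K y)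
        = -((N - 2 : ℝ)⁻¹ * ∫ y, eta N ε x y * pd i (fun y => ζ y * u y) y) := by
      have := integral_mul_pd i heC (hw.of_le (by norm_num : (1 : WithTop ℕ∞) ≤ 2)) hζc.mul_right
      rw [this, mul_neg, neg_neg, ← integral_const_mul]
      congr 1; funext y
      rw [hK, lapl_coord_rker hε hN]; ring
    rw [h2, abs_neg, abs_mul, abs_of_pos (inv_pos.2 hN2), hAD] at hb
    have h10 : (∫ y in closedBall 0 ρ, |K y| * (-lapl u y))
        ≤ ∫ y in closedBall 0 ρ, rker ((N - 1) / 2) ε x y * (-lapl u y) := by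
      refine setIntegral_mono_on ?_ ?_ measurableSet_closedBall ?_
      · exact (hKc.continuous.abs.mul (lapl_continuous hu).neg).integrableOn_closedBall ρ
      · exact ((rker_contDiff (n := 0) _ hε x).continuous.mul
          (lapl_continuous hu).neg).integrableOn_closedBall ρ
      · intro y hy
        rw [mem_closedBall_zero_iff] at hy
        exact mul_le_mul_of_nonneg_right (hKle y) (hlu y (by linarith))
    have h5 := hIk ((N - 1) / 2)
    set I := ∫ y in closedBall 0 ρ, rker ((N - 1) / 2) ε x y * (-lapl u y)
    set J := ∫ y in ann N, u y
    set P := (ρ - r) ^ (-(N + 2) : ℝ)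
    set G := ∫ y, eta N ε x y * pd i (fun y => ζ y * u y) y
    have h11 : |G| ≤ (N - 2) * (I + D * P * J) := by
      rw [inv_mul_le_iff₀ hN2] at hb
      refine hb.trans (mul_le_mul_of_nonneg_left (by linarith) hN2.le)
    have h12 : c * |pd i u x| ≤ c + |G| := by
      rw [← abs_of_pos hc, ← abs_mul, abs_of_pos hc]
      have := abs_sub_abs_le_abs_sub (c * pd i u x) G
      rw [abs_sub_comm] at this
      linarith
    have h7 : |pd i u x| ≤ (c + (N - 2) * (I + D * P * J)) / c := by
      rw [le_div_iff₀ hc]; linarith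
    refine h7.trans ?_
    rw [div_le_iff₀ hc]
    have h8 : (1 + (1 + (N - 2)) * (1 + D) / c * I + (1 + (N - 2)) * (1 + D) / c * P * J) * c
      = c + (1 + (N - 2)) * (1 + D) * I + (1 + (N - 2)) * (1 + D) * (P * J) := by
      field_simp
    rw [h8]
    have h9 : 0 ≤ P * J := mul_nonneg hpow hIu
    have k1 : (N - 2 : ℝ) ≤ (1 + (N - 2)) * (1 + D) := by nlinarith
    have k2 : (N - 2 : ℝ) * D ≤ (1 + (N - 2)) * (1 + D) := by nlinarith
    have k3 := mul_le_mul_of_nonneg_right k1 h5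
    have k4 := mul_le_mul_of_nonneg_right k2 h9
    linarith

end Representation

section LowerBound

lemma hasDerivAt_primitive {g : ℝ → ℝ} (hg : Continuous g) (t : ℝ) :
    HasDerivAt (fun t => ∫ s in (0 : ℝ)..t, g s) (g t) t :=
  intervalIntegral.integral_hasDerivAt_right (hg.intervalIntegrable _ _)
    (hg.stronglyMeasurableAtFilter _ _) hg.continuousAt

lemma primitive_pos {g : ℝ → ℝ} (hg : Continuous g) (hpos : ∀ s, 0 < s → 0 < g s) {t : ℝ}
    (ht : 0 < t) : 0 < ∫ s in (0 : ℝ)..t, g s :=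
  intervalIntegral.intervalIntegral_pos_of_pos_on (hg.intervalIntegrable _ _)
    (fun s hs => hpos s hs.1) ht

lemma primitive_zero {g : ℝ → ℝ} (hz : ∀ s, s ≤ 0 → g s = 0) {t : ℝ}
    (ht : t ≤ 0) : ∫ s in (0 : ℝ)..t, g s = 0 := by
  rw [intervalIntegral.integral_congr (g := fun _ => (0 : ℝ))]
  · simp
  · intro s hs
    rw [uIcc_of_ge ht] at hs
    exact hz s hs.2

lemma contDiff_two_of_hasDerivAt {h h1 h2 : ℝ → ℝ} (a : ∀ t, HasDerivAt h (h1 t) t)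
    (b : ∀ t, HasDerivAt h1 (h2 t) t) (c : Continuous h2) : ContDiff ℝ 2 h := by
  have d1 : deriv h = h1 := funext fun t => (a t).deriv
  have d2 : deriv h1 = h2 := funext fun t => (b t).deriv
  rw [show (2 : WithTop ℕ∞) = 1 + 1 by norm_num, contDiff_succ_iff_deriv]
  refine ⟨fun t => (a t).differentiableAt, by simp, ?_⟩
  rw [d1, contDiff_one_iff_deriv, d2]
  exact ⟨fun t => (b t).differentiableAt, c⟩

/-- A convex, nondecreasing `C²` function with bounded slope vanishing exactly on `(-∞, 0]`. -/
lemma exists_truncation : ∃ h : ℝ → ℝ, ContDiff ℝ 2 h ∧ (∀ t, t ≤ 0 → h t = 0) ∧ Monotone h ∧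
    (∀ t, 0 < t → 0 < h t) ∧ (∀ t, 0 ≤ deriv h t ∧ deriv h t ≤ 1) ∧
    (∀ t, t ≤ 0 → deriv h t = 0) ∧
    (∀ t, 0 ≤ deriv (deriv h) t) ∧ (∀ t, 0 < t → 0 < deriv (deriv h) t) ∧
    Continuous (deriv (deriv h)) := by
  set m : ℝ → ℝ := fun t => max t 0 with hm
  have hmc : Continuous m := by fun_prop
  set φ : ℝ → ℝ := fun t => ∫ s in (0 : ℝ)..t, m s with hφ
  have hφd : ∀ t, HasDerivAt φ (m t) t := hasDerivAt_primitive hmc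
  have hm0 : ∀ t, t ≤ 0 → m t = 0 := fun t ht => max_eq_right ht
  have hmp : ∀ t, 0 < t → 0 < m t := fun t ht => lt_max_of_lt_left ht
  have hφ0 : ∀ t, t ≤ 0 → φ t = 0 := fun t ht => primitive_zero hm0 ht
  have hφp : ∀ t, 0 < t → 0 < φ t := fun t ht => primitive_pos hmc hmp ht
  have hφn : ∀ t, 0 ≤ φ t := fun t => by
    rcases le_or_gt t 0 with h | h
    · exact (hφ0 t h).ge
    · exact (hφp t h).le
  have hφc : Continuous φ := continuous_iff_continuousAt.2 fun t => (hφd t).continuousAt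
  set h1 : ℝ → ℝ := fun t => φ t / (1 + φ t) with hh1
  have hne : ∀ t, 1 + φ t ≠ 0 := fun t => by have := hφn t; positivity
  set h2 : ℝ → ℝ := fun t => m t / (1 + φ t) ^ 2 with hh2
  have hd1 : ∀ t, HasDerivAt h1 (h2 t) t := fun t => by
    have := (hφd t).div ((hφd t).const_add 1) (hne t)
    have e : (m t * (1 + φ t) - φ t * m t) / (1 + φ t) ^ 2 = h2 t := by
      rw [hh2]; congr 1; ring
    rw [e] at this
    exact this
  have h1c : Continuous h1 := continuous_iff_continuousAt.2 fun t => (hd1 t).continuousAt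
  have h2c : Continuous h2 := hmc.div ((continuous_const.add hφc).pow 2) fun t => pow_ne_zero 2
      (hne t)
  have h10 : ∀ t, t ≤ 0 → h1 t = 0 := fun t ht => by simp [hh1, hφ0 t ht]
  have h1p : ∀ t, 0 < t → 0 < h1 t := fun t ht => by have := hφp t ht; positivity
  have hd : ∀ t, HasDerivAt (fun t => ∫ s in (0 : ℝ)..t, h1 s) (h1 t) t := hasDerivAt_primitive h1c
  have e1 : deriv (fun t => ∫ s in (0 : ℝ)..t, h1 s) = h1 := funext fun t => (hd t).deriv
  have e2 : deriv h1 = h2 := funext fun t => (hd1 t).deriv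
  have h1n : ∀ t, 0 ≤ h1 t := fun t => by have := hφn t; positivity
  refine ⟨fun t => ∫ s in (0 : ℝ)..t, h1 s, contDiff_two_of_hasDerivAt hd hd1 h2c,
    fun t ht => primitive_zero h10 ht,
    monotone_of_deriv_nonneg (fun t => (hd t).differentiableAt) fun t => by rw [e1]; exact h1n t,
    fun t ht => primitive_pos h1c h1p ht, ?_, ?_, ?_, ?_, ?_⟩
  · intro t
    rw [e1]
    refine ⟨h1n t, ?_⟩
    have := hφn t
    exact div_le_one_of_le₀ (by linarith) (by linarith)
  · intro t ht; rw [e1]; exact h10 t ht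
  · intro t
    rw [e1, e2]
    have : 0 ≤ m t := le_max_right _ _
    positivity
  · intro t ht
    rw [e1, e2]
    have := hmp t ht
    have h3 := hφp t ht
    positivity
  · rw [e1, e2]; exact h2c

variable {N : ℕ}

lemma superharmonic_lower_bound (hN : 3 ≤ N) : ∃ C > 0, ∀ u : EN N → ℝ, ContDiff ℝ 2 u →
    (∀ y, ‖y‖ < 2 → 0 ≤ u y) → (∀ y, ‖y‖ < 2 → 0 ≤ -lapl u y) → ∀ x, ‖x‖ < 1 / 4 →
      C * ((∫ y in closedBall 0 1, -lapl u y) + ∫ y in ann N, u y) ≤ u x := by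
  obtain ⟨c, hc, Heta⟩ := eta_approx_eventually hN
  obtain ⟨h, hh, h0, hmono, hpos, hd1, hd0, hdd, hddp, hddc⟩ := exists_truncation
  obtain ⟨_, -, Hcut⟩ := exists_cutoff N
  obtain ⟨ζ, hζ, hζ0, hζ1, hζin, hζout, -⟩ := Hcut (7 / 4) (15 / 8) (by norm_num) (by norm_num)
    (by norm_num)
  have hN3 : (3 : ℝ) ≤ N := by exact_mod_cast hN
  set k : ℝ := (N - 2) / 2 with hk
  have hk0 : 0 < k := by rw [hk]; linarith
  set t0 : ℝ := (9 / 4) ^ (-k) with ht0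
  set t1 : ℝ := (13 / 8) ^ (-k) with ht1
  have ht01 : t0 < t1 := Real.rpow_lt_rpow_of_neg (by norm_num) (by norm_num) (by linarith)
  obtain ⟨κ, hκ, hκ'⟩ := (isCompact_Icc (a := t1 - t0)
      (b := (1 / 4) ^ (-(2 * k)) - t0)).exists_forall_le'
    hddc.continuousOn (a := 0) (fun t ht => hddp t (by linarith [ht.1]))
  set G : ℝ := (2 * k) ^ 2 * ((1 / 16) * ((13 / 8) ^ (-(k + 1)) : ℝ) ^ 2) with hG
  have hGp : 0 < G := by positivity
  have hhp : 0 < h (t1 - t0) := hpos _ (by linarith)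
  set m := min (h (t1 - t0)) (κ * G) with hm
  have hmp : 0 < m := lt_min hhp (by positivity)
  refine ⟨m / c, by positivity, fun u hu hu0 hlu x hx => ?_⟩
  rw [div_mul_eq_mul_div, div_le_iff₀ hc, mul_comm (u x)]
  refine le_of_forall_pos_le_add fun δ hδ => ?_
  have hζc : HasCompactSupport ζ := hasCompactSupport_of_zero_outside hζout
  have ev := Heta (fun y => ζ y * u y) (hζ.continuous.mul hu.continuous) hζc.mul_right δ hδ
  have ev2 : ∀ᶠ ε in 𝓝[>] (0 : ℝ), ε ∈ Ioo (0 : ℝ) (1 / 4) := Ioo_mem_nhdsGT (by norm_num)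
  obtain ⟨ε, ⟨hε, hap⟩, -, hε4⟩ := (ev.and ev2).exists
  have hap := (abs_le.1 (hap x)).2
  rw [hζin x (by linarith), one_mul] at hap
  set Γ := rker k ε x with hΓ
  have hΓC : ContDiff ℝ 2 Γ := rker_contDiff _ hε x
  have hΓfar : ∀ y, 7 / 4 ≤ ‖y‖ → Γ y - t0 ≤ 0 := by
    intro y hy
    have h1 : 3 / 2 ≤ ‖y - x‖ := by
      have := norm_sub_norm_le y x
      linarith
    have := rker_le (ε := ε) hk0.le (by norm_num) h1
    have h2 : ((3 / 2 : ℝ)) ^ (-(2 * k)) = t0 := by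
      rw [ht0, show -(2 * k) = 2 * (-k) by ring, Real.rpow_mul (by norm_num)]
      norm_num
    rw [h2] at this
    linarith
  have hker : ∀ j : ℝ, 0 ≤ j → ∀ y, ‖y‖ ≤ 1 → (13 / 8 : ℝ) ^ (-j) ≤ rker j ε x y := by
    intro j hj y hy
    have h1 : ‖y - x‖ ≤ 5 / 4 := by
      have := norm_sub_le y x
      linarith
    refine Real.rpow_le_rpow_of_nonpos (rker_base_pos hε x y) ?_ (by linarith)
    nlinarith [norm_nonneg (y - x)]
  set Θ : EN N → ℝ := fun y => h (Γ y - t0) with hΘ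
  have hΘC : ContDiff ℝ 2 Θ := hh.comp (hΓC.sub contDiff_const)
  have hΘout : ∀ y, 7 / 4 ≤ ‖y‖ → Θ y = 0 := fun y hy => h0 _ (hΓfar y hy)
  have hΘc : HasCompactSupport Θ := hasCompactSupport_of_zero_outside hΘout
  have hΘ0 : ∀ y, 0 ≤ Θ y := fun y => by
    rcases le_or_gt (Γ y - t0) 0 with hh | hh
    · exact (h0 _ hh).ge
    · exact (hpos _ hh).le
  have hpd : ∀ y i, pd i (fun y => Γ y - t0) y = pd i Γ y := fun y i => by
    rw [pd_sub (hΓC.differentiable (by norm_num) y) (by fun_prop), pd_const, sub_zero]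
  have hlΘ : ∀ y, lapl Θ y = deriv (deriv h) (Γ y - t0) * ∑ i, pd i Γ y ^ 2
      - deriv h (Γ y - t0) * eta N ε x y := by
    intro y
    have h1 := lapl_comp hh (hΓC.sub (contDiff_const (c := t0))) y
    have h2 : lapl (fun y => Γ y - t0) y = lapl Γ y := by
      unfold lapl
      refine Finset.sum_congr rfl fun i _ => ?_
      rw [show pd i (fun y => Γ y - t0) = pd i Γ from funext fun y => hpd y i]
    rw [hΘ, h1, h2, hΓ, hk, lapl_rker hε, ← hk, ← hΓ]
    simp_rw [hpd]
    ring
  have hgreen := integral_mul_lapl hu hΘC hΘc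
  set S : EN N → ℝ := fun y => Θ y * (-lapl u y)
    + u y * (deriv (deriv h) (Γ y - t0) * ∑ i, pd i Γ y ^ 2) with hS
  have hddΓ : Continuous fun y => deriv (deriv h) (Γ y - t0) * ∑ i, pd i Γ y ^ 2 := by
    refine (hddc.comp (hΓC.continuous.sub continuous_const)).mul
      (continuous_finsetSum _ fun i _ => ?_)
    exact (pd_continuous i (hΓC.of_le (by norm_num))).pow 2
  have hdh : Continuous (deriv h) := hh.continuous_deriv (by norm_num)
  have hi1 : Integrable fun y => u y * lapl Θ y :=
    (hu.continuous.mul (lapl_continuous hΘC)).integrable_of_hasCompactSupport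
      (HasCompactSupport.intro hΘc fun y hy => by
        rw [Pi.mul_apply, lapl_eq_zero_of_notMem hy, mul_zero])
  have hi2 : Integrable fun y => Θ y * lapl u y :=
    (hΘC.continuous.mul (lapl_continuous hu)).integrable_of_hasCompactSupport hΘc.mul_right
  have hi3 : Integrable fun y => u y * (deriv h (Γ y - t0) * eta N ε x y) := by
    refine (hu.continuous.mul ((hdh.comp (hΓC.continuous.sub continuous_const)).mul
      (eta_continuous hε x))).integrable_of_hasCompactSupport
      (hasCompactSupport_of_zero_outside (R := 7 / 4) fun y hy => ?_)
    change u y * (deriv h (Γ y - t0) * eta N ε x y) = 0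
    rw [hd0 _ (hΓfar y hy)]; ring
  have hSeq : ∀ y, S y = u y * (deriv h (Γ y - t0) * eta N ε x y)
      + (u y * lapl Θ y - Θ y * lapl u y) := by
    intro y; rw [hS, hlΘ]; ring
  have hSi : Integrable S := by
    rw [show S = _ from funext hSeq]; exact hi3.add (hi1.sub hi2)
  have hSint : ∫ y, S y = ∫ y, u y * (deriv h (Γ y - t0) * eta N ε x y) := by
    have h1 := integral_add hi3 (hi1.sub hi2)
    have h2 := integral_sub hi1 hi2
    rw [hgreen, sub_self] at h2
    rw [show S = _ from funext hSeq]
    exact h1.trans (by rw [show ∫ y, ((fun y => u y * lapl Θ y) - fun y => Θ y * lapl u y) y = 0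
      from h2, add_zero])
  have hup : ∫ y, u y * (deriv h (Γ y - t0) * eta N ε x y) ≤ ∫ y, eta N ε x y * (ζ y * u y) := by
    refine integral_mono hi3 ?_ fun y => ?_
    · exact ((eta_continuous hε x).mul
          (hζ.continuous.mul hu.continuous)).integrable_of_hasCompactSupport
        (HasCompactSupport.mul_left hζc.mul_right)
    · have he := eta_nonneg hN hε x y
      have hζu : 0 ≤ ζ y * u y := by
        rcases lt_or_ge ‖y‖ 2 with h2 | h2
        · exact mul_nonneg (hζ0 y) (hu0 y h2)
        · rw [hζout y (by linarith), zero_mul]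
      rcases lt_or_ge ‖y‖ (7 / 4) with h2 | h2
      · simp only
        rw [hζin y h2.le]
        have h3 := hu0 y (by linarith)
        have h4 := (hd1 (Γ y - t0)).2
        have h5 := mul_nonneg he h3
        nlinarith
      · simp only
        rw [hd0 _ (hΓfar y h2)]
        have := mul_nonneg he hζu
        linarith
  have hS0 : ∀ y, 0 ≤ S y := by
    intro y
    rcases lt_or_ge ‖y‖ (7 / 4) with h2 | h2
    · have h3 := hu0 y (by linarith)
      have h4 := hlu y (by linarith)
      have h5 := hΘ0 y
      have h6 := hdd (Γ y - t0)
      have h7 : 0 ≤ ∑ i, pd i Γ y ^ 2 := Finset.sum_nonneg fun i _ => sq_nonneg _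
      rw [hS]
      positivity
    · have h3 : deriv (deriv h) (Γ y - t0) = 0 ∨ 0 < Γ y - t0 := by
        left
        have hz : ∀ t, t ≤ 0 → deriv (deriv h) t = 0 := by
          intro t ht
          have hdiff : DifferentiableAt ℝ (deriv h) t := by
            have := (contDiff_succ_iff_deriv (𝕜 := ℝ) (n := 1) (f := h)).1
                (by simpa [one_add_one_eq_two] using hh)
            exact this.2.2.differentiable (by norm_num) t
          have hmin : IsLocalMin (deriv h) t :=
            Eventually.of_forall fun s => by rw [hd0 t ht]; exact (hd1 s).1
          exact hmin.deriv_eq_zero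
        exact hz _ (hΓfar y h2)
      rcases h3 with h3 | h3
      · rw [hS]; simp only; rw [h3, hΘout y h2]; simp
      · linarith [hΓfar y h2]
  have hlow : m * ((∫ y in closedBall 0 1, -lapl u y) + ∫ y in ann N, u y) ≤ ∫ y, S y := by
    rw [mul_add, ← integral_const_mul, ← integral_const_mul,
      ← integral_indicator measurableSet_closedBall, ← integral_indicator measurableSet_ann,
      ← integral_add]
    rotate_left
    · exact (integrable_indicator_iff measurableSet_closedBall).2
        (((lapl_continuous hu).neg.integrableOn_closedBall 1).const_mul _)
    · exact (integrable_indicator_iff measurableSet_ann).2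
        ((hu.continuous.integrableOn_ann).const_mul _)
    refine integral_mono_of_nonneg ?_ hSi (Eventually.of_forall fun y => ?_)
    · refine Eventually.of_forall fun y => add_nonneg (indicator_nonneg (fun z hz => ?_) y)
        (indicator_nonneg (fun z hz => ?_) y)
      · rw [mem_closedBall_zero_iff] at hz
        exact mul_nonneg hmp.le (hlu z (by linarith))
      · have hz := hz.1
        rw [mem_closedBall_zero_iff] at hz
        exact mul_nonneg hmp.le (hu0 z (by linarith))
    · beta_reduce
      by_cases hy : y ∈ closedBall (0 : EN N) 1
      · have hy1 := hy
        rw [mem_closedBall_zero_iff] at hy1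
        have hlow1 : t1 - t0 ≤ Γ y - t0 := by linarith [hker k hk0.le y hy1]
        have h3 := hu0 y (by linarith)
        have h4 := hlu y (by linarith)
        have h6 := hdd (Γ y - t0)
        have h7 : 0 ≤ ∑ i, pd i Γ y ^ 2 := Finset.sum_nonneg fun i _ => sq_nonneg _
        simp only [hS]
        rw [indicator_of_mem hy]
        refine add_le_add (mul_le_mul_of_nonneg_right
          ((min_le_left _ _).trans (hmono hlow1)) h4) ?_
        by_cases hya : y ∈ ann N
        · rw [indicator_of_mem hya, mul_comm]
          refine mul_le_mul_of_nonneg_left ((min_le_right _ _).trans ?_) h3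
          have hyx : 1 / 4 ≤ ‖y - x‖ := by
            have := norm_sub_norm_le y x
            have h8 : 1 / 2 ≤ ‖y‖ := by simpa using hya.2
            linarith
          have hsum : ∑ i, pd i Γ y ^ 2 = (2 * k) ^ 2 * (‖y - x‖ ^ 2 * rker (k + 1) ε x y ^ 2) := by
            rw [EuclideanSpace.norm_sq_eq, Finset.sum_mul, Finset.mul_sum]
            refine Finset.sum_congr rfl fun i _ => ?_
            rw [hΓ, pd_rker _ hε]
            simp only [PiLp.sub_apply, Real.norm_eq_abs, sq_abs]
            ring
          refine mul_le_mul (hκ' _ ⟨hlow1, ?_⟩) ?_ hGp.le h6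
          · have := rker_le (ε := ε) hk0.le (by norm_num) hyx
            linarith
          · rw [hsum, hG]
            have := hker (k + 1) (by linarith) y hy1
            gcongr
            nlinarith
        · rw [indicator_of_notMem hya]
          positivity
      · have hya : y ∉ ann N := fun hya => hy hya.1
        rw [indicator_of_notMem hy, indicator_of_notMem hya, add_zero]
        exact hS0 y
  calc _ ≤ ∫ y, S y := hlow
    _ ≤ ∫ y, eta N ε x y * (ζ y * u y) := hSint.le.trans hup
    _ ≤ c * u x + δ := by linarith

end LowerBound

section Apriori

variable {N : ℕ} {p q κ : ℝ}

/-- Positive solutions on the ball of radius two of the system with slowly varying coefficients. -/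
structure Sol (p q κ : ℝ) (c d u v : EN N → ℝ) : Prop where
  cu : ContDiff ℝ 2 u
  cv : ContDiff ℝ 2 v
  pu : ∀ y, 0 < u y
  pv : ∀ y, 0 < v y
  cc : ContDiff ℝ 1 c
  cd : ContDiff ℝ 1 d
  bc : ∀ y, ‖y‖ < 2 → 1 / 2 ≤ c y ∧ c y ≤ 2
  bd : ∀ y, ‖y‖ < 2 → 1 / 2 ≤ d y ∧ d y ≤ 2
  gc : ∀ y, ‖y‖ < 2 → ∀ i, |pd i c y| ≤ κ
  gd : ∀ y, ‖y‖ < 2 → ∀ i, |pd i d y| ≤ κ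
  eu : ∀ y, ‖y‖ < 2 → -lapl u y = c y * v y ^ p
  ev : ∀ y, ‖y‖ < 2 → -lapl v y = d y * u y ^ q

namespace Sol

variable {c d u v : EN N → ℝ}

lemma swap (h : Sol p q κ c d u v) : Sol q p κ d c v u :=
  ⟨h.cv, h.cu, h.pv, h.pu, h.cd, h.cc, h.bd, h.bc, h.gd, h.gc, h.ev, h.eu⟩

lemma upow_cont (h : Sol p q κ c d u v) (s : ℝ) : Continuous fun y => u y ^ s :=
  h.cu.continuous.rpow_const fun y => Or.inl (h.pu y).ne'

lemma vpow_cont (h : Sol p q κ c d u v) (s : ℝ) : Continuous fun y => v y ^ s := h.swap.upow_cont s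

lemma lapl_nonneg (h : Sol p q κ c d u v) : ∀ y, ‖y‖ < 2 → 0 ≤ -lapl u y := fun y hy => by
  rw [h.eu y hy]
  have := (h.bc y hy).1
  have := Real.rpow_pos_of_pos (h.pv y) p
  positivity

lemma lapl_lower (h : Sol p q κ c d u v) : ∀ y, ‖y‖ < 2 → v y ^ p ≤ 2 * (-lapl u y) :=
    fun y hy => by
  rw [h.eu y hy]
  have := (h.bc y hy).1
  have := Real.rpow_pos_of_pos (h.pv y) p
  nlinarith

lemma lapl_upper (h : Sol p q κ c d u v) : ∀ y, ‖y‖ < 2 → -lapl u y ≤ 2 * v y ^ p := fun y hy => by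
  rw [h.eu y hy]
  have := (h.bc y hy).2
  have := Real.rpow_pos_of_pos (h.pv y) p
  nlinarith

lemma exists_min (h : Sol p q κ c d u v) :
    ∃ x : EN N, ‖x‖ ≤ 1 / 8 ∧ ∀ y, ‖y‖ ≤ 1 / 8 → u x ≤ u y := by
  obtain ⟨x, hx, hm⟩ := (isCompact_closedBall (0 : EN N) (1 / 8)).exists_isMinOn
    ⟨0, by simp⟩ h.cu.continuous.continuousOn
  refine ⟨x, by simpa using hx, fun y hy => hm (by simpa using hy)⟩

end Sol

lemma setIntegral_le_of_subset {g : EN N → ℝ} {s t : Set (EN N)} (hst : s ⊆ t)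
    (ht : MeasurableSet t) (hg : IntegrableOn g t) (h0 : ∀ y ∈ t, 0 ≤ g y) :
    ∫ y in s, g y ≤ ∫ y in t, g y :=
  setIntegral_mono_set hg ((ae_restrict_iff' ht).2 (Eventually.of_forall h0))
    (Eventually.of_forall hst)

lemma exists_harnack_constant (hN : 3 ≤ N) (p : ℝ) (hp : 0 < p) : ∃ B > 0, ∀ (q κ : ℝ)
    (c d u v : EN N → ℝ), Sol p q κ c d u v → ∀ x, ‖x‖ ≤ 1 / 8 →
      B * (∫ y in closedBall 0 1, v y ^ p) ≤ u x ∧ B * (∫ y in ann N, u y) ≤ u x ∧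
      ∀ m, 0 ≤ m → (∀ y, ‖y‖ ≤ 1 / 8 → m ≤ v y) → B * m ^ p ≤ u x := by
  obtain ⟨C, hC, H⟩ := superharmonic_lower_bound hN
  set V := (volume (closedBall (0 : EN N) (1 / 8))).toReal with hV
  have hVp : 0 < V := ENNReal.toReal_pos (measure_closedBall_pos _ _ (by norm_num)).ne'
    measure_closedBall_lt_top.ne
  set B := C / 2 * min 1 V with hB
  have hBp : 0 < B := mul_pos (by positivity) (lt_min one_pos hVp)
  have hB1 : B ≤ C / 2 := mul_le_of_le_one_right (by positivity) (min_le_left _ _)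
  have hB2 : B ≤ C / 2 * V := mul_le_mul_of_nonneg_left (min_le_right _ _) (by positivity)
  refine ⟨B, hBp, fun q κ c d u v h x hx => ?_⟩
  have h1 := H u h.cu (fun y _ => (h.pu y).le) h.lapl_nonneg x (by linarith)
  set I := ∫ y in closedBall (0 : EN N) 1, v y ^ p with hI
  set J := ∫ y in ann N, u y with hJ
  set L := ∫ y in closedBall 0 1, -lapl u y with hL
  have hI0 : 0 ≤ I := setIntegral_nonneg measurableSet_closedBall fun y _ =>
    (Real.rpow_pos_of_pos (h.pv y) p).le
  have hJ0 : 0 ≤ J := setIntegral_nonneg measurableSet_ann fun y _ => (h.pu y).le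
  have hIL : I ≤ 2 * L := by
    rw [hI, hL, ← integral_const_mul]
    refine setIntegral_mono_on ((h.vpow_cont p).integrableOn_closedBall 1)
      (((lapl_continuous h.cu).neg.integrableOn_closedBall 1).const_mul _)
      measurableSet_closedBall fun y hy => ?_
    rw [mem_closedBall_zero_iff] at hy
    exact h.lapl_lower y (by linarith)
  have h2 : C / 2 * I + C * J ≤ u x := by nlinarith
  refine ⟨?_, ?_, fun m hm hmv => ?_⟩
  · nlinarith
  · nlinarith
  · have h3 : V * m ^ p ≤ I := by
      have : V * m ^ p = ∫ y in closedBall (0 : EN N) (1 / 8), m ^ p := by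
        rw [setIntegral_const, smul_eq_mul, hV]; rfl
      rw [this]
      refine le_trans ?_ (setIntegral_le_of_subset
        (closedBall_subset_closedBall (by norm_num : (1 / 8 : ℝ) ≤ 1)) measurableSet_closedBall
        ((h.vpow_cont p).integrableOn_closedBall 1)
        fun y _ => (Real.rpow_pos_of_pos (h.pv y) p).le)
      refine setIntegral_mono_on (continuous_const.integrableOn_closedBall _)
        ((h.vpow_cont p).integrableOn_closedBall _) measurableSet_closedBall fun y hy => ?_
      rw [mem_closedBall_zero_iff] at hy
      exact Real.rpow_le_rpow hm (hmv y hy) hp.le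
    have h4 : 0 ≤ m ^ p := Real.rpow_nonneg hm p
    nlinarith

lemma apriori_half (hN : 3 ≤ N) (hp : 0 < p) (hq : 0 < q) (hpq : 1 < p * q) : ∃ C > 0,
    ∀ (κ : ℝ) (c d u v : EN N → ℝ), Sol p q κ c d u v →
      (∫ y in closedBall 0 1, v y ^ p) ≤ C ∧ (∫ y in ann N, u y) ≤ C := by
  obtain ⟨A, hA, HA⟩ := exists_harnack_constant hN p hp
  obtain ⟨B, hB, HB⟩ := exists_harnack_constant hN q hq
  refine ⟨(1 / (A * B ^ p)) ^ (1 / (p * q - 1)) / A, by positivity, fun κ c d u v h => ?_⟩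
  obtain ⟨x, hx, hxm⟩ := h.exists_min
  obtain ⟨z, hz, hzm⟩ := h.swap.exists_min
  obtain ⟨h1, h2, h3⟩ := HA q κ c d u v h x hx
  obtain ⟨-, -, h4⟩ := HB p κ d c v u h.swap z hz
  have h5 := h3 (v z) (h.pv z).le hzm
  have h6 := h4 (u x) (h.pu x).le hxm
  have hux := h.pu x
  have h7 : A * B ^ p * u x ^ (p * q) ≤ u x := by
    refine le_trans ?_ h5
    rw [mul_assoc]
    refine mul_le_mul_of_nonneg_left ?_ hA.le
    rw [mul_comm p q, Real.rpow_mul hux.le, ← Real.mul_rpow hB.le (by positivity)]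
    exact Real.rpow_le_rpow (by positivity) h6 hp.le
  have h8 : u x ^ (p * q - 1) ≤ 1 / (A * B ^ p) := by
    rw [Real.rpow_sub hux, Real.rpow_one, div_le_div_iff₀ hux (by positivity)]
    linarith
  have h9 : u x ≤ (1 / (A * B ^ p)) ^ (1 / (p * q - 1)) := by
    have := Real.rpow_le_rpow (by positivity) h8 (by
      have : 0 < p * q - 1 := by linarith
      positivity : 0 ≤ 1 / (p * q - 1))
    rwa [← Real.rpow_mul hux.le, mul_one_div_cancel (by linarith), Real.rpow_one] at this
  constructor
  · rw [le_div_iff₀ hA]; linarith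
  · rw [le_div_iff₀ hA]; linarith

end Apriori

section SlicePotential

variable {N : ℕ}

lemma integral_swap_of_isCompact {X Y : Type*} [TopologicalSpace X] [MeasurableSpace X]
    [TopologicalSpace Y] [MeasurableSpace Y] [OpensMeasurableSpace (X × Y)]
    [SecondCountableTopologyEither (X × Y) ℝ] [T2Space X] [T2Space Y]
    [OpensMeasurableSpace X] [OpensMeasurableSpace Y]
    {μ : Measure X} {ν : Measure Y} [SFinite μ] [SFinite ν]
    [IsLocallyFiniteMeasure μ] [IsLocallyFiniteMeasure ν]
    {f : X → Y → ℝ} (hf : Continuous f.uncurry) {s : Set X} {t : Set Y} (hs : IsCompact s)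
    (ht : IsCompact t) :
    ∫ x in s, ∫ y in t, f x y ∂ν ∂μ = ∫ y in t, ∫ x in s, f x y ∂μ ∂ν := by
  refine integral_integral_swap ?_
  rw [Measure.prod_restrict]
  exact hf.continuousOn.integrableOn_compact (hs.prod ht)

/-- Three-function Hölder inequality, with upper bounds in place of the integrals. -/
lemma integral_mul_mul_le {X : Type*} [MeasurableSpace X] {μ : Measure X} {A B D : X → ℝ}
    (hA : Integrable A μ) (hB : Integrable B μ) (hD : Integrable D μ)
    (h : ∀ᵐ x ∂μ, 0 ≤ A x ∧ 0 ≤ B x ∧ 0 ≤ D x)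
    {a b d w₁ w₂ w₃ : ℝ} (ha : 0 < a) (hb : 0 < b) (hd : 0 < d)
    (hAa : ∫ x, A x ∂μ ≤ a) (hBb : ∫ x, B x ∂μ ≤ b) (hDd : ∫ x, D x ∂μ ≤ d)
    (h1 : 0 ≤ w₁) (h2 : 0 ≤ w₂) (h3 : 0 ≤ w₃) (hw : w₁ + w₂ + w₃ = 1) :
    ∫ x, A x ^ w₁ * B x ^ w₂ * D x ^ w₃ ∂μ ≤ a ^ w₁ * b ^ w₂ * d ^ w₃ := by
  set M := a ^ w₁ * b ^ w₂ * d ^ w₃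
  have hM : 0 < M := by positivity
  have hle : ∀ᵐ x ∂μ, A x ^ w₁ * B x ^ w₂ * D x ^ w₃
      ≤ M * (w₁ / a * A x + w₂ / b * B x + w₃ / d * D x) := by
    filter_upwards [h] with x hx
    obtain ⟨hA, hB, hD⟩ := hx
    have := Real.geom_mean_le_arith_mean3_weighted h1 h2 h3 (div_nonneg hA ha.le)
      (div_nonneg hB hb.le) (div_nonneg hD hd.le) hw
    rw [Real.div_rpow hA ha.le, Real.div_rpow hB hb.le, Real.div_rpow hD hd.le,
      div_mul_div_comm, div_mul_div_comm, div_le_iff₀ hM] at this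
    calc _ ≤ _ := this
      _ = _ := by ring
  have hI : Integrable (fun x => M * (w₁ / a * A x + w₂ / b * B x + w₃ / d * D x)) μ :=
    (((hA.const_mul _).add (hB.const_mul _)).add (hD.const_mul _)).const_mul _
  have h0 : ∀ᵐ x ∂μ, 0 ≤ A x ^ w₁ * B x ^ w₂ * D x ^ w₃ := by
    filter_upwards [h] with x hx
    obtain ⟨hA, hB, hD⟩ := hx
    positivity
  refine (integral_mono_of_nonneg h0 hI hle).trans ?_
  have hs : ∫ x, (w₁ / a * A x + w₂ / b * B x + w₃ / d * D x) ∂μ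
      = w₁ / a * (∫ x, A x ∂μ) + w₂ / b * (∫ x, B x ∂μ) + w₃ / d * ∫ x, D x ∂μ := by
    rw [integral_add (f := fun x => w₁ / a * A x + w₂ / b * B x)
      ((hA.const_mul _).add (hB.const_mul _)) (hD.const_mul _),
      integral_add (hA.const_mul _) (hB.const_mul _)]
    simp only [integral_const_mul]
  rw [integral_const_mul, hs]
  have e1 : w₁ / a * ∫ x, A x ∂μ ≤ w₁ := by
    rw [div_mul_eq_mul_div, div_le_iff₀ ha]; gcongr
  have e2 : w₂ / b * ∫ x, B x ∂μ ≤ w₂ := by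
    rw [div_mul_eq_mul_div, div_le_iff₀ hb]; gcongr
  have e3 : w₃ / d * ∫ x, D x ∂μ ≤ w₃ := by
    rw [div_mul_eq_mul_div, div_le_iff₀ hd]; gcongr
  nlinarith

lemma exists_rker_integral_bound (hN : 3 ≤ N) {τ : ℝ} (h0 : 0 < τ) (h1 : τ < 1) :
    ∃ K : ℝ, 0 < K ∧ ∀ ρ : ℝ, ρ ≤ 1 → ∀ ε : ℝ, 0 < ε → ∀ x : EN N, ‖x‖ ≤ 1 →
      ∫ y in closedBall 0 ρ, rker (N * τ / 2) ε x y ≤ K := by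
  have hd : Module.finrank ℝ (EN N) = N := by simp
  have hN' : (0 : ℝ) < N := by positivity
  have hi : IntegrableOn (fun z : EN N => ‖z‖ ^ (-(N * τ))) (ball 0 3) := by
    refine integrableOn_ball_of_norm_le_rpow (C := 1) (α := N * τ) (by rw [hd]; omega) ?_ ?_ ?_
    · rw [hd]; nlinarith
    · refine .of_forall fun x => ?_
      rw [one_mul, Real.norm_of_nonneg (by positivity)]
    · exact (measurable_norm.pow_const _).aestronglyMeasurable
  set F : EN N → ℝ := (ball 0 3).indicator fun z => ‖z‖ ^ (-(N * τ)) with hFdef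
  have hF : Integrable F := (integrable_indicator_iff measurableSet_ball).2 hi
  refine ⟨(∫ z, F z) + 1, ?_, fun ρ hρ ε hε x hx => ?_⟩
  · have : 0 ≤ ∫ z, F z := integral_nonneg (indicator_nonneg fun z _ => by positivity)
    linarith
  have hFx : Integrable (fun y => F (y - x)) := hF.comp_sub_right x
  have hF0 : ∀ z, 0 ≤ F z := indicator_nonneg fun z _ => by positivity
  have hle : ∀ᵐ y ∂(volume.restrict (closedBall (0 : EN N) ρ)),
      rker (N * τ / 2) ε x y ≤ F (y - x) := by
    have : Nonempty (Fin N) := ⟨⟨0, by omega⟩⟩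
    have hae : ∀ᵐ y ∂(volume : Measure (EN N)), y ≠ x := by
      simp [ae_iff, measure_singleton]
    filter_upwards [ae_restrict_mem measurableSet_closedBall, ae_restrict_of_ae hae] with y hy hyx
    rw [mem_closedBall_zero_iff] at hy
    have hpos : 0 < ‖y - x‖ := norm_pos_iff.2 (sub_ne_zero.2 hyx)
    have hmem : y - x ∈ ball (0 : EN N) 3 := by
      rw [mem_ball_zero_iff]
      have := norm_sub_le y x
      linarith
    rw [hFdef, indicator_of_mem hmem]
    have := rker_le (k := N * τ / 2) (ε := ε) (by positivity) hpos (le_refl _)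
    rwa [show -(2 * (N * τ / 2)) = -(N * τ) by ring] at this
  have e1 := integral_mono_of_nonneg (.of_forall fun y => (rker_pos hε x y).le)
    hFx.integrableOn hle
  have e2 := setIntegral_le_integral (s := closedBall (0 : EN N) ρ) hFx
    (.of_forall fun y => hF0 _)
  have e3 : ∫ y, F (y - x) = ∫ z, F z := integral_sub_right_eq_self F x
  linarith

end SlicePotential

section SlicePotential

variable {N : ℕ}

/-- Regularised one-dimensional Riesz potential, in the variable `‖x‖ ^ 2`, of a density. -/
noncomputable def slicePot (ρ ε τ : ℝ) (G : EN N → ℝ) (t : ℝ) : ℝ :=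
  ∫ y in closedBall 0 ρ, ((t - ‖y‖ ^ 2) ^ 2 / 4 + ε ^ 2) ^ (-(τ / 2)) * G y

lemma rker_continuous (k : ℝ) {ε : ℝ} (hε : 0 < ε) (z : EN N) : Continuous (rker k ε z) :=
  (rker_contDiff (n := 0) k hε z).continuous

lemma slice_base_pos {ε : ℝ} (hε : 0 < ε) (t : ℝ) (y : EN N) :
    0 < (t - ‖y‖ ^ 2) ^ 2 / 4 + ε ^ 2 := by positivity

lemma slice_base_le {x y : EN N} (hx : ‖x‖ ≤ 1) (hy : ‖y‖ ≤ 1) (ε : ℝ) :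
    (‖x‖ ^ 2 - ‖y‖ ^ 2) ^ 2 / 4 + ε ^ 2 ≤ ‖y - x‖ ^ 2 + ε ^ 2 := by
  have h1 : |‖x‖ - ‖y‖| ≤ ‖y - x‖ := by
    rw [norm_sub_rev]; exact abs_norm_sub_norm_le x y
  have h2 : (‖x‖ - ‖y‖) ^ 2 ≤ ‖y - x‖ ^ 2 := by
    rw [← sq_abs]; gcongr
  have h3 : (‖x‖ + ‖y‖) ^ 2 ≤ 4 := by
    nlinarith [norm_nonneg x, norm_nonneg y]
  have h4 : (‖x‖ ^ 2 - ‖y‖ ^ 2) ^ 2 = (‖x‖ - ‖y‖) ^ 2 * (‖x‖ + ‖y‖) ^ 2 := by ring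
  nlinarith [sq_nonneg (‖x‖ - ‖y‖)]

lemma slice_kernel_continuous {ε : ℝ} (hε : 0 < ε) (τ : ℝ) {G : EN N → ℝ} (hG : Continuous G) :
    Continuous (fun p : ℝ × EN N =>
      ((p.1 - ‖p.2‖ ^ 2) ^ 2 / 4 + ε ^ 2) ^ (-(τ / 2)) * G p.2) :=
  (Continuous.rpow_const (by fun_prop) fun p => Or.inl (slice_base_pos hε p.1 p.2).ne').mul
    (hG.comp continuous_snd)

lemma slicePot_continuous {ε : ℝ} (hε : 0 < ε) (ρ τ : ℝ) {G : EN N → ℝ} (hG : Continuous G) :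
    Continuous (slicePot ρ ε τ G) :=
  continuous_parametric_integral_of_continuous (slice_kernel_continuous hε τ hG)
    (isCompact_closedBall 0 ρ)

lemma rker_mul_le_of_slice {τ s z h ε : ℝ} (hs : 1 ≤ s) (hsz : s ≤ z)
    (hh : h ≤ τ * (N - (N - 1) * (1 / s - 1 / z))) (hτ : 0 ≤ τ) (h0 : 0 < ε) (h1 : ε < 1)
    {x y : EN N} (hx : ‖x‖ ≤ 1) (hy : ‖y‖ ≤ 1) {F : ℝ} (hF : 0 ≤ F) :
    rker (h / 2) ε x y * F ≤
      5 ^ ((τ * (N - (N - 1) * (1 / s - 1 / z)) - h) / 2)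
      * ((rker (N * τ / 2) ε x y * F ^ s) ^ (1 / z) * rker (N * τ / 2) ε x y ^ (1 - 1 / s)
      * (((‖x‖ ^ 2 - ‖y‖ ^ 2) ^ 2 / 4 + ε ^ 2) ^ (-(τ / 2)) * F ^ s) ^ (1 / s - 1 / z)) := by
  have hs0 : 0 < s := by linarith
  have hz0 : 0 < z := by linarith
  have hsz' : 0 ≤ 1 / s - 1 / z := by
    have := one_div_le_one_div_of_le hs0 hsz; linarith
  set H := τ * (N - (N - 1) * (1 / s - 1 / z)) with hH
  have hL := rker_base_pos h0 x y
  have hm := slice_base_pos h0 (‖x‖ ^ 2) y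
  have hmL := slice_base_le hx hy ε
  unfold rker
  set L := ‖y - x‖ ^ 2 + ε ^ 2 with hLdef
  set m := (‖x‖ ^ 2 - ‖y‖ ^ 2) ^ 2 / 4 + ε ^ 2
  have hL5 : L ≤ 5 := by
    have h2 := norm_sub_le y x
    have h3 : ‖y - x‖ ≤ 2 := by linarith
    have h4 : ‖y - x‖ ^ 2 ≤ 4 := by nlinarith [norm_nonneg (y - x)]
    rw [hLdef]; nlinarith
  have e1 : L ^ (-(h / 2)) = L ^ ((H - h) / 2) * L ^ (-(H / 2)) := by
    rw [← Real.rpow_add hL]; congr 1; ring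
  have e2 : L ^ ((H - h) / 2) ≤ 5 ^ ((H - h) / 2) :=
    Real.rpow_le_rpow hL.le hL5 (by linarith)
  have e3 : (L ^ (-(τ / 2)) * F ^ s) ^ (1 / s - 1 / z)
      ≤ (m ^ (-(τ / 2)) * F ^ s) ^ (1 / s - 1 / z) := by
    refine Real.rpow_le_rpow (by positivity) ?_ hsz'
    refine mul_le_mul_of_nonneg_right ?_ (by positivity)
    exact Real.rpow_le_rpow_of_nonpos hm hmL (by linarith)
  have e4 : L ^ (-(H / 2)) * F = (L ^ (-(N * τ / 2)) * F ^ s) ^ (1 / z)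
      * (L ^ (-(N * τ / 2))) ^ (1 - 1 / s) * (L ^ (-(τ / 2)) * F ^ s) ^ (1 / s - 1 / z) := by
    have f1 : F = (F ^ s) ^ (1 / z) * (F ^ s) ^ (1 / s - 1 / z) := by
      rw [← Real.rpow_add_of_nonneg (by positivity) (by positivity) hsz', ← Real.rpow_mul hF,
        show s * (1 / z + (1 / s - 1 / z)) = 1 by field_simp; ring, Real.rpow_one]
    have f2 : L ^ (-(H / 2)) = (L ^ (-(N * τ / 2))) ^ (1 / z) * (L ^ (-(N * τ / 2))) ^ (1 - 1 / s)
        * (L ^ (-(τ / 2))) ^ (1 / s - 1 / z) := by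
      rw [← Real.rpow_mul hL.le, ← Real.rpow_mul hL.le, ← Real.rpow_mul hL.le,
        ← Real.rpow_add hL, ← Real.rpow_add hL, hH]
      congr 1; ring
    rw [Real.mul_rpow (by positivity) (by positivity),
      Real.mul_rpow (by positivity) (by positivity), f2]
    conv_lhs => rw [f1]
    ring
  calc L ^ (-(h / 2)) * F = L ^ ((H - h) / 2) * (L ^ (-(H / 2)) * F) := by rw [e1]; ring
    _ ≤ 5 ^ ((H - h) / 2) * (L ^ (-(H / 2)) * F) := by gcongr
    _ ≤ _ := by rw [e4]; gcongr

set_option maxHeartbeats 400000 in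
/-- Weighted potential estimate on the level sets of a one-dimensional potential. -/
lemma exists_slice_potential_bound (hN : 3 ≤ N) {τ s z h : ℝ} (hτ0 : 0 < τ) (hτ1 : τ < 1)
    (hs : 1 ≤ s) (hsz : s ≤ z) (hh : h ≤ τ * (N - (N - 1) * (1 / s - 1 / z))) :
    ∃ C : ℝ, 0 < C ∧ ∀ ρ : ℝ, ρ ≤ 1 → ∀ ε : ℝ, 0 < ε → ε < 1 → ∀ f : EN N → ℝ,
      Continuous f → (∀ y, ‖y‖ ≤ 1 → 0 ≤ f y) → ∀ T : ℝ, 0 < T → ∀ w : EN N → ℝ,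
      Continuous w → (∀ x, 0 ≤ w x) → (∀ x, w x ≤ 1) →
      (∀ x, w x ≠ 0 → ‖x‖ ≤ 1 ∧ slicePot ρ ε τ (fun y => f y ^ s) (‖x‖ ^ 2) ≤ T) →
      ∫ x in closedBall 0 1, w x * (∫ y in closedBall 0 ρ, rker (h / 2) ε x y * f y) ^ z
        ≤ C * T ^ (z / s - 1) * (1 + ∫ y in closedBall 0 ρ, f y ^ s) := by
  obtain ⟨K, hK, hKb⟩ := exists_rker_integral_bound hN hτ0 hτ1
  have hs0 : 0 < s := by linarith
  have hz0 : 0 < z := by linarith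
  have hz1 : 1 / z ≤ 1 / s := one_div_le_one_div_of_le hs0 hsz
  have hs1 : 1 / s ≤ 1 := by rw [div_le_one hs0]; exact hs
  set c5 : ℝ := 5 ^ ((τ * (N - (N - 1) * (1 / s - 1 / z)) - h) / 2) with hc5
  have hc5p : 0 < c5 := by positivity
  set V := (volume : Measure (EN N)).real (closedBall 0 1) with hV
  have hV0 : 0 ≤ V := measureReal_nonneg
  refine ⟨(c5 * K ^ (1 - 1 / s)) ^ z * (V + K), by positivity,
    fun ρ hρ ε hε hε1 f hf hf0 T hT w hw hw0 hw1 hwT => ?_⟩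
  have hfs : Continuous fun y => f y ^ s := hf.rpow_const fun _ => Or.inr hs0.le
  have hkc : Continuous fun p : EN N × EN N => rker (N * τ / 2) ε p.1 p.2 * f p.2 ^ s :=
    (rker_continuous_uncurry _ hε).mul (hfs.comp continuous_snd)
  have hmem : ∀ y : EN N, y ∈ closedBall (0 : EN N) ρ → ‖y‖ ≤ 1 := fun y hy => by
    rw [mem_closedBall_zero_iff] at hy; linarith
  set a : EN N → ℝ := fun x => 1 + ∫ y in closedBall 0 ρ, rker (N * τ / 2) ε x y * f y ^ s with ha
  have ha1 : ∀ x, 1 ≤ a x := fun x => by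
    have : 0 ≤ ∫ y in closedBall 0 ρ, rker (N * τ / 2) ε x y * f y ^ s :=
      setIntegral_nonneg measurableSet_closedBall fun y hy =>
        mul_nonneg (rker_pos hε x y).le (Real.rpow_nonneg (hf0 y (hmem y hy)) _)
    simp only [ha]; linarith
  have hac : Continuous a := continuous_const.add
    (continuous_parametric_integral_of_continuous (f := fun x y => rker (N * τ / 2) ε x y * f y ^ s)
      hkc (isCompact_closedBall 0 ρ))
  have key : ∀ x, w x * (∫ y in closedBall 0 ρ, rker (h / 2) ε x y * f y) ^ z
      ≤ (c5 * K ^ (1 - 1 / s)) ^ z * T ^ (z / s - 1) * a x := by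
    intro x
    have hax := ha1 x
    by_cases hwx : w x = 0
    · rw [hwx, zero_mul]; positivity
    obtain ⟨hx, hTx⟩ := hwT x hwx
    have hP0 : 0 ≤ ∫ y in closedBall 0 ρ, rker (h / 2) ε x y * f y :=
      setIntegral_nonneg measurableSet_closedBall fun y hy =>
        mul_nonneg (rker_pos hε x y).le (hf0 y (hmem y hy))
    have hBc : Continuous fun y => rker (N * τ / 2) ε x y := rker_continuous _ hε x
    have hAc : Continuous fun y => rker (N * τ / 2) ε x y * f y ^ s := hBc.mul hfs
    have hDc : Continuous fun y : EN N =>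
        ((‖x‖ ^ 2 - ‖y‖ ^ 2) ^ 2 / 4 + ε ^ 2) ^ (-(τ / 2)) * f y ^ s :=
      (Continuous.rpow_const (by fun_prop) fun y =>
        Or.inl (slice_base_pos hε (‖x‖ ^ 2) y).ne').mul hfs
    have hH := integral_mul_mul_le (μ := volume.restrict (closedBall (0 : EN N) ρ))
      (hAc.integrableOn_closedBall ρ) (hBc.integrableOn_closedBall ρ)
      (hDc.integrableOn_closedBall ρ)
      (by
        filter_upwards [ae_restrict_mem measurableSet_closedBall] with y hy
        have hfy := Real.rpow_nonneg (hf0 y (hmem y hy)) s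
        have hr := (rker_pos (k := N * τ / 2) hε x y).le
        have hm := slice_base_pos hε (‖x‖ ^ 2) y
        exact ⟨mul_nonneg hr hfy, hr, mul_nonneg (by positivity) hfy⟩)
      (a := a x) (b := K) (d := T) (w₁ := 1 / z) (w₂ := 1 - 1 / s) (w₃ := 1 / s - 1 / z)
      (by linarith) hK hT (by simp [ha]) (hKb ρ hρ ε hε x hx) hTx (by positivity) (by linarith)
      (by linarith) (by ring)
    have hPle : ∫ y in closedBall 0 ρ, rker (h / 2) ε x y * f y
        ≤ c5 * (a x ^ (1 / z) * K ^ (1 - 1 / s) * T ^ (1 / s - 1 / z)) := by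
      refine le_trans ?_ (mul_le_mul_of_nonneg_left hH hc5p.le)
      rw [← integral_const_mul]
      have hc : Continuous fun y => c5 * ((rker (N * τ / 2) ε x y * f y ^ s) ^ (1 / z)
          * rker (N * τ / 2) ε x y ^ (1 - 1 / s)
          * (((‖x‖ ^ 2 - ‖y‖ ^ 2) ^ 2 / 4 + ε ^ 2) ^ (-(τ / 2)) * f y ^ s) ^ (1 / s - 1 / z)) :=
        continuous_const.mul (((hAc.rpow_const fun _ => Or.inr (by positivity)).mul
          (hBc.rpow_const fun _ => Or.inr (by linarith))).mul
          (hDc.rpow_const fun _ => Or.inr (by linarith)))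
      have hlc : Continuous fun y => rker (h / 2) ε x y * f y :=
        (rker_continuous _ hε x).mul hf
      refine setIntegral_mono_on (hlc.integrableOn_closedBall ρ) (hc.integrableOn_closedBall ρ)
        measurableSet_closedBall fun y hy => ?_
      exact rker_mul_le_of_slice hs hsz hh hτ0.le hε hε1 hx (hmem y hy) (hf0 y (hmem y hy))
    have hfin : (∫ y in closedBall 0 ρ, rker (h / 2) ε x y * f y) ^ z
        ≤ (c5 * K ^ (1 - 1 / s)) ^ z * T ^ (z / s - 1) * a x := by
      refine (Real.rpow_le_rpow hP0 hPle hz0.le).trans_eq ?_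
      rw [show c5 * (a x ^ (1 / z) * K ^ (1 - 1 / s) * T ^ (1 / s - 1 / z))
        = (c5 * K ^ (1 - 1 / s)) * T ^ (1 / s - 1 / z) * a x ^ (1 / z) by ring,
        Real.mul_rpow (by positivity) (by positivity),
        Real.mul_rpow (by positivity) (by positivity), ← Real.rpow_mul hT.le,
        ← Real.rpow_mul (by linarith : 0 ≤ a x),
        show (1 / s - 1 / z) * z = z / s - 1 by field_simp,
        show 1 / z * z = 1 by field_simp, Real.rpow_one]
    calc _ ≤ 1 * (∫ y in closedBall 0 ρ, rker (h / 2) ε x y * f y) ^ z :=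
          mul_le_mul_of_nonneg_right (hw1 x) (by positivity)
      _ ≤ _ := by rw [one_mul]; exact hfin
  have hRc : Continuous fun x => (c5 * K ^ (1 - 1 / s)) ^ z * T ^ (z / s - 1) * a x :=
    continuous_const.mul hac
  have hPc : Continuous fun x => ∫ y in closedBall 0 ρ, rker (h / 2) ε x y * f y :=
    continuous_parametric_integral_of_continuous (f := fun x y => rker (h / 2) ε x y * f y)
      ((rker_continuous_uncurry (h / 2) hε).mul (hf.comp continuous_snd)) (isCompact_closedBall 0 ρ)
  have hLc : Continuous fun x => w x * (∫ y in closedBall 0 ρ, rker (h / 2) ε x y * f y) ^ z :=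
    hw.mul (hPc.rpow_const fun _ => Or.inr hz0.le)
  have hstep := setIntegral_mono_on (hLc.integrableOn_closedBall 1) (hRc.integrableOn_closedBall 1)
    measurableSet_closedBall fun x _ => key x
  refine hstep.trans ?_
  rw [integral_const_mul]
  have hsum : ∫ x in closedBall 0 1, a x ≤ V + K * ∫ y in closedBall 0 ρ, f y ^ s := by
    have hpc : Continuous fun x => ∫ y in closedBall 0 ρ, rker (N * τ / 2) ε x y * f y ^ s :=
      continuous_parametric_integral_of_continuous
        (f := fun x y => rker (N * τ / 2) ε x y * f y ^ s) hkc (isCompact_closedBall 0 ρ)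
    simp only [ha]
    rw [integral_add (continuous_const.integrableOn_closedBall 1) (hpc.integrableOn_closedBall 1),
      integral_swap_of_isCompact (f := fun x y => rker (N * τ / 2) ε x y * f y ^ s) hkc
        (isCompact_closedBall 0 1) (isCompact_closedBall 0 ρ), setIntegral_const, smul_eq_mul,
      mul_one]
    refine add_le_add_right ?_ _
    rw [← integral_const_mul]
    have hkc' : Continuous fun p : EN N × EN N => rker (N * τ / 2) ε p.2 p.1 * f p.1 ^ s := by
      simp_rw [rker_swap _ ε _ (Prod.fst _)]
      exact (rker_continuous_uncurry _ hε).mul (hfs.comp continuous_fst)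
    have hpc' : Continuous fun y => ∫ x in closedBall 0 1, rker (N * τ / 2) ε x y * f y ^ s :=
      continuous_parametric_integral_of_continuous
        (f := fun y x => rker (N * τ / 2) ε x y * f y ^ s) hkc' (isCompact_closedBall 0 1)
    refine setIntegral_mono_on (hpc'.integrableOn_closedBall ρ)
      ((continuous_const.mul hfs).integrableOn_closedBall ρ) measurableSet_closedBall fun y hy => ?_
    rw [integral_mul_const]
    refine mul_le_mul_of_nonneg_right ?_ (Real.rpow_nonneg (hf0 y (hmem y hy)) s)
    simp_rw [rker_swap _ ε _ y]
    exact hKb 1 le_rfl ε hε y (hmem y hy)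
  have hI0 : 0 ≤ ∫ y in closedBall 0 ρ, f y ^ s :=
    setIntegral_nonneg measurableSet_closedBall fun y hy =>
      Real.rpow_nonneg (hf0 y (hmem y hy)) _
  calc _ ≤ (c5 * K ^ (1 - 1 / s)) ^ z * T ^ (z / s - 1) *
        ((V + K) * (1 + ∫ y in closedBall 0 ρ, f y ^ s)) := by
        gcongr
        nlinarith
    _ = _ := by ring

end SlicePotential

section SliceWeight

variable {N : ℕ}

lemma exists_one_dim_kernel_bound {τ : ℝ} (h0 : 0 < τ) (h1 : τ < 1) :
    ∃ C : ℝ, 0 < C ∧ ∀ ε : ℝ, 0 < ε → ∀ b : ℝ, 0 ≤ b → b ≤ 1 →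
      ∫ t in Icc (0 : ℝ) 1, ((t - b) ^ 2 / 4 + ε ^ 2) ^ (-(τ / 2)) ≤ C := by
  set F : ℝ → ℝ := (ball 0 2).indicator fun z => 2 ^ τ * ‖z‖ ^ (-τ) with hFdef
  have hF : Integrable F := by
    refine (integrable_indicator_iff measurableSet_ball).2 ?_
    refine integrableOn_ball_of_norm_le_rpow (C := 2 ^ τ) (α := τ) (by simp) (by simpa) ?_ ?_
    · refine .of_forall fun x => ?_
      rw [Real.norm_of_nonneg (by positivity)]
    · exact ((measurable_norm.pow_const _).const_mul _).aestronglyMeasurable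
  have hF0 : ∀ z, 0 ≤ F z := indicator_nonneg fun z _ => by positivity
  refine ⟨(∫ z, F z) + 1, ?_, fun ε hε b hb0 hb1 => ?_⟩
  · have := integral_nonneg (μ := volume) (f := F) fun z => hF0 z
    linarith
  have hFx : Integrable (fun y => F (y - b)) := hF.comp_sub_right b
  have hle : ∀ᵐ t ∂((volume : Measure ℝ).restrict (Icc (0 : ℝ) 1)),
      ((t - b) ^ 2 / 4 + ε ^ 2) ^ (-(τ / 2)) ≤ F (t - b) := by
    have hae : ∀ᵐ y ∂(volume : Measure ℝ), y ≠ b := by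
      simp [ae_iff, measure_singleton]
    filter_upwards [ae_restrict_mem measurableSet_Icc, ae_restrict_of_ae hae] with t ht htb
    have hpos : 0 < |t - b| := abs_pos.2 (sub_ne_zero.2 htb)
    have hmem : t - b ∈ ball (0 : ℝ) 2 := by
      rw [mem_ball_zero_iff, Real.norm_eq_abs, abs_lt]
      constructor <;> linarith [ht.1, ht.2]
    rw [hFdef, indicator_of_mem hmem, Real.norm_eq_abs]
    have e1 : 2 ^ τ * |t - b| ^ (-τ) = ((t - b) ^ 2 / 4) ^ (-(τ / 2)) := by
      rw [show (t - b) ^ 2 / 4 = (|t - b| / 2) ^ 2 by rw [div_pow, sq_abs]; norm_num,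
        ← Real.rpow_natCast, ← Real.rpow_mul (by positivity),
            Real.div_rpow (by positivity) (by norm_num)]
      rw [show ((2 : ℕ) : ℝ) * -(τ / 2) = -τ by push_cast; ring,
            Real.rpow_neg (by norm_num : (0:ℝ) ≤ 2)]
      rw [div_inv_eq_mul, mul_comm]
    rw [e1]
    have h2 : 0 < (t - b) ^ 2 / 4 := by
      rw [← sq_abs]; positivity
    exact Real.rpow_le_rpow_of_nonpos h2 (by nlinarith) (by linarith)
  have e1 := integral_mono_of_nonneg (.of_forall fun t => by positivity)
    hFx.integrableOn hle
  have e2 := setIntegral_le_integral (s := Icc (0 : ℝ) 1) hFx (.of_forall fun y => hF0 _)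
  have e3 : ∫ y, F (y - b) = ∫ z, F z := integral_sub_right_eq_self F b
  linarith

lemma slicePot_nonneg {ρ ε τ : ℝ} (hε : 0 < ε) (hρ : ρ ≤ 1) {G : EN N → ℝ}
    (hG : ∀ y, ‖y‖ ≤ 1 → 0 ≤ G y) (t : ℝ) : 0 ≤ slicePot ρ ε τ G t :=
  setIntegral_nonneg measurableSet_closedBall fun y hy => by
    rw [mem_closedBall_zero_iff] at hy
    have := hG y (by linarith)
    have := slice_base_pos hε t y
    positivity

lemma exists_integral_slicePot_bound (N : ℕ) {τ : ℝ} (h0 : 0 < τ) (h1 : τ < 1) :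
    ∃ C : ℝ, 0 < C ∧ ∀ ρ : ℝ, ρ ≤ 1 → ∀ ε : ℝ, 0 < ε → ∀ G : EN N → ℝ, Continuous G →
      (∀ y, ‖y‖ ≤ 1 → 0 ≤ G y) →
      ∫ t in Icc (0 : ℝ) 1, slicePot ρ ε τ G t ≤ C * ∫ y in closedBall 0 ρ, G y := by
  obtain ⟨C, hC, hb⟩ := exists_one_dim_kernel_bound h0 h1
  refine ⟨C, hC, fun ρ hρ ε hε G hG hG0 => ?_⟩
  unfold slicePot
  rw [integral_swap_of_isCompact (slice_kernel_continuous hε τ hG) isCompact_Icc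
    (isCompact_closedBall 0 ρ), ← integral_const_mul]
  have hc : Continuous fun y : EN N => ∫ t in Icc (0 : ℝ) 1,
      ((t - ‖y‖ ^ 2) ^ 2 / 4 + ε ^ 2) ^ (-(τ / 2)) * G y :=
    continuous_parametric_integral_of_continuous
      (f := fun (y : EN N) (t : ℝ) => ((t - ‖y‖ ^ 2) ^ 2 / 4 + ε ^ 2) ^ (-(τ / 2)) * G y)
      ((Continuous.rpow_const (by fun_prop) fun p => Or.inl (slice_base_pos hε p.2 p.1).ne').mul
        (hG.comp continuous_fst)) isCompact_Icc
  refine setIntegral_mono_on (hc.integrableOn_closedBall ρ)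
    ((continuous_const.mul hG).integrableOn_closedBall ρ) measurableSet_closedBall fun y hy => ?_
  rw [mem_closedBall_zero_iff] at hy
  rw [integral_mul_const]
  have hy1 : ‖y‖ ≤ 1 := by linarith
  exact mul_le_mul_of_nonneg_right (hb ε hε _ (by positivity) (pow_le_one₀ (norm_nonneg y) hy1))
    (hG0 y hy1)

/-- A bump supported where two functions with controlled integrals are both small. -/
lemma exists_slice_weight {Φ₁ Φ₂ : ℝ → ℝ} (hc₁ : Continuous Φ₁) (hc₂ : Continuous Φ₂)
    (hΦ₁ : ∀ t, 0 ≤ Φ₁ t) (hΦ₂ : ∀ t, 0 ≤ Φ₂ t) {A₁ A₂ t₁ t₂ : ℝ} (hA₁ : 0 < A₁) (hA₂ : 0 < A₂)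
    (hi₁ : ∫ t in Icc (0 : ℝ) 1, Φ₁ t ≤ A₁) (hi₂ : ∫ t in Icc (0 : ℝ) 1, Φ₂ t ≤ A₂)
    (h0 : 0 ≤ t₁) (h12 : t₁ < t₂) (h1 : t₂ ≤ 1) :
    ∃ g : ℝ → ℝ, Continuous g ∧ (∀ t, 0 ≤ g t) ∧ (∀ t, g t ≤ 1) ∧
      (∀ t, g t ≠ 0 → t₁ < t ∧ t < t₂ ∧ Φ₁ t ≤ 6 * A₁ / (t₂ - t₁) ∧ Φ₂ t ≤ 6 * A₂ / (t₂ - t₁)) ∧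
      (t₂ - t₁) ^ 3 / 12 ≤ ∫ t in Icc (0 : ℝ) 1, g t := by
  set δ := t₂ - t₁ with hδ
  have hδ0 : 0 < δ := by linarith
  have hδ1 : δ ≤ 1 := by linarith
  set η : ℝ → ℝ := fun t => max 0 ((t - t₁) * (t₂ - t)) with hη
  set m : ℝ → ℝ := fun t => max 0 (1 - Φ₁ t * (δ / (6 * A₁)) - Φ₂ t * (δ / (6 * A₂))) with hm
  have hηc : Continuous η := by fun_prop
  have hmc : Continuous m := by fun_prop
  have hη0 : ∀ t, 0 ≤ η t := fun t => le_max_left _ _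
  have hm0 : ∀ t, 0 ≤ m t := fun t => le_max_left _ _
  have hηle : ∀ t, η t ≤ δ ^ 2 / 4 := fun t => by
    refine max_le (by positivity) ?_
    nlinarith [sq_nonneg (t - t₁ - (t₂ - t))]
  have hmle : ∀ t, m t ≤ 1 := fun t => by
    have := mul_nonneg (hΦ₁ t) (by positivity : 0 ≤ δ / (6 * A₁))
    have := mul_nonneg (hΦ₂ t) (by positivity : 0 ≤ δ / (6 * A₂))
    exact max_le zero_le_one (by linarith)
  refine ⟨fun t => η t * m t, hηc.mul hmc, fun t => mul_nonneg (hη0 t) (hm0 t), fun t => ?_,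
    fun t ht => ?_, ?_⟩
  · have : η t ≤ 1 := (hηle t).trans (by nlinarith)
    exact mul_le_one₀ this (hm0 t) (hmle t)
  · have ht1 : 0 < (t - t₁) * (t₂ - t) := by
      by_contra! h
      exact ht (by simp only [hη, max_eq_left h, zero_mul])
    have ht2 : 0 < 1 - Φ₁ t * (δ / (6 * A₁)) - Φ₂ t * (δ / (6 * A₂)) := by
      by_contra! h
      exact ht (by simp only [hm, max_eq_left h, mul_zero])
    have n1 := mul_nonneg (hΦ₁ t) (by positivity : 0 ≤ δ / (6 * A₁))
    have n2 := mul_nonneg (hΦ₂ t) (by positivity : 0 ≤ δ / (6 * A₂))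
    have f1 : Φ₁ t * (δ / (6 * A₁)) ≤ 1 := by linarith
    have f2 : Φ₂ t * (δ / (6 * A₂)) ≤ 1 := by linarith
    rw [mul_div_assoc', div_le_one (by positivity)] at f1 f2
    have hsign := pos_and_pos_or_neg_and_neg_of_mul_pos ht1
    rcases hsign with ⟨ha, hb⟩ | ⟨ha, hb⟩
    · exact ⟨by linarith, by linarith, (le_div_iff₀ hδ0).2 f1, (le_div_iff₀ hδ0).2 f2⟩
    · exfalso; linarith
  · have hpt : ∀ t ∈ Icc (0 : ℝ) 1,
        η t - (δ ^ 3 / (24 * A₁) * Φ₁ t + δ ^ 3 / (24 * A₂) * Φ₂ t) ≤ η t * m t := fun t _ => by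
      have a1 : 1 - Φ₁ t * (δ / (6 * A₁)) - Φ₂ t * (δ / (6 * A₂)) ≤ m t := le_max_right _ _
      have a2 : 0 ≤ Φ₁ t * (δ / (6 * A₁)) + Φ₂ t * (δ / (6 * A₂)) := by
        have n1 := mul_nonneg (hΦ₁ t) (by positivity : 0 ≤ δ / (6 * A₁))
        have n2 := mul_nonneg (hΦ₂ t) (by positivity : 0 ≤ δ / (6 * A₂))
        linarith
      have a3 : η t * (1 - Φ₁ t * (δ / (6 * A₁)) - Φ₂ t * (δ / (6 * A₂))) ≤ η t * m t :=
        mul_le_mul_of_nonneg_left a1 (hη0 t)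
      have a4 := mul_le_mul_of_nonneg_right (hηle t) a2
      have a5 : δ ^ 2 / 4 * (Φ₁ t * (δ / (6 * A₁)) + Φ₂ t * (δ / (6 * A₂)))
          = δ ^ 3 / (24 * A₁) * Φ₁ t + δ ^ 3 / (24 * A₂) * Φ₂ t := by
        field_simp; ring
      linarith
    have hη_int : δ ^ 3 / 6 ≤ ∫ t in Icc (0 : ℝ) 1, η t := by
      have b1 : ∫ t in Icc t₁ t₂, η t ≤ ∫ t in Icc (0 : ℝ) 1, η t :=
        setIntegral_mono_set (hηc.continuousOn.integrableOn_compact isCompact_Icc)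
          (.of_forall hη0) (Icc_subset_Icc h0 h1).eventuallyLE
      have b2 : ∫ t in Icc t₁ t₂, η t = ∫ t in t₁..t₂, ((t - t₁) * (t₂ - t)) := by
        rw [intervalIntegral.integral_of_le h12.le, ← integral_Icc_eq_integral_Ioc]
        refine setIntegral_congr_fun measurableSet_Icc fun t ht => ?_
        exact max_eq_right (mul_nonneg (by linarith [ht.1]) (by linarith [ht.2]))
      have b3 : ∫ t in t₁..t₂, ((t - t₁) * (t₂ - t)) = δ ^ 3 / 6 := by
        rw [intervalIntegral.integral_eq_sub_of_hasDerivAt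
          (f := fun t => δ / 2 * (t - t₁) ^ 2 - (t - t₁) ^ 3 / 3)]
        · simp only [hδ]; ring
        · intro t _
          have h2 := ((((hasDerivAt_id t).sub_const t₁).pow 2).const_mul (δ / 2)).sub
            ((((hasDerivAt_id t).sub_const t₁).pow 3).div_const 3)
          refine HasDerivAt.congr_deriv (h2.congr_of_eventuallyEq (.of_forall fun y => rfl)) ?_
          simp only [hδ, id]; push_cast; ring
        · exact (Continuous.intervalIntegrable (by fun_prop) _ _)
      linarith
    have hI : ∀ {f : ℝ → ℝ}, Continuous f → IntegrableOn f (Icc (0 : ℝ) 1) := fun hf =>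
      hf.continuousOn.integrableOn_compact isCompact_Icc
    have hk₁ : Continuous fun t => δ ^ 3 / (24 * A₁) * Φ₁ t := continuous_const.mul hc₁
    have hk₂ : Continuous fun t => δ ^ 3 / (24 * A₂) * Φ₂ t := continuous_const.mul hc₂
    have hk : Continuous fun t => δ ^ 3 / (24 * A₁) * Φ₁ t + δ ^ 3 / (24 * A₂) * Φ₂ t :=
      hk₁.add hk₂
    have hmono : ∫ t in Icc (0 : ℝ) 1,
        (η t - (δ ^ 3 / (24 * A₁) * Φ₁ t + δ ^ 3 / (24 * A₂) * Φ₂ t))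
          ≤ ∫ t in Icc (0 : ℝ) 1, η t * m t :=
      setIntegral_mono_on (hI (hηc.sub hk)) (hI (hηc.mul hmc)) measurableSet_Icc hpt
    rw [integral_sub (hI hηc) (hI hk), integral_add (hI hk₁) (hI hk₂),
      integral_const_mul, integral_const_mul] at hmono
    have c1 : δ ^ 3 / (24 * A₁) * ∫ t in Icc (0 : ℝ) 1, Φ₁ t ≤ δ ^ 3 / 24 := by
      calc _ ≤ δ ^ 3 / (24 * A₁) * A₁ := by gcongr
        _ = _ := by field_simp
    have c2 : δ ^ 3 / (24 * A₂) * ∫ t in Icc (0 : ℝ) 1, Φ₂ t ≤ δ ^ 3 / 24 := by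
      calc _ ≤ δ ^ 3 / (24 * A₂) * A₂ := by gcongr
        _ = _ := by field_simp
    change δ ^ 3 / 12 ≤ ∫ t in Icc (0 : ℝ) 1, η t * m t
    linarith

end SliceWeight

section Pohozaev

variable {N : ℕ}

lemma pd_comm {f : EN N → ℝ} (hf : ContDiff ℝ 2 f) (i j : Fin N) (x : EN N) :
    pd i (pd j f) x = pd j (pd i f) x := by
  have hs : IsSymmSndFDerivAt ℝ f x :=
    hf.contDiffAt.isSymmSndFDerivAt (by simp)
  have hd : DifferentiableAt ℝ (fderiv ℝ f) x :=
    (hf.fderiv_right (m := 1) (by norm_num)).differentiable (by norm_num) x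
  have h : ∀ i j : Fin N, pd i (pd j f) x
      = fderiv ℝ (fderiv ℝ f) x (EuclideanSpace.single i 1) (EuclideanSpace.single j 1) := by
    intro i j
    have : pd j f = fun y => fderiv ℝ f y (EuclideanSpace.single j 1) := rfl
    rw [pd, this, fderiv_clm_apply hd (differentiableAt_const _)]
    simp
  rw [h, h]
  exact hs _ _

/-- Radial derivative multiplied by the radius. -/
noncomputable def euler (f : EN N → ℝ) (x : EN N) : ℝ := ∑ j, x j * pd j f x

/-- Inner product of two gradients. -/
noncomputable def gradDot (f g : EN N → ℝ) (x : EN N) : ℝ := ∑ j, pd j f x * pd j g x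

lemma euler_contDiff {f : EN N → ℝ} (hf : ContDiff ℝ 2 f) : ContDiff ℝ 1 (euler f) :=
  ContDiff.sum fun j _ => (by fun_prop : ContDiff ℝ 1 fun x : EN N => x j).mul (pd_contDiff1 j hf)

lemma gradDot_contDiff {f g : EN N → ℝ} (hf : ContDiff ℝ 2 f) (hg : ContDiff ℝ 2 g) :
    ContDiff ℝ 1 (gradDot f g) :=
  ContDiff.sum fun j _ => (pd_contDiff1 j hf).mul (pd_contDiff1 j hg)

lemma pd_euler {f : EN N → ℝ} (hf : ContDiff ℝ 2 f) (i : Fin N) (x : EN N) :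
    pd i (euler f) x = pd i f x + ∑ j, x j * pd i (pd j f) x := by
  have hd : ∀ j, Differentiable ℝ (pd j f) := fun j =>
    (pd_contDiff1 j hf).differentiable (by norm_num)
  have hc : ∀ j : Fin N, Differentiable ℝ fun x : EN N => x j := fun j => by fun_prop
  have : euler f = fun x => ∑ j, x j * pd j f x := rfl
  rw [this, pd_sum (f := fun j x => x j * pd j f x) _ fun j _ => ((hc j).mul (hd j)) x]
  simp_rw [pd_mul (hc _ x) (hd _ x), pd_coord, Finset.sum_add_distrib]
  simp [add_comm]

lemma pd_gradDot {f g : EN N → ℝ} (hf : ContDiff ℝ 2 f) (hg : ContDiff ℝ 2 g) (i : Fin N)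
    (x : EN N) : pd i (gradDot f g) x
      = ∑ j, (pd j f x * pd i (pd j g) x + pd j g x * pd i (pd j f) x) := by
  have hd : ∀ {f : EN N → ℝ}, ContDiff ℝ 2 f → ∀ j, Differentiable ℝ (pd j f) := fun hf j =>
    (pd_contDiff1 j hf).differentiable (by norm_num)
  have : gradDot f g = fun x => ∑ j, pd j f x * pd j g x := rfl
  rw [this, pd_sum (f := fun j x => pd j f x * pd j g x) _ fun j _ =>
    ((hd hf j).mul (hd hg j)) x]
  simp_rw [pd_mul (hd hf _ x) (hd hg _ x)]

/-- The Rellich–Pohozaev vector field. -/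
noncomputable def pohField (u v W : EN N → ℝ) (a₁ a₂ : ℝ) (i : Fin N) (x : EN N) : ℝ :=
  euler v x * pd i u x + euler u x * pd i v x + x i * (W x - gradDot u v x)
    + (a₁ * (v x * pd i u x) + a₂ * (u x * pd i v x))

lemma pohField_contDiff {u v W : EN N → ℝ} (hu : ContDiff ℝ 2 u) (hv : ContDiff ℝ 2 v)
    (hW : ContDiff ℝ 1 W) (a₁ a₂ : ℝ) (i : Fin N) : ContDiff ℝ 1 (pohField u v W a₁ a₂ i) := by
  have h1 := pd_contDiff1 i hu
  have h2 := pd_contDiff1 i hv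
  have h3 := euler_contDiff hu
  have h4 := euler_contDiff hv
  have h5 := gradDot_contDiff hu hv
  have h6 := hu.of_le (m := 1) (by norm_num)
  have h7 := hv.of_le (m := 1) (by norm_num)
  have h8 : ContDiff ℝ 1 fun x : EN N => x i := by fun_prop
  exact (((h4.mul h1).add (h3.mul h2)).add (h8.mul (hW.sub h5))).add
    ((contDiff_const.mul (h7.mul h1)).add (contDiff_const.mul (h6.mul h2)))

lemma sum_pd_pohField {u v W : EN N → ℝ} (hu : ContDiff ℝ 2 u) (hv : ContDiff ℝ 2 v)
    (hW : ContDiff ℝ 1 W) {a₁ a₂ : ℝ} (ha : a₁ + a₂ = N - 2) (x : EN N) :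
    ∑ i, pd i (pohField u v W a₁ a₂ i) x
      = euler v x * lapl u x + euler u x * lapl v x + N * W x + euler W x
        + a₁ * v x * lapl u x + a₂ * u x * lapl v x := by
  have h1 : ∀ i, DifferentiableAt ℝ (pd i u) x := fun i =>
    (pd_contDiff1 i hu).differentiable (by norm_num) x
  have h2 : ∀ i, DifferentiableAt ℝ (pd i v) x := fun i =>
    (pd_contDiff1 i hv).differentiable (by norm_num) x
  have h3 := (euler_contDiff hu).differentiable (by norm_num) x
  have h4 := (euler_contDiff hv).differentiable (by norm_num) x
  have h5 := (gradDot_contDiff hu hv).differentiable (by norm_num) x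
  have h6 := hu.differentiable (by norm_num) x
  have h7 := hv.differentiable (by norm_num) x
  have h8 : ∀ i, DifferentiableAt ℝ (fun x : EN N => x i) x := fun i => by fun_prop
  have h9 := hW.differentiable (by norm_num) x
  have key : ∀ i, pd i (pohField u v W a₁ a₂ i) x
      = (euler v x * pd i (pd i u) x + euler u x * pd i (pd i v) x
        + (2 + a₁ + a₂) * (pd i u x * pd i v x) + (W x - gradDot u v x) + x i * pd i W x
        + a₁ * v x * pd i (pd i u) x + a₂ * u x * pd i (pd i v) x)
        + (∑ j, (pd i u x * (x j * pd i (pd j v) x)) - ∑ j, (x i * (pd j u x * pd i (pd j v) x)))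
        + (∑ j, (pd i v x * (x j * pd i (pd j u) x))
          - ∑ j, (x i * (pd j v x * pd i (pd j u) x))) := by
    intro i
    have e : pohField u v W a₁ a₂ i = fun x => euler v x * pd i u x + euler u x * pd i v x
      + x i * (W x - gradDot u v x) + (a₁ * (v x * pd i u x) + a₂ * (u x * pd i v x)) := rfl
    have d1 : DifferentiableAt ℝ (fun x => euler v x * pd i u x) x := h4.mul (h1 i)
    have d2 : DifferentiableAt ℝ (fun x => euler u x * pd i v x) x := h3.mul (h2 i)
    have d0 : DifferentiableAt ℝ (fun x => W x - gradDot u v x) x := h9.sub h5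
    have d3 : DifferentiableAt ℝ (fun x => x i * (W x - gradDot u v x)) x := (h8 i).mul d0
    have d4 : DifferentiableAt ℝ (fun x => v x * pd i u x) x := h7.mul (h1 i)
    have d5 : DifferentiableAt ℝ (fun x => u x * pd i v x) x := h6.mul (h2 i)
    have d6 : DifferentiableAt ℝ (fun x => a₁ * (v x * pd i u x)) x := d4.const_mul a₁
    have d7 : DifferentiableAt ℝ (fun x => a₂ * (u x * pd i v x)) x := d5.const_mul a₂
    have d8 : DifferentiableAt ℝ (fun x => euler v x * pd i u x + euler u x * pd i v x) x :=
      d1.add d2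
    have d9 : DifferentiableAt ℝ (fun x => euler v x * pd i u x + euler u x * pd i v x
      + x i * (W x - gradDot u v x)) x := d8.add d3
    have d10 : DifferentiableAt ℝ
      (fun x => a₁ * (v x * pd i u x) + a₂ * (u x * pd i v x)) x := d6.add d7
    rw [e, pd_add d9 d10, pd_add d8 d3, pd_add d1 d2, pd_add d6 d7,
      pd_const_mul _ d4, pd_const_mul _ d5, pd_mul h4 (h1 i), pd_mul h3 (h2 i),
      pd_mul (h8 i) d0, pd_sub h9 h5, pd_mul h7 (h1 i), pd_mul h6 (h2 i),
      pd_coord, if_pos rfl, pd_euler hu, pd_euler hv, pd_gradDot hu hv, Finset.sum_add_distrib]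
    simp only [← Finset.mul_sum]
    ring
  have hsym : ∀ {f g : EN N → ℝ}, ContDiff ℝ 2 g →
      ∑ i, (∑ j, (pd i f x * (x j * pd i (pd j g) x)) - ∑ j, (x i * (pd j f x * pd i (pd j g) x)))
        = 0 := by
    intro f g hg
    rw [Finset.sum_sub_distrib, sub_eq_zero, Finset.sum_comm]
    refine Finset.sum_congr rfl fun i _ => Finset.sum_congr rfl fun j _ => ?_
    rw [pd_comm hg j i]; ring
  simp_rw [key]
  rw [Finset.sum_add_distrib, Finset.sum_add_distrib, hsym hv, hsym hu]
  simp only [Finset.sum_add_distrib, ← Finset.mul_sum, Finset.sum_const, Finset.card_univ,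
    Fintype.card_fin, nsmul_eq_mul]
  have e1 : ∑ i, pd i (pd i u) x = lapl u x := rfl
  have e2 : ∑ i, pd i (pd i v) x = lapl v x := rfl
  have e3 : ∑ i, pd i u x * pd i v x = gradDot u v x := rfl
  have e4 : ∑ i, x i * pd i W x = euler W x := rfl
  rw [e1, e2, e3, e4]
  linear_combination (gradDot u v x) * ha

end Pohozaev

section PohozaevInequality

variable {N : ℕ} {p q κ : ℝ}

lemma abs_euler_le (f : EN N → ℝ) {x : EN N} (hx : ‖x‖ ≤ 1) : |euler f x| ≤ ∑ j, |pd j f x| := by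
  refine (Finset.abs_sum_le_sum_abs _ _).trans (Finset.sum_le_sum fun j _ => ?_)
  rw [abs_mul]
  exact mul_le_of_le_one_left (abs_nonneg _) ((abs_coord_le_norm x j).trans hx)

lemma abs_gradDot_le (f g : EN N → ℝ) (x : EN N) :
    |gradDot f g x| ≤ (∑ j, |pd j f x|) * ∑ j, |pd j g x| := by
  refine (Finset.abs_sum_le_sum_abs _ _).trans ?_
  rw [Finset.sum_mul]
  refine Finset.sum_le_sum fun j _ => ?_
  rw [abs_mul]
  gcongr
  exact Finset.single_le_sum (f := fun j => |pd j g x|) (fun i _ => abs_nonneg _)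
      (Finset.mem_univ j)

lemma sum_coord_mul_pohField (u v W : EN N → ℝ) (a₁ a₂ : ℝ) (x : EN N) :
    ∑ i, x i * pohField u v W a₁ a₂ i x
      = 2 * (euler u x * euler v x) + ‖x‖ ^ 2 * (W x - gradDot u v x)
        + (a₁ * v x * euler u x + a₂ * u x * euler v x) := by
  have e : ∀ i, x i * pohField u v W a₁ a₂ i x
      = euler v x * (x i * pd i u x) + euler u x * (x i * pd i v x)
        + (W x - gradDot u v x) * ‖x i‖ ^ 2
        + (a₁ * v x * (x i * pd i u x) + a₂ * u x * (x i * pd i v x)) := fun i => by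
    rw [pohField, Real.norm_eq_abs, sq_abs]; ring
  simp_rw [e, Finset.sum_add_distrib, ← Finset.mul_sum, ← EuclideanSpace.norm_sq_eq]
  have e1 : ∑ i, x i * pd i u x = euler u x := rfl
  have e2 : ∑ i, x i * pd i v x = euler v x := rfl
  rw [e1, e2]; ring

lemma euler_mul_rpow {c v : EN N → ℝ} (hc : ContDiff ℝ 1 c) (hv : ContDiff ℝ 2 v)
    (pv : ∀ y, 0 < v y) (x : EN N) :
    euler (fun y => c y * v y ^ (p + 1)) x
      = v x ^ (p + 1) * euler c x + (p + 1) * (c x * v x ^ p * euler v x) := by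
  have d1 := hc.differentiable (by norm_num) x
  have d2 := hv.differentiable (by norm_num) x
  have hder := Real.hasDerivAt_rpow_const (p := p + 1) (Or.inl (pv x).ne')
  have d3 : DifferentiableAt ℝ (fun y => v y ^ (p + 1)) x := d2.rpow_const (Or.inl (pv x).ne')
  have e : ∀ i, pd i (fun y => c y * v y ^ (p + 1)) x
      = v x ^ (p + 1) * pd i c x + (p + 1) * (c x * v x ^ p * pd i v x) := fun i => by
    rw [pd_mul d1 d3, pd_comp (h := fun t => t ^ (p + 1)) hder.differentiableAt d2, hder.deriv,
      add_sub_cancel_right]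
    ring
  unfold euler
  simp_rw [e, Finset.mul_sum, ← Finset.sum_add_distrib]
  exact Finset.sum_congr rfl fun i _ => by ring

lemma euler_add {f g : EN N → ℝ} (hf : ContDiff ℝ 1 f) (hg : ContDiff ℝ 1 g) (x : EN N) :
    euler (fun y => f y + g y) x = euler f x + euler g x := by
  unfold euler
  simp_rw [pd_add (hf.differentiable (by norm_num) x) (hg.differentiable (by norm_num) x), mul_add,
    Finset.sum_add_distrib]

lemma euler_const_mul (s : ℝ) {f : EN N → ℝ} (hf : ContDiff ℝ 1 f) (x : EN N) :
    euler (fun y => s * f y) x = s * euler f x := by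
  unfold euler
  simp_rw [pd_const_mul s (hf.differentiable (by norm_num) x), Finset.mul_sum]
  exact Finset.sum_congr rfl fun i _ => by ring

/-- The potential term of the Pohozaev field. -/
noncomputable def pohPot (p q : ℝ) (c d u v : EN N → ℝ) (y : EN N) : ℝ :=
  1 / (p + 1) * (c y * v y ^ (p + 1)) + 1 / (q + 1) * (d y * u y ^ (q + 1))

variable {c d u v : EN N → ℝ}

lemma Sol.mul_rpow_contDiff (h : Sol p q κ c d u v) (s : ℝ) :
    ContDiff ℝ 1 (fun y => c y * v y ^ s) :=
  h.cc.mul ((h.cv.of_le (by norm_num)).rpow_const_of_ne fun y => (h.pv y).ne')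

lemma Sol.pohPot_contDiff (h : Sol p q κ c d u v) : ContDiff ℝ 1 (pohPot p q c d u v) :=
  (contDiff_const.mul (h.mul_rpow_contDiff _)).add
    (contDiff_const.mul (h.swap.mul_rpow_contDiff _))

lemma Sol.abs_euler_coeff_le (h : Sol p q κ c d u v) {x : EN N} (hx : ‖x‖ ≤ 1) :
    |euler c x| ≤ N * κ := by
  refine (abs_euler_le c hx).trans ?_
  refine (Finset.sum_le_card_nsmul _ _ κ fun i _ => h.gc x (by linarith) i).trans_eq ?_
  simp

lemma Sol.div_pohField_ge (h : Sol p q κ c d u v) (hp : 0 < p) (hq : 0 < q) {a₁ a₂ δ : ℝ}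
    (ha : a₁ + a₂ = N - 2) (hδ : 0 < δ) (h₁ : a₁ + δ ≤ N / (p + 1)) (h₂ : a₂ + δ ≤ N / (q + 1))
    (hκ : N * κ ≤ δ / 4) {x : EN N} (hx : ‖x‖ ≤ 1) :
    δ / 4 * (u x ^ (q + 1) + v x ^ (p + 1))
      ≤ ∑ i, pd i (pohField u v (pohPot p q c d u v) a₁ a₂ i) x := by
  have hx2 : ‖x‖ < 2 := by linarith
  have hW : euler (pohPot p q c d u v) x
      = 1 / (p + 1) * (v x ^ (p + 1) * euler c x + (p + 1) * (c x * v x ^ p * euler v x))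
      + 1 / (q + 1) * (u x ^ (q + 1) * euler d x + (q + 1) * (d x * u x ^ q * euler u x)) := by
    rw [← euler_mul_rpow h.cc h.cv h.pv, ← euler_mul_rpow h.cd h.cu h.pu,
      ← euler_const_mul _ (h.mul_rpow_contDiff _), ← euler_const_mul _ (h.swap.mul_rpow_contDiff _),
      ← euler_add (contDiff_const.mul (h.mul_rpow_contDiff _))
        (contDiff_const.mul (h.swap.mul_rpow_contDiff _))]
    rfl
  rw [sum_pd_pohField h.cu h.cv h.pohPot_contDiff ha, hW]
  have eu : lapl u x = -(c x * v x ^ p) := by rw [← h.eu x hx2, neg_neg]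
  have ev : lapl v x = -(d x * u x ^ q) := by rw [← h.ev x hx2, neg_neg]
  have e1 : v x ^ (p + 1) = v x ^ p * v x := Real.rpow_add_one (h.pv x).ne' p
  have e2 : u x ^ (q + 1) = u x ^ q * u x := Real.rpow_add_one (h.pu x).ne' q
  have hV : 0 < v x ^ (p + 1) := Real.rpow_pos_of_pos (h.pv x) _
  have hU : 0 < u x ^ (q + 1) := Real.rpow_pos_of_pos (h.pu x) _
  have hmain : ∀ {s : ℝ} {c : EN N → ℝ} {a : ℝ}, 0 < s → |euler c x| ≤ N * κ → 1 / 2 ≤ c x →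
      a + δ ≤ N / (s + 1) → δ / 4 ≤ (N / (s + 1) - a) * c x + 1 / (s + 1) * euler c x := by
    intro s c a hs hc hc2 ha
    have f1 : |1 / (s + 1) * euler c x| ≤ 1 * (N * κ) := by
      rw [abs_mul, abs_of_pos (by positivity)]
      gcongr
      rw [div_le_one (by positivity)]; linarith
    have f2 := neg_le_of_abs_le f1
    have f3 : δ * (1 / 2) ≤ (N / (s + 1) - a) * c x :=
      mul_le_mul (by linarith) hc2 (by norm_num) (by linarith)
    linarith
  have m1 := hmain hp (h.abs_euler_coeff_le hx) (h.bc x hx2).1 h₁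
  have m2 := hmain hq (h.swap.abs_euler_coeff_le hx) (h.bd x hx2).1 h₂
  have n1 := mul_le_mul_of_nonneg_right m1 hV.le
  have n2 := mul_le_mul_of_nonneg_right m2 hU.le
  refine le_of_le_of_eq (b := ((N / (p + 1) - a₁) * c x + 1 / (p + 1) * euler c x) * v x ^ (p + 1)
    + ((N / (q + 1) - a₂) * d x + 1 / (q + 1) * euler d x) * u x ^ (q + 1)) (by linarith) ?_
  rw [eu, ev, pohPot, e1, e2]
  field_simp
  ring

/-- Size of a function and its gradient. -/
noncomputable def jet (f : EN N → ℝ) (x : EN N) : ℝ := f x + ∑ i, |pd i f x|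

lemma jet_continuous {f : EN N → ℝ} (hf : ContDiff ℝ 2 f) : Continuous (jet f) :=
  hf.continuous.add (continuous_finsetSum _ fun i _ => (pd_continuous i
      (hf.of_le (by norm_num))).abs)

lemma Sol.pohField_radial_le (h : Sol p q κ c d u v) (hp : 0 < p) (hq : 0 < q) (a₁ a₂ : ℝ)
    {x : EN N} (hx : ‖x‖ ≤ 1) :
    ∑ i, x i * pohField u v (pohPot p q c d u v) a₁ a₂ i x
      ≤ (3 + |a₁| + |a₂|) * (jet u x * jet v x + (u x ^ (q + 1) + v x ^ (p + 1))) := by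
  have hx2 : ‖x‖ < 2 := by linarith
  rw [sum_coord_mul_pohField]
  have hu := h.pu x
  have hv := h.pv x
  have hV : 0 < v x ^ (p + 1) := Real.rpow_pos_of_pos (h.pv x) _
  have hU : 0 < u x ^ (q + 1) := Real.rpow_pos_of_pos (h.pu x) _
  have hSu : 0 ≤ ∑ i, |pd i u x| := Finset.sum_nonneg fun i _ => abs_nonneg _
  have hSv : 0 ≤ ∑ i, |pd i v x| := Finset.sum_nonneg fun i _ => abs_nonneg _
  have b1 := abs_euler_le u hx
  have b2 := abs_euler_le v hx
  have b3 := abs_gradDot_le u v x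
  have hx1 : ‖x‖ ^ 2 ≤ 1 := pow_le_one₀ (norm_nonneg x) hx
  unfold jet
  set Su := ∑ i, |pd i u x|
  set Sv := ∑ i, |pd i v x|
  set P := u x + Su
  set Q := v x + Sv
  have hP : 0 < P := by positivity
  have hQ : 0 < Q := by positivity
  have c1 : euler u x * euler v x ≤ P * Q := by
    refine (le_abs_self _).trans ?_
    rw [abs_mul]
    exact mul_le_mul (b1.trans (by linarith)) (b2.trans (by linarith)) (abs_nonneg _) hP.le
  have c2 : -gradDot u v x ≤ P * Q := by
    refine (neg_le_abs _).trans (b3.trans ?_)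
    exact mul_le_mul (by linarith) (by linarith) hSv hP.le
  have c3 : a₁ * v x * euler u x ≤ |a₁| * (P * Q) := by
    refine (le_abs_self _).trans ?_
    rw [abs_mul, abs_mul, abs_of_pos hv, mul_assoc]
    refine mul_le_mul_of_nonneg_left ?_ (abs_nonneg _)
    rw [mul_comm P]
    exact mul_le_mul (by linarith) (b1.trans (by linarith)) (abs_nonneg _) hQ.le
  have c4 : a₂ * u x * euler v x ≤ |a₂| * (P * Q) := by
    refine (le_abs_self _).trans ?_
    rw [abs_mul, abs_mul, abs_of_pos hu, mul_assoc]
    refine mul_le_mul_of_nonneg_left ?_ (abs_nonneg _)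
    exact mul_le_mul (by linarith) (b2.trans (by linarith)) (abs_nonneg _) hP.le
  have c5 : pohPot p q c d u v x ≤ 2 * (u x ^ (q + 1) + v x ^ (p + 1)) := by
    have g1 : 1 / (p + 1) * (c x * v x ^ (p + 1)) ≤ 1 * (2 * v x ^ (p + 1)) := by
      have hc := h.bc x hx2
      have : 1 / (p + 1) ≤ 1 := by rw [div_le_one (by positivity)]; linarith
      have h0 : 0 ≤ c x := by linarith [hc.1]
      gcongr
      exact hc.2
    have g2 : 1 / (q + 1) * (d x * u x ^ (q + 1)) ≤ 1 * (2 * u x ^ (q + 1)) := by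
      have hc := h.bd x hx2
      have : 1 / (q + 1) ≤ 1 := by rw [div_le_one (by positivity)]; linarith
      have h0 : 0 ≤ d x := by linarith [hc.1]
      gcongr
      exact hc.2
    unfold pohPot
    linarith
  have c6 : ‖x‖ ^ 2 * (pohPot p q c d u v x - gradDot u v x)
      ≤ 1 * (2 * (u x ^ (q + 1) + v x ^ (p + 1)) + P * Q) := by
    refine (mul_le_mul_of_nonneg_left
        (by linarith : _ ≤ 2 * (u x ^ (q + 1) + v x ^ (p + 1)) + P * Q)
      (by positivity)).trans ?_
    gcongr
  have hPQ : 0 < P * Q := by positivity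
  have k1 := mul_nonneg (abs_nonneg a₁) (add_pos hU hV).le
  have k2 := mul_nonneg (abs_nonneg a₂) (add_pos hU hV).le
  nlinarith

end PohozaevInequality

section PohozaevIntegrated

variable {N : ℕ} {p q κ : ℝ} {c d u v : EN N → ℝ}

/-- The radial cutoff whose derivative in `‖x‖ ^ 2` is `-g`. -/
lemma exists_radial_primitive {g : ℝ → ℝ} (hg : Continuous g) (hg0 : ∀ t, 0 ≤ g t) {t₁ : ℝ}
    (hsupp : ∀ t, g t ≠ 0 → t₁ < t ∧ t < 1) (N : ℕ) :
    ∃ ψ : EN N → ℝ, ContDiff ℝ 1 ψ ∧ (∀ x, 0 ≤ ψ x) ∧ (∀ x, 1 ≤ ‖x‖ → ψ x = 0) ∧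
      (∀ x, ‖x‖ ^ 2 ≤ t₁ → ψ x = ∫ t in Icc (0 : ℝ) 1, g t) ∧
      ∀ i x, pd i ψ x = -2 * (x i * g (‖x‖ ^ 2)) := by
  have hM : ∫ t in Icc (0 : ℝ) 1, g t = ∫ t in (0 : ℝ)..1, g t := by
    rw [intervalIntegral.integral_of_le zero_le_one, integral_Icc_eq_integral_Ioc]
  have hd : ∀ t, HasDerivAt (fun t => ∫ s in (0 : ℝ)..t, g s) (g t) t := hasDerivAt_primitive hg
  have hC : ContDiff ℝ 1 (fun t => ∫ s in (0 : ℝ)..t, g s) := by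
    rw [contDiff_one_iff_deriv]
    refine ⟨fun t => (hd t).differentiableAt, ?_⟩
    rwa [show deriv (fun t => ∫ s in (0 : ℝ)..t, g s) = g from funext fun t => (hd t).deriv]
  have hmono : Monotone (fun t => ∫ s in (0 : ℝ)..t, g s) :=
    monotone_of_deriv_nonneg (fun t => (hd t).differentiableAt) fun t => by
      rw [(hd t).deriv]; exact hg0 t
  have hlate : ∀ t, 1 ≤ t → ∫ s in (0 : ℝ)..t, g s = ∫ s in (0 : ℝ)..1, g s := fun t ht => by
    have h1 : ∫ s in (1 : ℝ)..t, g s = 0 := by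
      rw [intervalIntegral.integral_congr (g := fun _ => 0)]
      · simp
      · intro s hs
        rw [uIcc_of_le ht] at hs
        by_contra hne
        have h2 := hsupp s hne
        linarith [hs.1, h2.2]
    rw [← intervalIntegral.integral_add_adjacent_intervals (hg.intervalIntegrable 0 1)
      (hg.intervalIntegrable 1 t), h1, add_zero]
  have hsq : ∀ x : EN N, ‖x‖ ^ 2 = ‖x - 0‖ ^ 2 := fun x => by rw [sub_zero]
  refine ⟨fun x => (∫ t in (0 : ℝ)..1, g t) - ∫ s in (0 : ℝ)..(‖x‖ ^ 2), g s, ?_, ?_, ?_, ?_, ?_⟩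
  · exact contDiff_const.sub (hC.comp (contDiff_norm_sq ℝ))
  · intro x
    rcases le_total 1 (‖x‖ ^ 2) with h | h
    · simp only [hlate _ h, sub_self, le_refl]
    · exact sub_nonneg.2 (hmono h)
  · intro x hx
    simp only [hlate _ (one_le_pow₀ hx), sub_self]
  · intro x hx
    simp only []
    rw [hM, sub_eq_self, intervalIntegral.integral_congr (g := fun _ => 0)]
    · simp
    · intro s hs
      rw [uIcc_of_le (by positivity)] at hs
      by_contra hne
      have h2 := hsupp s hne
      linarith [hs.2, h2.1]
  · intro i x
    have hn : DifferentiableAt ℝ (fun x : EN N => ‖x‖ ^ 2) x :=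
      (contDiff_norm_sq (n := 1) ℝ).differentiable (by norm_num) x
    have hcomp : DifferentiableAt ℝ (fun x : EN N => ∫ s in (0 : ℝ)..(‖x‖ ^ 2), g s) x :=
      (hd _).differentiableAt.comp x hn
    have hpn : pd i (fun x : EN N => ‖x‖ ^ 2) x = 2 * x i := by
      have := pd_normSq i 0 x
      simpa using this
    rw [pd_sub (differentiableAt_const _) hcomp, pd_const,
      pd_comp (h := fun t => ∫ s in (0 : ℝ)..t, g s) (hd _).differentiableAt hn, (hd _).deriv, hpn]
    ring

lemma Sol.pohozaev_inequality (h : Sol p q κ c d u v) (hp : 0 < p) (hq : 0 < q) {a₁ a₂ δ : ℝ}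
    (ha : a₁ + a₂ = N - 2) (hδ : 0 < δ) (h₁ : a₁ + δ ≤ N / (p + 1)) (h₂ : a₂ + δ ≤ N / (q + 1))
    (hκ : N * κ ≤ δ / 4) {g : ℝ → ℝ} (hg : Continuous g) (hg0 : ∀ t, 0 ≤ g t) {r : ℝ}
    (hsupp : ∀ t, g t ≠ 0 → r ^ 2 < t ∧ t < 1) :
    δ / 4 * ((∫ t in Icc (0 : ℝ) 1, g t) * ∫ x in closedBall 0 r, (u x ^ (q + 1) + v x ^ (p + 1)))
      ≤ 2 * (3 + |a₁| + |a₂|) * ∫ x in closedBall 0 1, g (‖x‖ ^ 2) *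
        (jet u x * jet v x + (u x ^ (q + 1) + v x ^ (p + 1))) := by
  obtain ⟨ψ, hψ, hψ0, hψ1, hψr, hψd⟩ := exists_radial_primitive hg hg0 hsupp N
  set Y := pohField u v (pohPot p q c d u v) a₁ a₂ with hY
  have hYc : ∀ i, ContDiff ℝ 1 (Y i) := fun i => pohField_contDiff h.cu h.cv h.pohPot_contDiff _ _ i
  have hψs : HasCompactSupport ψ := hasCompactSupport_of_zero_outside (R := 1) fun y hy => hψ1 y hy
  have hUV : Continuous fun x => u x ^ (q + 1) + v x ^ (p + 1) :=
      (h.upow_cont _).add (h.vpow_cont _)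
  have hpt : ∀ x i, pd i (fun y => ψ y * Y i y) x
      = ψ x * pd i (Y i) x - 2 * (g (‖x‖ ^ 2) * (x i * Y i x)) := fun x i => by
    rw [pd_mul (hψ.differentiable (by norm_num) x) ((hYc i).differentiable (by norm_num) x), hψd]
    ring
  have hzero : ∫ x, ∑ i, pd i (fun y => ψ y * Y i y) x = 0 := by
    rw [integral_finsetSum]
    · exact Finset.sum_eq_zero fun i _ => integral_pd_eq_zero i (hψ.mul (hYc i)) hψs.mul_right
    · intro i _
      exact (pd_continuous i (hψ.mul (hYc i))).integrable_of_hasCompactSupport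
        (hasCompactSupport_pd i hψs.mul_right)
  set D : EN N → ℝ := fun x => ∑ i, pd i (Y i) x with hD
  set R : EN N → ℝ := fun x => ∑ i, x i * Y i x with hR
  have hDc : Continuous D := continuous_finsetSum _ fun i _ => pd_continuous i (hYc i)
  have hRc : Continuous R := continuous_finsetSum _ fun i _ =>
    (by fun_prop : Continuous fun x : EN N => x i).mul (hYc i).continuous
  have hgc : Continuous fun x : EN N => g (‖x‖ ^ 2) := hg.comp (by fun_prop)
  have hgs : ∀ x : EN N, 1 ≤ ‖x‖ → g (‖x‖ ^ 2) = 0 := fun x hx => by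
    by_contra hne
    have := (hsupp _ hne).2
    have := one_le_pow₀ hx (n := 2)
    linarith
  have hsum : ∀ x, ∑ i, pd i (fun y => ψ y * Y i y) x = ψ x * D x - 2 * (g (‖x‖ ^ 2) * R x) := by
    intro x
    simp_rw [hpt, Finset.sum_sub_distrib, ← Finset.mul_sum]
    rfl
  have hi1 : Integrable fun x => ψ x * D x :=
    (hψ.continuous.mul hDc).integrable_of_hasCompactSupport hψs.mul_right
  have hi2 : Integrable fun x => 2 * (g (‖x‖ ^ 2) * R x) :=
    (continuous_const.mul (hgc.mul hRc)).integrable_of_hasCompactSupport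
      (hasCompactSupport_of_zero_outside (R := 1) fun y hy => by simp [hgs y hy])
  simp_rw [hsum] at hzero
  rw [integral_sub hi1 hi2, sub_eq_zero, integral_const_mul] at hzero
  have hleft : δ / 4 * ((∫ t in Icc (0 : ℝ) 1, g t) *
      ∫ x in closedBall 0 r, (u x ^ (q + 1) + v x ^ (p + 1))) ≤ ∫ x, ψ x * D x := by
    have hψE : Integrable fun x => δ / 4 * (ψ x * (u x ^ (q + 1) + v x ^ (p + 1))) :=
      (continuous_const.mul (hψ.continuous.mul hUV)).integrable_of_hasCompactSupport
        (hψs.mul_right.mul_left)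
    have hnn : ∀ x, 0 ≤ δ / 4 * (ψ x * (u x ^ (q + 1) + v x ^ (p + 1))) := fun x => by
      have := hψ0 x
      have := Real.rpow_pos_of_pos (h.pu x) (q + 1)
      have := Real.rpow_pos_of_pos (h.pv x) (p + 1)
      positivity
    have s1 : ∫ x, δ / 4 * (ψ x * (u x ^ (q + 1) + v x ^ (p + 1))) ≤ ∫ x, ψ x * D x := by
      refine integral_mono hψE hi1 fun x => ?_
      rcases le_total 1 ‖x‖ with hx | hx
      · simp [hψ1 x hx]
      · have := mul_le_mul_of_nonneg_left (h.div_pohField_ge hp hq ha hδ h₁ h₂ hκ hx) (hψ0 x)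
        simp only [hD, hY]
        linarith
    have s2 : ∫ x in closedBall 0 r, δ / 4 * (ψ x * (u x ^ (q + 1) + v x ^ (p + 1)))
        ≤ ∫ x, δ / 4 * (ψ x * (u x ^ (q + 1) + v x ^ (p + 1))) :=
      setIntegral_le_integral hψE (.of_forall hnn)
    have s3 : ∫ x in closedBall 0 r, δ / 4 * (ψ x * (u x ^ (q + 1) + v x ^ (p + 1)))
        = δ / 4 * ((∫ t in Icc (0 : ℝ) 1, g t) *
          ∫ x in closedBall 0 r, (u x ^ (q + 1) + v x ^ (p + 1))) := by
      rw [integral_const_mul, ← integral_const_mul (∫ t in Icc (0 : ℝ) 1, g t)]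
      congr 1
      refine setIntegral_congr_fun measurableSet_closedBall fun x hx => ?_
      rw [mem_closedBall_zero_iff] at hx
      rw [hψr x (pow_le_pow_left₀ (norm_nonneg x) hx 2)]
    linarith
  have hright : ∫ x, g (‖x‖ ^ 2) * R x ≤ (3 + |a₁| + |a₂|) * ∫ x in closedBall 0 1, g (‖x‖ ^ 2) *
        (jet u x * jet v x + (u x ^ (q + 1) + v x ^ (p + 1))) := by
    have t1 : ∫ x in closedBall 0 1, g (‖x‖ ^ 2) * R x = ∫ x, g (‖x‖ ^ 2) * R x := by
      refine setIntegral_eq_integral_of_forall_compl_eq_zero fun x hx => ?_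
      rw [mem_closedBall_zero_iff, not_le] at hx
      rw [hgs x hx.le, zero_mul]
    have hJ : Continuous fun x => g (‖x‖ ^ 2) *
        (jet u x * jet v x + (u x ^ (q + 1) + v x ^ (p + 1))) :=
      hgc.mul (((jet_continuous h.cu).mul (jet_continuous h.cv)).add hUV)
    rw [← t1, ← integral_const_mul]
    refine setIntegral_mono_on ((hgc.mul hRc).integrableOn_closedBall 1)
      ((continuous_const.mul hJ).integrableOn_closedBall 1) measurableSet_closedBall fun x hx => ?_
    rw [mem_closedBall_zero_iff] at hx
    have := mul_le_mul_of_nonneg_left (h.pohField_radial_le hp hq a₁ a₂ hx) (hg0 (‖x‖ ^ 2))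
    simp only [hR, hY]
    linarith
  linarith

end PohozaevIntegrated

section Moments

variable {N : ℕ}

lemma one_add_rpow_le {t z : ℝ} (ht : 0 ≤ t) (hz : 0 ≤ z) : (1 + t) ^ z ≤ 2 ^ z * (1 + t ^ z) := by
  have h1 : (1 + t) ^ z ≤ (2 * max 1 t) ^ z :=
    Real.rpow_le_rpow (by positivity) (by linarith [le_max_left 1 t, le_max_right 1 t]) hz
  rw [Real.mul_rpow (by norm_num) (by positivity)] at h1
  refine h1.trans (mul_le_mul_of_nonneg_left ?_ (by positivity))
  rcases max_cases 1 t with ⟨h, _⟩ | ⟨h, _⟩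
  · rw [h, Real.one_rpow]; have := Real.rpow_nonneg ht z; linarith
  · rw [h]; linarith

/-- Weighted moment bound for a function dominated by a potential. -/
lemma exists_moment_bound (hN : 3 ≤ N) {τ s z h M : ℝ} (hτ0 : 0 < τ) (hτ1 : τ < 1) (hs : 1 ≤ s)
    (hsz : s ≤ z) (hh : h ≤ τ * (N - (N - 1) * (1 / s - 1 / z))) (hM : 1 ≤ M) :
    ∃ C : ℝ, 0 < C ∧ ∃ m : ℝ, 0 ≤ m ∧ ∀ X K ρ ε : ℝ, 1 ≤ X → 1 ≤ K → ρ ≤ 1 → 0 < ε → ε < 1 →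
      ∀ f : EN N → ℝ, Continuous f → (∀ y, ‖y‖ ≤ 1 → 0 ≤ f y) →
      1 + (∫ y in closedBall 0 ρ, f y ^ s) ≤ M * K →
      ∀ w : EN N → ℝ, Continuous w → (∀ x, 0 ≤ w x) → (∀ x, w x ≤ 1) →
      (∀ x, w x ≠ 0 → ‖x‖ ≤ 1 ∧ slicePot ρ ε τ (fun y => f y ^ s) (‖x‖ ^ 2) ≤ M * X * K) →
      ∀ F : EN N → ℝ, Continuous F → (∀ x, 0 ≤ F x) →
      (∀ x, w x ≠ 0 → F x ≤ M * X ^ ((N : ℝ) + 2) *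
        (1 + ∫ y in closedBall 0 ρ, rker (h / 2) ε x y * f y)) →
      ∫ x in closedBall 0 1, w x * F x ^ z ≤ C * X ^ m * K ^ (z / s) := by
  obtain ⟨C, hC, H⟩ := exists_slice_potential_bound hN hτ0 hτ1 hs hsz hh
  have hs0 : 0 < s := by linarith
  have hz0 : 0 < z := by linarith
  have hzs : 0 ≤ z / s - 1 := by rw [sub_nonneg, le_div_iff₀ hs0]; linarith
  set V := (volume : Measure (EN N)).real (closedBall 0 1) with hV
  have hV0 : 0 ≤ V := measureReal_nonneg
  refine ⟨M ^ z * 2 ^ z * (V + C * M ^ (z / s - 1) * M), by positivity,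
    (N + 2) * z + (z / s - 1), by positivity, ?_⟩
  intro X K ρ ε hX hK hρ hε hε1 f hf hf0 hfK w hw hw0 hw1 hwT F hF hF0 hFB
  have hT : 0 < M * X * K := by positivity
  have hslice := H ρ hρ ε hε hε1 f hf hf0 (M * X * K) hT w hw hw0 hw1 hwT
  have hmem : ∀ y : EN N, y ∈ closedBall (0 : EN N) ρ → ‖y‖ ≤ 1 := fun y hy => by
    rw [mem_closedBall_zero_iff] at hy; linarith
  set P : EN N → ℝ := fun x => ∫ y in closedBall 0 ρ, rker (h / 2) ε x y * f y with hP
  have hPc : Continuous P :=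
    continuous_parametric_integral_of_continuous (f := fun x y => rker (h / 2) ε x y * f y)
      ((rker_continuous_uncurry (h / 2) hε).mul (hf.comp continuous_snd)) (isCompact_closedBall 0 ρ)
  have hP0 : ∀ x, 0 ≤ P x := fun x => setIntegral_nonneg measurableSet_closedBall fun y hy =>
    mul_nonneg (rker_pos hε x y).le (hf0 y (hmem y hy))
  set B := M * X ^ ((N : ℝ) + 2) with hB
  have hB0 : 0 < B := by positivity
  have hpt : ∀ x, w x * F x ^ z ≤ B ^ z * 2 ^ z * (1 + w x * P x ^ z) := fun x => by
    have hPz := Real.rpow_nonneg (hP0 x) z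
    by_cases hwx : w x = 0
    · rw [hwx]; simp only [zero_mul, add_zero, mul_one]; positivity
    have h1 : F x ^ z ≤ B ^ z * (2 ^ z * (1 + P x ^ z)) := by
      refine (Real.rpow_le_rpow (hF0 x) (hFB x hwx) hz0.le).trans ?_
      rw [Real.mul_rpow hB0.le (by linarith [hP0 x])]
      exact mul_le_mul_of_nonneg_left (one_add_rpow_le (hP0 x) hz0.le) (by positivity)
    calc w x * F x ^ z ≤ w x * (B ^ z * (2 ^ z * (1 + P x ^ z))) :=
          mul_le_mul_of_nonneg_left h1 (hw0 x)
      _ = B ^ z * 2 ^ z * (w x + w x * P x ^ z) := by ring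
      _ ≤ _ := by gcongr; exact hw1 x
  have hwP : Continuous fun x => w x * P x ^ z := hw.mul (hPc.rpow_const fun _ => Or.inr hz0.le)
  have hI : ∫ x in closedBall 0 1, w x * F x ^ z
      ≤ ∫ x in closedBall 0 1, B ^ z * 2 ^ z * (1 + w x * P x ^ z) := setIntegral_mono_on
    ((hw.mul (hF.rpow_const fun _ => Or.inr hz0.le)).integrableOn_closedBall 1)
    ((continuous_const.mul (continuous_const.add hwP)).integrableOn_closedBall 1)
    measurableSet_closedBall fun x _ => hpt x
  refine hI.trans ?_
  rw [integral_const_mul, integral_add (continuous_const.integrableOn_closedBall 1)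
    (hwP.integrableOn_closedBall 1), setIntegral_const, smul_eq_mul, mul_one, ← hV]
  have hT1 : (M * X * K) ^ (z / s - 1) * K = M ^ (z / s - 1) * (X ^ (z / s - 1) * K ^ (z / s)) := by
    rw [Real.mul_rpow (by positivity) (by positivity),
          Real.mul_rpow (by positivity) (by positivity),
      Real.rpow_sub_one (by positivity : K ≠ 0)]
    field_simp
  have hone : 1 ≤ X ^ (z / s - 1) * K ^ (z / s) := by
    have h1 := Real.one_le_rpow hX hzs
    have h2 := Real.one_le_rpow hK (by positivity : 0 ≤ z / s)
    nlinarith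
  have hBz : B ^ z = M ^ z * X ^ (((N : ℝ) + 2) * z) := by
    rw [hB, Real.mul_rpow (by positivity) (by positivity), ← Real.rpow_mul (by positivity)]
  have hsl : ∫ x in closedBall 0 1, w x * P x ^ z
      ≤ C * M ^ (z / s - 1) * M * (X ^ (z / s - 1) * K ^ (z / s)) := by
    refine hslice.trans ?_
    calc _ ≤ C * (M * X * K) ^ (z / s - 1) * (M * K) := by gcongr
      _ = C * M * ((M * X * K) ^ (z / s - 1) * K) := by ring
      _ = _ := by rw [hT1]; ring
  calc _ ≤ B ^ z * 2 ^ z * (V * (X ^ (z / s - 1) * K ^ (z / s))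
        + C * M ^ (z / s - 1) * M * (X ^ (z / s - 1) * K ^ (z / s))) := by
        gcongr
        exact le_mul_of_one_le_right hV0 hone
    _ = _ := by
        rw [hBz, Real.rpow_add (by positivity : 0 < X)]; ring

/-- Admissible exponents. -/
lemma exists_exponents {n p q : ℝ} (hn : 2 ≤ n) (hp : 0 < p) (hq : 0 < q) (hpq : 1 < p * q)
    (h : n - 2 < 2 * (p + 1) / (p * q - 1)) :
    ∃ ω y : ℝ, 0 < ω ∧ p * ω < 1 / (q + 1) ∧ ω < 1 / (p + 1) ∧ ω < q / (q + 1) ∧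
      q / (q + 1) - ω < 2 / n ∧ 1 - ω - y < 1 / n ∧ y - 1 / (q + 1) < 1 / n ∧
      1 / (q + 1) < y ∧ y < 1 - ω := by
  have hn0 : 0 < n := by linarith
  have hp1 : 1 / (p * (q + 1)) < 1 / (p + 1) :=
    one_div_lt_one_div_of_lt (by linarith) (by nlinarith)
  have hq1 : 1 / (p * (q + 1)) < q / (q + 1) := by
    rw [div_lt_div_iff₀ (by positivity) (by positivity)]
    nlinarith
  have hlow : q / (q + 1) - 2 / n < 1 / (p * (q + 1)) := by
    rw [lt_div_iff₀ (by linarith)] at h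
    rw [sub_lt_iff_lt_add, div_add_div _ _ (by positivity) (by positivity),
      div_lt_div_iff₀ (by positivity) (by positivity)]
    have h3 : n * (p * q - 1) < 2 * (p * (q + 1)) := by linarith
    have h4 := mul_lt_mul_of_pos_right h3 (by linarith : 0 < q + 1)
    nlinarith
  obtain ⟨ω, hω1, hω2⟩ := exists_between (max_lt (by positivity : 0 < 1 / (p * (q + 1))) hlow)
  rw [max_lt_iff] at hω1
  have hn1 : 0 < 1 / n := by positivity
  have h2n : 2 / n = 1 / n + 1 / n := by ring
  have hqq : q / (q + 1) = 1 - 1 / (q + 1) := by field_simp; ring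
  have hy : max (1 - ω - 1 / n) (1 / (q + 1)) < min (1 - ω) (1 / (q + 1) + 1 / n) := by
    rw [max_lt_iff, lt_min_iff, lt_min_iff]
    refine ⟨⟨?_, ?_⟩, ?_, ?_⟩ <;> linarith [hω1.2]
  obtain ⟨y, hy1, hy2⟩ := exists_between hy
  rw [max_lt_iff] at hy1
  rw [lt_min_iff] at hy2
  refine ⟨ω, y, hω1.1, ?_, by linarith, by linarith, by linarith [hω1.2], by linarith [hy1.1],
    by linarith [hy2.2], hy1.2, hy2.1⟩
  have := mul_lt_mul_of_pos_left hω2 hp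
  refine this.trans_eq ?_
  field_simp

lemma exists_common_factor {h₁ h₂ X₁ X₂ X₃ X₄ : ℝ} (a : h₁ < X₁) (b : h₁ < X₂) (c : h₂ < X₃)
    (d : h₂ < X₄) : ∃ τ : ℝ, 0 < τ ∧ τ < 1 ∧ h₁ ≤ τ * X₁ ∧ h₁ ≤ τ * X₂ ∧ h₂ ≤ τ * X₃ ∧
      h₂ ≤ τ * X₄ := by
  have key : ∀ {h X : ℝ}, h < X → ∀ᶠ τ : ℝ in 𝓝[<] 1, h < τ * X := fun {h X} hX => by
    have ht : Tendsto (fun τ : ℝ => τ * X) (𝓝[<] 1) (𝓝 (1 * X)) :=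
      ((continuous_id.mul continuous_const).tendsto (1 : ℝ)).mono_left nhdsWithin_le_nhds
    exact ht.eventually (lt_mem_nhds (by rwa [one_mul]))
  have h0 : ∀ᶠ τ : ℝ in 𝓝[<] 1, 0 < τ := nhdsWithin_le_nhds (lt_mem_nhds one_pos)
  obtain ⟨τ, h1, h2, h3, h4, h5, h6⟩ :=
    ((key a).and ((key b).and ((key c).and ((key d).and (h0.and self_mem_nhdsWithin))))).exists
  exact ⟨τ, h5, h6, h1.le, h2.le, h3.le, h4.le⟩

end Moments

section Sources

variable {N : ℕ} {p q κ : ℝ} {c d u v : EN N → ℝ}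

lemma rpow_le_one_add {t θ : ℝ} (ht : 0 ≤ t) (h0 : 0 ≤ θ) (h1 : θ ≤ 1) : t ^ θ ≤ 1 + t := by
  rcases le_total t 1 with h | h
  · linarith [Real.rpow_le_one ht h h0]
  · have := Real.rpow_le_rpow_of_exponent_le h h1
    rw [Real.rpow_one] at this
    linarith

/-- Higher integrability of `-Δu`, interpolated between `∫ v ^ p` and the energy. -/
lemma Sol.source_moment_interpolated (h : Sol p q κ c d u v) {s ρ C₀ K : ℝ} (hs : 1 ≤ s)
    (hp : 0 < p) (hps : p * (s - 1) ≤ 1) (hρ : ρ ≤ 1) (hK : 1 ≤ K)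
    (h₀ : ∫ y in closedBall 0 ρ, v y ^ p ≤ C₀)
    (h₁ : ∫ y in closedBall 0 ρ, v y ^ (p + 1) ≤ K) :
    1 + (∫ y in closedBall 0 ρ, (-lapl u y) ^ s) ≤ (1 + 2 ^ s * (C₀ + 1)) * K ^ (p * (s - 1)) := by
  have hK0 : 0 < K := by linarith
  have hθ : 0 ≤ p * (s - 1) := mul_nonneg hp.le (by linarith)
  have hpt : ∀ y ∈ closedBall (0 : EN N) ρ, (-lapl u y) ^ s
      ≤ 2 ^ s * K ^ (p * (s - 1)) * (v y ^ p + K⁻¹ * v y ^ (p + 1)) := fun y hy => by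
    have hy2 : ‖y‖ < 2 := by rw [mem_closedBall_zero_iff] at hy; linarith
    have hv := h.pv y
    have h1 : (-lapl u y) ^ s ≤ (2 * v y ^ p) ^ s :=
      Real.rpow_le_rpow (h.lapl_nonneg y hy2) (h.lapl_upper y hy2) (by linarith)
    refine h1.trans ?_
    have h2 := rpow_le_one_add (t := v y / K) (by positivity) hθ hps
    rw [Real.div_rpow hv.le hK0.le, div_le_iff₀ (by positivity)] at h2
    rw [Real.mul_rpow (by norm_num) (by positivity), ← Real.rpow_mul hv.le,
      show p * s = p + p * (s - 1) by ring, Real.rpow_add hv, Real.rpow_add hv, Real.rpow_one]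
    calc 2 ^ s * (v y ^ p * v y ^ (p * (s - 1)))
        ≤ 2 ^ s * (v y ^ p * ((1 + v y / K) * K ^ (p * (s - 1)))) := by gcongr
      _ = _ := by rw [div_eq_mul_inv]; ring
  have c1 : Continuous fun y => (-lapl u y) ^ s :=
    (lapl_continuous h.cu).neg.rpow_const fun _ => Or.inr (by linarith)
  have c2 := h.vpow_cont p
  have c3 := h.vpow_cont (p + 1)
  have c4 : Continuous fun y => K⁻¹ * v y ^ (p + 1) := continuous_const.mul c3
  have hI : ∫ y in closedBall 0 ρ, (-lapl u y) ^ s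
      ≤ ∫ y in closedBall 0 ρ, 2 ^ s * K ^ (p * (s - 1)) * (v y ^ p + K⁻¹ * v y ^ (p + 1)) :=
    setIntegral_mono_on (c1.integrableOn_closedBall ρ)
      ((continuous_const.mul (c2.add c4)).integrableOn_closedBall ρ) measurableSet_closedBall hpt
  rw [integral_const_mul, integral_add (c2.integrableOn_closedBall ρ)
    (c4.integrableOn_closedBall ρ), integral_const_mul] at hI
  have h2 : K⁻¹ * (∫ y in closedBall 0 ρ, v y ^ (p + 1)) ≤ 1 := by
    rw [inv_mul_le_iff₀ hK0]; linarith
  have h3 := Real.one_le_rpow hK hθ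
  calc _ ≤ K ^ (p * (s - 1)) + 2 ^ s * K ^ (p * (s - 1)) * (C₀ + 1) :=
        add_le_add h3 (hI.trans (by gcongr))
    _ = _ := by ring

/-- The energy bounds `-Δv` in its natural Lebesgue space. -/
lemma Sol.source_moment (h : Sol p q κ c d u v) (hq : 0 < q) {ρ K : ℝ} (hρ : ρ ≤ 1) (hK : 1 ≤ K)
    (h₁ : ∫ y in closedBall 0 ρ, u y ^ (q + 1) ≤ K) :
    1 + (∫ y in closedBall 0 ρ, (-lapl v y) ^ ((q + 1) / q))
      ≤ (1 + 2 ^ ((q + 1) / q)) * K := by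
  have hs : 0 ≤ (q + 1) / q := by positivity
  have hpt : ∀ y ∈ closedBall (0 : EN N) ρ, (-lapl v y) ^ ((q + 1) / q)
      ≤ 2 ^ ((q + 1) / q) * u y ^ (q + 1) := fun y hy => by
    have hy2 : ‖y‖ < 2 := by rw [mem_closedBall_zero_iff] at hy; linarith
    have hu := h.pu y
    refine (Real.rpow_le_rpow (h.swap.lapl_nonneg y hy2) (h.swap.lapl_upper y hy2) hs).trans_eq ?_
    rw [Real.mul_rpow (by norm_num) (by positivity), ← Real.rpow_mul hu.le,
      mul_div_cancel₀ _ hq.ne']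
  have c1 : Continuous fun y => (-lapl v y) ^ ((q + 1) / q) :=
    (lapl_continuous h.cv).neg.rpow_const fun _ => Or.inr hs
  have c2 := h.upow_cont (q + 1)
  have hI : ∫ y in closedBall 0 ρ, (-lapl v y) ^ ((q + 1) / q)
      ≤ ∫ y in closedBall 0 ρ, 2 ^ ((q + 1) / q) * u y ^ (q + 1) :=
    setIntegral_mono_on (c1.integrableOn_closedBall ρ)
      ((continuous_const.mul c2).integrableOn_closedBall ρ) measurableSet_closedBall hpt
  rw [integral_const_mul] at hI
  have := mul_le_mul_of_nonneg_left h₁ (by positivity : (0 : ℝ) ≤ 2 ^ ((q + 1) / q))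
  linarith

/-- Pointwise domination of a superharmonic function and of its jet by Riesz-type potentials. -/
lemma exists_potential_domination (hN : 3 ≤ N) {A : ℝ} (hA : 0 ≤ A) :
    ∃ C : ℝ, 1 ≤ C ∧ ∀ u : EN N → ℝ, ContDiff ℝ 2 u → (∀ y, ‖y‖ < 2 → 0 ≤ u y) →
      (∀ y, ‖y‖ < 2 → 0 ≤ -lapl u y) → (∫ y in ann N, u y) ≤ A →
      ∀ r ρ, 1 / 2 ≤ r → r < ρ → ρ ≤ 1 → ∀ᶠ ε in 𝓝[>] (0 : ℝ), 0 < ε ∧ ε < 1 ∧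
        ∀ x, ‖x‖ ≤ r →
          u x ≤ C * ((ρ - r)⁻¹) ^ ((N : ℝ) + 2) *
            (1 + ∫ y in closedBall 0 ρ, rker (((N : ℝ) - 2) / 2) ε x y * (-lapl u y)) ∧
          jet u x ≤ C * ((ρ - r)⁻¹) ^ ((N : ℝ) + 2) *
            (1 + ∫ y in closedBall 0 ρ, rker (((N : ℝ) - 1) / 2) ε x y * (-lapl u y)) := by
  obtain ⟨C, hC, H⟩ := representation hN
  have hNR : (3 : ℝ) ≤ N := by exact_mod_cast hN
  set D := (1 + C * A + 3 * C) with hD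
  have hD1 : 1 ≤ D := by rw [hD]; nlinarith
  have hCD : 3 * C ≤ D := by rw [hD]; nlinarith
  refine ⟨(N + 1) * D, by nlinarith, ?_⟩
  intro u hu hu0 hl hA' r ρ hr hrρ hρ
  have h1 : ∀ᶠ ε in 𝓝[>] (0 : ℝ), ε < 1 := nhdsWithin_le_nhds (gt_mem_nhds one_pos)
  filter_upwards [H u hu hu0 hl r ρ hr hrρ hρ, h1] with ε hε hε1
  refine ⟨hε.1, hε1, fun x hx => ?_⟩
  obtain ⟨hux, hpx⟩ := hε.2 x hx
  have hmem : ∀ y : EN N, y ∈ closedBall (0 : EN N) ρ → ‖y‖ ≤ 1 := fun y hy => by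
    rw [mem_closedBall_zero_iff] at hy; linarith
  have hl' : ∀ y ∈ closedBall (0 : EN N) ρ, 0 ≤ -lapl u y := fun y hy =>
    hl y (by linarith [hmem y hy])
  have hlc : Continuous fun y => -lapl u y := (lapl_continuous hu).neg
  set I₂ := ∫ y in closedBall 0 ρ, rker (((N : ℝ) - 2) / 2) ε x y * (-lapl u y) with hI₂
  set I₁ := ∫ y in closedBall 0 ρ, rker (((N : ℝ) - 1) / 2) ε x y * (-lapl u y) with hI₁
  have h20 : 0 ≤ I₂ := setIntegral_nonneg measurableSet_closedBall fun y hy =>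
    mul_nonneg (rker_pos hε.1 x y).le (hl' y hy)
  have h10 : 0 ≤ I₁ := setIntegral_nonneg measurableSet_closedBall fun y hy =>
    mul_nonneg (rker_pos hε.1 x y).le (hl' y hy)
  have hX : 1 ≤ (ρ - r)⁻¹ := (one_le_inv₀ (by linarith)).2 (by linarith)
  have hXe : (ρ - r) ^ (-(N + 2) : ℝ) = ((ρ - r)⁻¹) ^ ((N : ℝ) + 2) := by
    rw [Real.rpow_neg (by linarith), Real.inv_rpow (by linarith)]
  rw [hXe] at hux hpx
  set Y := ((ρ - r)⁻¹) ^ ((N : ℝ) + 2) with hY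
  have hY1 : 1 ≤ Y := Real.one_le_rpow hX (by linarith)
  have h21 : I₂ ≤ 3 * I₁ := by
    rw [hI₁, ← integral_const_mul]
    refine setIntegral_mono_on (((rker_continuous _ hε.1 x).mul hlc).integrableOn_closedBall ρ)
      ((continuous_const.mul ((rker_continuous _ hε.1 x).mul hlc)).integrableOn_closedBall ρ)
      measurableSet_closedBall fun y hy => ?_
    rw [← mul_assoc]
    refine mul_le_mul_of_nonneg_right ?_ (hl' y hy)
    have hb := rker_base_pos hε.1 x y
    have hb9 : ‖y - x‖ ^ 2 + ε ^ 2 ≤ 3 ^ 2 := by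
      have h3 : ‖y - x‖ ≤ 2 := by
        have := norm_sub_le y x
        linarith [hmem y hy]
      have := norm_nonneg (y - x)
      nlinarith [hε.1]
    have hs : (‖y - x‖ ^ 2 + ε ^ 2) ^ ((1 : ℝ) / 2) ≤ 3 := by
      rw [← Real.sqrt_eq_rpow]
      exact (Real.sqrt_le_left (by norm_num)).2 hb9
    rw [rker, rker, show -(((N : ℝ) - 2) / 2) = 1 / 2 + -(((N : ℝ) - 1) / 2) by ring,
      Real.rpow_add hb]
    gcongr
  have hb2 : 1 + C * I₂ + C * Y * (∫ y in ann N, u y) ≤ D * Y * (1 + I₂) := by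
    have e1 : C * Y * (∫ y in ann N, u y) ≤ C * Y * A := by gcongr
    have e2 : C * I₂ ≤ D * Y * I₂ := by
      gcongr; nlinarith
    have e3 : 1 + C * Y * A ≤ D * Y := by rw [hD]; nlinarith
    linarith
  have hb1 : 1 + C * I₁ + C * Y * (∫ y in ann N, u y) ≤ D * Y * (1 + I₁) := by
    have e1 : C * Y * (∫ y in ann N, u y) ≤ C * Y * A := by gcongr
    have e2 : C * I₁ ≤ D * Y * I₁ := by
      gcongr; nlinarith
    have e3 : 1 + C * Y * A ≤ D * Y := by rw [hD]; nlinarith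
    linarith
  have hb3 : 1 + C * I₂ + C * Y * (∫ y in ann N, u y) ≤ D * Y * (1 + I₁) := by
    have e1 : C * Y * (∫ y in ann N, u y) ≤ C * Y * A := by gcongr
    have e2 : C * I₂ ≤ D * Y * I₁ := by
      calc C * I₂ ≤ C * (3 * I₁) := by gcongr
        _ = 3 * C * I₁ := by ring
        _ ≤ _ := mul_le_mul_of_nonneg_right (hCD.trans
            (le_mul_of_one_le_right (by linarith) hY1)) h10
    have e3 : 1 + C * Y * A ≤ D * Y := by rw [hD]; nlinarith
    linarith
  refine ⟨hux.trans (hb2.trans ?_), ?_⟩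
  · have : D * Y * (1 + I₂) ≤ (N + 1) * (D * Y * (1 + I₂)) :=
      le_mul_of_one_le_left (by positivity) (by linarith)
    linarith
  · have hsum : ∑ i, |pd i u x| ≤ N * (D * Y * (1 + I₁)) := by
      refine (Finset.sum_le_card_nsmul _ _ _ fun i _ => (hpx i).trans hb1).trans_eq ?_
      simp
    rw [jet]
    linarith [hux.trans hb3]

end Sources

section Interpolation

variable {N : ℕ}

lemma mul_le_rpow_add_rpow {s t z z' : ℝ} (hs : 0 ≤ s) (ht : 0 ≤ t) (h : z.HolderConjugate z') :
    s * t ≤ s ^ z + t ^ z' := by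
  refine (Real.young_inequality_of_nonneg hs ht h).trans (add_le_add ?_ ?_)
  · exact div_le_self (by positivity) h.lt.le
  · exact div_le_self (by positivity) h.symm.lt.le

/-- Interpolation of the integrals on a good annulus. -/
lemma weighted_energy_bound {w P Q U V : EN N → ℝ} (hw : Continuous w) (hP : Continuous P)
    (hQ : Continuous Q) (hU : Continuous U) (hV : Continuous V) (hw0 : ∀ x, 0 ≤ w x)
    (hw1 : ∀ x, w x ≤ 1) (hP0 : ∀ x, 0 ≤ P x) (hQ0 : ∀ x, 0 ≤ Q x)
    (hV0 : ∀ x, 0 < V x) {p q z z' z₃ e e₁ b b₃ K Y C : ℝ} (hp : 0 < p) (hq : 0 < q)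
    (hz : z.HolderConjugate z') (hz₃ : p + 1 ≤ z₃) (hK : 1 ≤ K)
    (hY : 1 ≤ Y) (hC : 0 ≤ C) (hb₁ : e₁ + e ≤ b) (hb₂ : e₁ * (q + 1) ≤ b) (hb₃ : b₃ ≤ b)
    (hb₄ : b₃ * (p + 1 - z₃) + e * z₃ ≤ b)
    (h₁ : ∫ x in closedBall 0 1, w x * P x ^ z ≤ C * Y * K ^ (e₁ * z))
    (h₂ : ∫ x in closedBall 0 1, w x * Q x ^ z' ≤ C * Y * K ^ (e * z'))
    (h₃ : ∫ x in closedBall 0 1, w x * U x ^ (q + 1) ≤ C * Y * K ^ (e₁ * (q + 1)))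
    (h₄ : ∫ x in closedBall 0 1, w x * V x ^ z₃ ≤ C * Y * K ^ (e * z₃))
    (h₅ : ∫ x in closedBall 0 1, V x ^ p ≤ C) :
    ∫ x in closedBall 0 1, w x * (P x * Q x + (U x ^ (q + 1) + V x ^ (p + 1)))
      ≤ 5 * C * Y * K ^ b := by
  have hK0 : 0 < K := by linarith
  have hz0 := hz.pos
  have hz0' := hz.symm.pos
  have hz30 : 0 < z₃ := by linarith
  have young : ∀ x, P x * Q x ≤ K ^ (e₁ + e - e₁ * z) * P x ^ z +
      K ^ (e₁ + e - e * z') * Q x ^ z' :=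
    fun x => by
    have := mul_le_rpow_add_rpow (s := P x / K ^ e₁) (t := Q x / K ^ e)
      (div_nonneg (hP0 x) (by positivity)) (div_nonneg (hQ0 x) (by positivity)) hz
    rw [Real.div_rpow (hP0 x) (by positivity), Real.div_rpow (hQ0 x) (by positivity),
      ← Real.rpow_mul hK0.le, ← Real.rpow_mul hK0.le, div_mul_div_comm, ← Real.rpow_add hK0,
      div_le_iff₀ (by positivity)] at this
    refine this.trans_eq ?_
    rw [Real.rpow_sub hK0, Real.rpow_sub hK0]
    ring
  have split : ∀ x, w x * V x ^ (p + 1)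
      ≤ K ^ b₃ * V x ^ p + K ^ (b₃ * (p + 1 - z₃)) * (w x * V x ^ z₃) := fun x => by
    have hv := hV0 x
    rcases le_total (V x) (K ^ b₃) with h | h
    · have e1 : V x ^ (p + 1) ≤ K ^ b₃ * V x ^ p := by
        rw [Real.rpow_add hv, Real.rpow_one, mul_comm]; gcongr
      have e2 : w x * V x ^ (p + 1) ≤ V x ^ (p + 1) :=
        mul_le_of_le_one_left (by positivity) (hw1 x)
      have e3 : 0 ≤ K ^ (b₃ * (p + 1 - z₃)) * (w x * V x ^ z₃) :=
        mul_nonneg (by positivity) (mul_nonneg (hw0 x) (by positivity))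
      linarith
    · have e1 : V x ^ (p + 1) ≤ K ^ (b₃ * (p + 1 - z₃)) * V x ^ z₃ := by
        rw [show p + 1 = (p + 1 - z₃) + z₃ by ring, Real.rpow_add hv, Real.rpow_mul hK0.le,
          show p + 1 - z₃ + z₃ - z₃ = p + 1 - z₃ by ring]
        refine mul_le_mul_of_nonneg_right ?_ (by positivity)
        exact Real.rpow_le_rpow_of_nonpos (by positivity) h (by linarith)
      have e2 := mul_le_mul_of_nonneg_left e1 (hw0 x)
      have e3 : 0 ≤ K ^ b₃ * V x ^ p := by positivity
      linarith
  have hpt : ∀ x, w x * (P x * Q x + (U x ^ (q + 1) + V x ^ (p + 1)))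
      ≤ K ^ (e₁ + e - e₁ * z) * (w x * P x ^ z) + K ^ (e₁ + e - e * z') * (w x * Q x ^ z')
        + w x * U x ^ (q + 1) + K ^ b₃ * V x ^ p
        + K ^ (b₃ * (p + 1 - z₃)) * (w x * V x ^ z₃) := fun x => by
    have := mul_le_mul_of_nonneg_left (young x) (hw0 x)
    linarith [split x]
  have cP : Continuous fun x => w x * P x ^ z := hw.mul (hP.rpow_const fun _ => Or.inr hz0.le)
  have cQ : Continuous fun x => w x * Q x ^ z' := hw.mul (hQ.rpow_const fun _ => Or.inr hz0'.le)
  have cU : Continuous fun x => w x * U x ^ (q + 1) :=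
    hw.mul (hU.rpow_const fun _ => Or.inr (by linarith))
  have cV : Continuous fun x => V x ^ p := hV.rpow_const fun _ => Or.inr hp.le
  have cW : Continuous fun x => w x * V x ^ z₃ := hw.mul (hV.rpow_const fun _ => Or.inr hz30.le)
  have cV1 : Continuous fun x => V x ^ (p + 1) := hV.rpow_const fun _ => Or.inr (by linarith)
  have cU1 : Continuous fun x => U x ^ (q + 1) := hU.rpow_const fun _ => Or.inr (by linarith)
  have c1 : Continuous fun x => K ^ (e₁ + e - e₁ * z) * (w x * P x ^ z) := continuous_const.mul cP
  have c2 : Continuous fun x => K ^ (e₁ + e - e * z') * (w x * Q x ^ z') := continuous_const.mul cQ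
  have c4 : Continuous fun x => K ^ b₃ * V x ^ p := continuous_const.mul cV
  have c5 : Continuous fun x => K ^ (b₃ * (p + 1 - z₃)) * (w x * V x ^ z₃) :=
    continuous_const.mul cW
  have c12 : Continuous fun x => K ^ (e₁ + e - e₁ * z) * (w x * P x ^ z)
      + K ^ (e₁ + e - e * z') * (w x * Q x ^ z') := c1.add c2
  have c123 : Continuous fun x => K ^ (e₁ + e - e₁ * z) * (w x * P x ^ z)
      + K ^ (e₁ + e - e * z') * (w x * Q x ^ z') + w x * U x ^ (q + 1) := c12.add cU
  have c1234 : Continuous fun x => K ^ (e₁ + e - e₁ * z) * (w x * P x ^ z)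
      + K ^ (e₁ + e - e * z') * (w x * Q x ^ z') + w x * U x ^ (q + 1) + K ^ b₃ * V x ^ p :=
    c123.add c4
  have hI : ∫ x in closedBall 0 1, w x * (P x * Q x + (U x ^ (q + 1) + V x ^ (p + 1)))
      ≤ ∫ x in closedBall 0 1, (K ^ (e₁ + e - e₁ * z) * (w x * P x ^ z)
        + K ^ (e₁ + e - e * z') * (w x * Q x ^ z')
        + w x * U x ^ (q + 1) + K ^ b₃ * V x ^ p
        + K ^ (b₃ * (p + 1 - z₃)) * (w x * V x ^ z₃)) :=
    setIntegral_mono_on ((hw.mul ((hP.mul hQ).add (cU1.add cV1))).integrableOn_closedBall 1)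
      ((c1234.add c5).integrableOn_closedBall 1) measurableSet_closedBall fun x _ => hpt x
  rw [integral_add (c1234.integrableOn_closedBall 1) (c5.integrableOn_closedBall 1),
    integral_add (c123.integrableOn_closedBall 1) (c4.integrableOn_closedBall 1),
    integral_add (c12.integrableOn_closedBall 1) (cU.integrableOn_closedBall 1),
    integral_add (c1.integrableOn_closedBall 1) (c2.integrableOn_closedBall 1),
    integral_const_mul, integral_const_mul, integral_const_mul, integral_const_mul] at hI
  have hmono : ∀ {s : ℝ}, s ≤ b → C * Y * K ^ s ≤ C * Y * K ^ b := fun hs =>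
    mul_le_mul_of_nonneg_left (Real.rpow_le_rpow_of_exponent_le hK hs) (by positivity)
  have hscale : ∀ {s t I : ℝ}, I ≤ C * Y * K ^ t → s + t ≤ b → K ^ s * I ≤ C * Y * K ^ b :=
    fun {s t I} hI hst => by
      refine (mul_le_mul_of_nonneg_left hI (by positivity)).trans ?_
      refine le_trans (le_of_eq ?_) (hmono hst)
      rw [Real.rpow_add hK0]; ring
  have g1 := hscale (s := e₁ + e - e₁ * z) h₁ (by linarith)
  have g2 := hscale (s := e₁ + e - e * z') h₂ (by linarith)
  have g3 := h₃.trans (hmono hb₂)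
  have g4 := hscale (s := b₃) (t := 0) (I := ∫ x in closedBall 0 1, V x ^ p)
    (by rw [Real.rpow_zero]; nlinarith) (by linarith)
  have g5 := hscale (s := b₃ * (p + 1 - z₃)) h₄ hb₄
  linarith

end Interpolation

section EnergyStep

variable {N : ℕ} {p q : ℝ}

/-- The energy of a pair on a ball. -/
noncomputable def energy (p q : ℝ) (u v : EN N → ℝ) (r : ℝ) : ℝ :=
  ∫ x in closedBall 0 r, (u x ^ (q + 1) + v x ^ (p + 1))

lemma Sol.energy_cont {κ : ℝ} {c d u v : EN N → ℝ} (h : Sol p q κ c d u v) :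
    Continuous fun x => u x ^ (q + 1) + v x ^ (p + 1) := (h.upow_cont _).add (h.vpow_cont _)

lemma Sol.energy_nonneg {κ : ℝ} {c d u v : EN N → ℝ} (h : Sol p q κ c d u v) (r : ℝ) :
    0 ≤ energy p q u v r := setIntegral_nonneg measurableSet_closedBall fun x _ =>
  add_nonneg (Real.rpow_nonneg (h.pu x).le _) (Real.rpow_nonneg (h.pv x).le _)

lemma Sol.energy_parts {κ : ℝ} {c d u v : EN N → ℝ} (h : Sol p q κ c d u v) (r : ℝ) :
    (∫ x in closedBall 0 r, u x ^ (q + 1)) ≤ energy p q u v r ∧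
      (∫ x in closedBall 0 r, v x ^ (p + 1)) ≤ energy p q u v r := by
  constructor
  · exact setIntegral_mono_on ((h.upow_cont _).integrableOn_closedBall r)
      (h.energy_cont.integrableOn_closedBall r) measurableSet_closedBall fun x _ =>
        le_add_of_nonneg_right (Real.rpow_nonneg (h.pv x).le _)
  · exact setIntegral_mono_on ((h.vpow_cont _).integrableOn_closedBall r)
      (h.energy_cont.integrableOn_closedBall r) measurableSet_closedBall fun x _ =>
        le_add_of_nonneg_left (Real.rpow_nonneg (h.pu x).le _)

/-- Exponents, written in the form used by the energy estimate. -/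
lemma exists_energy_exponents (hN : 3 ≤ N) (hp : 0 < p) (hq : 0 < q) (hpq : 1 < p * q)
    (hα : (N : ℝ) - 3 < 2 * (p + 1) / (p * q - 1)) :
    ∃ ω y τ : ℝ, 0 < ω ∧ ω < 1 ∧ p * ω < 1 / (q + 1) ∧ ω < 1 / (p + 1) ∧
      0 < y ∧ y < 1 ∧ 0 < τ ∧ τ < 1 ∧ 1 / (1 - ω) ≤ 1 / y ∧ (q + 1) / q ≤ 1 / (1 - y) ∧
      1 / (1 - ω) ≤ q + 1 ∧ (q + 1) / q ≤ 1 / ω ∧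
      (N : ℝ) - 1 ≤ τ * (N - (N - 1) * (1 / (1 / (1 - ω)) - 1 / (1 / y))) ∧
      (N : ℝ) - 1 ≤ τ * (N - (N - 1) * (1 / ((q + 1) / q) - 1 / (1 / (1 - y)))) ∧
      (N : ℝ) - 2 ≤ τ * (N - (N - 1) * (1 / (1 / (1 - ω)) - 1 / (q + 1))) ∧
      (N : ℝ) - 2 ≤ τ * (N - (N - 1) * (1 / ((q + 1) / q) - 1 / (1 / ω))) := by
  have hNR : (3 : ℝ) ≤ N := by exact_mod_cast hN
  set n : ℝ := (N : ℝ) - 1 with hn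
  have hn2 : 2 ≤ n := by linarith
  have hn0 : 0 < n := by linarith
  obtain ⟨ω, y, hω, hpω, hωp, hωq, H1, H2, H3, H4, H5⟩ :=
    exists_exponents hn2 hp hq hpq (by linarith)
  have hq1 : 0 < 1 / (q + 1) := by positivity
  have hqq : q / (q + 1) = 1 - 1 / (q + 1) := by field_simp; ring
  have hy0 : 0 < y := by linarith
  have hω1 : ω < 1 := by linarith
  rw [lt_div_iff₀ hn0] at H1 H2 H3
  obtain ⟨τ, t0, t1, T1, T2, T3, T4⟩ := exists_common_factor (h₁ := n) (h₂ := n - 1)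
    (X₁ := N - n * (1 - ω - y)) (X₂ := N - n * (q / (q + 1) - (1 - y)))
    (X₃ := N - n * (1 - ω - 1 / (q + 1))) (X₄ := N - n * (q / (q + 1) - ω))
    (by nlinarith) (by rw [hqq]; nlinarith)
    (by rw [show 1 - ω - 1 / (q + 1) = q / (q + 1) - ω by linarith]; nlinarith) (by nlinarith)
  refine ⟨ω, y, τ, hω, hω1, hpω, hωp, hy0, by linarith, t0, t1, ?_, ?_, ?_, ?_, ?_, ?_, ?_, ?_⟩
  · exact one_div_le_one_div_of_le hy0 H5.le
  · rw [show (q + 1) / q = 1 / (q / (q + 1)) by field_simp]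
    exact one_div_le_one_div_of_le (by linarith) (by linarith)
  · rw [div_le_iff₀ (by linarith)]
    have := mul_lt_mul_of_pos_left hωq (by linarith : 0 < q + 1)
    rw [mul_div_cancel₀ _ (by linarith : q + 1 ≠ 0)] at this
    linarith
  · rw [show (q + 1) / q = 1 / (q / (q + 1)) by field_simp]
    exact one_div_le_one_div_of_le hω hωq.le
  · rw [one_div_one_div, one_div_one_div]; exact T1
  · rw [one_div_div, one_div_one_div]; exact T2
  · rw [one_div_one_div, show (N : ℝ) - 2 = n - 1 by rw [hn]; ring]; exact T3
  · rw [one_div_div, one_div_one_div, show (N : ℝ) - 2 = n - 1 by rw [hn]; ring]; exact T4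

end EnergyStep

section EnergyStep

variable {N : ℕ} {p q : ℝ}

set_option maxHeartbeats 1000000 in
/-- Sublinear control of the energy on a ball by the energy on a larger ball. -/
lemma exists_energy_step (hN : 3 ≤ N) (hp : 0 < p) (hq : 0 < q) (hpq : 1 < p * q)
    (hsub : (N : ℝ) - 2 < N / (p + 1) + N / (q + 1))
    (hα : (N : ℝ) - 3 < 2 * (p + 1) / (p * q - 1)) :
    ∃ κ₀ > 0, ∃ C > 0, ∃ m b : ℝ, 0 ≤ m ∧ 0 ≤ b ∧ b < 1 ∧
      ∀ (κ : ℝ) (c d u v : EN N → ℝ), κ ≤ κ₀ → Sol p q κ c d u v → ∀ r ρ : ℝ, 1 / 2 ≤ r → r < ρ →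
        ρ ≤ 1 → energy p q u v r ≤ C * ((ρ - r)⁻¹) ^ m * (1 + energy p q u v ρ) ^ b := by
  have hN0 : (0 : ℝ) < N := by positivity
  obtain ⟨ω, y, τ, hω, hω1, hpω, hωp, hy0, hy1, hτ0, hτ1, S1, S2, S3, S4, T1, T2, T3, T4⟩ :=
    exists_energy_exponents hN hp hq hpq hα
  obtain ⟨δ, hδ⟩ : ∃ δ, δ = (N / (p + 1) + N / (q + 1) - ((N : ℝ) - 2)) / 2 := ⟨_, rfl⟩
  have hδ0 : 0 < δ := by rw [hδ]; linarith
  obtain ⟨a₁, ha₁⟩ : ∃ a₁, a₁ = N / (p + 1) - δ := ⟨_, rfl⟩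
  obtain ⟨a₂, ha₂⟩ : ∃ a₂, a₂ = N / (q + 1) - δ := ⟨_, rfl⟩
  have haa : a₁ + a₂ = N - 2 := by rw [ha₁, ha₂, hδ]; ring
  set s₁ := 1 / (1 - ω) with hs₁
  set s₂ := (q + 1) / q with hs₂
  have hs11 : 1 ≤ s₁ := by rw [hs₁, le_div_iff₀ (by linarith)]; linarith
  have hs21 : 1 ≤ s₂ := by rw [hs₂, le_div_iff₀ hq]; linarith
  have hs1ω : s₁ - 1 = ω * s₁ := by
    have : 1 - ω ≠ 0 := by linarith
    rw [hs₁]; field_simp; ring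
  have hωp' : ω * (p + 1) < 1 := by rwa [lt_div_iff₀ (by linarith)] at hωp
  have hps : p * (s₁ - 1) ≤ 1 := by
    rw [hs₁, div_sub_one (by linarith), mul_div_assoc', div_le_one (by linarith)]
    linarith
  set e₁ := p * ω with he₁
  set e := q / (q + 1) with he
  have hee : e = 1 - 1 / (q + 1) := by rw [he]; field_simp; ring
  have he0 : 0 < e := by positivity
  have he10 : 0 < e₁ := by positivity
  have heq : 1 / (q + 1) < 1 := by rw [div_lt_one (by linarith)]; linarith
  have hes : ∀ z : ℝ, z / s₂ = e * z := fun z => by rw [hs₂, he]; field_simp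
  set b₃ := e / (1 - e₁) with hb₃
  have hb3 : b₃ < 1 := by rw [hb₃, div_lt_one (by linarith)]; linarith
  have hb30 : 0 ≤ b₃ := div_nonneg he0.le (by linarith)
  have hb3e : e = b₃ * (1 - e₁) := by rw [hb₃, div_mul_cancel₀ _ (by linarith)]
  set b := max (max (e₁ + e) (e₁ * (q + 1))) b₃ with hb
  have hb1 : b < 1 := by
    rw [hb, max_lt_iff, max_lt_iff]
    refine ⟨⟨by linarith, ?_⟩, hb3⟩
    rwa [lt_div_iff₀ (by linarith)] at hpω
  have hb0 : 0 ≤ b := hb30.trans (le_max_right _ _)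
  obtain ⟨C₁, hC₁, H₁⟩ := apriori_half hN hp hq hpq
  obtain ⟨C₂, hC₂, H₂⟩ := apriori_half hN hq hp (by rwa [mul_comm])
  set C₀ := C₁ + C₂ with hC₀
  have hC₀0 : 0 < C₀ := by positivity
  obtain ⟨D, hD1, HD⟩ := exists_potential_domination hN hC₀0.le
  obtain ⟨S, hS, HS⟩ := exists_integral_slicePot_bound N hτ0 hτ1
  set M₁ := 1 + 2 ^ s₁ * (C₀ + 1) with hM₁
  set M₂ : ℝ := 1 + 2 ^ s₂ with hM₂
  have hM₁0 : 1 ≤ M₁ := by rw [hM₁]; exact le_add_of_nonneg_right (by positivity)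
  have hM₂0 : 1 ≤ M₂ := by rw [hM₂]; exact le_add_of_nonneg_right (by positivity)
  obtain ⟨M, hM⟩ : ∃ M, M = M₁ + M₂ + 6 * (S * M₁) + 6 * (S * M₂) + D := ⟨_, rfl⟩
  have hSM₁ : 0 < S * M₁ := by positivity
  have hSM₂ : 0 < S * M₂ := by positivity
  have hM1 : 1 ≤ M := by rw [hM]; linarith
  have hDM : D ≤ M := by rw [hM]; linarith
  obtain ⟨B₁, hB₁, m₁, hm₁, G₁⟩ := exists_moment_bound hN hτ0 hτ1 hs11 S1 T1 hM1
  obtain ⟨B₂, hB₂, m₂, hm₂, G₂⟩ := exists_moment_bound hN hτ0 hτ1 hs21 S2 T2 hM1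
  obtain ⟨B₃, hB₃, m₃, hm₃, G₃⟩ := exists_moment_bound hN hτ0 hτ1 hs11 S3 T3 hM1
  obtain ⟨B₄, hB₄, m₄, hm₄, G₄⟩ := exists_moment_bound hN hτ0 hτ1 hs21 S4 T4 hM1
  obtain ⟨B, hB⟩ : ∃ B, B = B₁ + B₂ + B₃ + B₄ + C₀ := ⟨_, rfl⟩
  have hB0 : 0 < B := by rw [hB]; positivity
  obtain ⟨m, hm⟩ : ∃ m, m = m₁ + m₂ + m₃ + m₄ := ⟨_, rfl⟩
  have hm0 : 0 ≤ m := by rw [hm]; positivity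
  set L := 2 * (3 + |a₁| + |a₂|) with hL
  have hL0 : 0 < L := by positivity
  refine ⟨δ / (4 * N), by positivity, 4 / δ * 12 * (L * (5 * B)) * 2 ^ (m + 3), by positivity,
    m + 3, b, by positivity, hb0, hb1, ?_⟩
  intro κ c d u v hκ h r ρ hr hrρ hρ
  have hκ' : N * κ ≤ δ / 4 := by
    have := mul_le_mul_of_nonneg_left hκ hN0.le
    refine this.trans_eq ?_
    field_simp
  obtain ⟨r', hr'⟩ : ∃ r', r' = (r + ρ) / 2 := ⟨_, rfl⟩
  have hr'1 : r < r' := by linarith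
  have hr'2 : r' < ρ := by linarith
  obtain ⟨⟨hvp, hua⟩, huq, hva⟩ := And.intro (H₁ κ c d u v h) (H₂ κ d c v u h.swap)
  have hvp1 : ∫ x in closedBall 0 1, v x ^ p ≤ C₀ := by rw [hC₀]; linarith
  have hvp0 : ∫ x in closedBall 0 ρ, v x ^ p ≤ C₀ :=
    (setIntegral_le_of_subset (closedBall_subset_closedBall hρ) measurableSet_closedBall
      ((h.vpow_cont p).integrableOn_closedBall 1)
      fun x _ => Real.rpow_nonneg (h.pv x).le _).trans hvp1
  obtain ⟨K, hK⟩ : ∃ K, K = 1 + energy p q u v ρ := ⟨_, rfl⟩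
  have hE0 := h.energy_nonneg ρ
  obtain ⟨hEu, hEv⟩ := h.energy_parts ρ
  have hK1 : 1 ≤ K := by linarith
  have hK0 : 0 < K := by linarith
  set K₁ := K ^ (p * (s₁ - 1)) with hK₁
  have hK₁1 : 1 ≤ K₁ := Real.one_le_rpow hK1 (mul_nonneg hp.le (by linarith))
  have hKz : ∀ z, K₁ ^ (z / s₁) = K ^ (e₁ * z) := fun z => by
    rw [hK₁, ← Real.rpow_mul hK0.le, hs1ω, he₁]
    congr 1
    field_simp
  obtain ⟨X, hX⟩ : ∃ X, X = (ρ - r')⁻¹ := ⟨_, rfl⟩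
  have hX1 : 1 ≤ X := by rw [hX, one_le_inv₀ (by linarith)]; linarith
  have hXr : X = 2 * (ρ - r)⁻¹ := by
    rw [hX, hr', show ρ - (r + ρ) / 2 = (ρ - r) / 2 by ring, inv_div, div_eq_mul_inv]
  obtain ⟨ε, ⟨hε, hε1, Du⟩, -, -, Dv⟩ :=
    ((HD u h.cu (fun x _ => (h.pu x).le) h.lapl_nonneg (by linarith) r' ρ (by linarith) hr'2 hρ).and
      (HD v h.cv (fun x _ => (h.pv x).le) h.swap.lapl_nonneg (by linarith) r' ρ (by linarith) hr'2
        hρ)).exists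
  rw [← hX] at Du Dv
  set f₁ : EN N → ℝ := fun x => -lapl u x with hf₁
  set f₂ : EN N → ℝ := fun x => -lapl v x with hf₂
  have cf₁ : Continuous f₁ := (lapl_continuous h.cu).neg
  have cf₂ : Continuous f₂ := (lapl_continuous h.cv).neg
  have nf₁ : ∀ x, ‖x‖ ≤ 1 → 0 ≤ f₁ x := fun x hx => h.lapl_nonneg x (by linarith)
  have nf₂ : ∀ x, ‖x‖ ≤ 1 → 0 ≤ f₂ x := fun x hx => h.swap.lapl_nonneg x (by linarith)
  have cg₁ : Continuous fun x => f₁ x ^ s₁ := cf₁.rpow_const fun _ => Or.inr (by linarith)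
  have cg₂ : Continuous fun x => f₂ x ^ s₂ := cf₂.rpow_const fun _ => Or.inr (by linarith)
  have ng₁ : ∀ x, ‖x‖ ≤ 1 → 0 ≤ f₁ x ^ s₁ := fun x hx => Real.rpow_nonneg (nf₁ x hx) _
  have ng₂ : ∀ x, ‖x‖ ≤ 1 → 0 ≤ f₂ x ^ s₂ := fun x hx => Real.rpow_nonneg (nf₂ x hx) _
  have I₁ : 1 + (∫ x in closedBall 0 ρ, f₁ x ^ s₁) ≤ M₁ * K₁ :=
    h.source_moment_interpolated hs11 hp hps hρ hK1 hvp0 (by linarith)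
  have I₂ : 1 + (∫ x in closedBall 0 ρ, f₂ x ^ s₂) ≤ M₂ * K :=
    h.source_moment hq hρ hK1 (by linarith)
  have hSP₁ : ∫ t in Icc (0 : ℝ) 1, slicePot ρ ε τ (fun x => f₁ x ^ s₁) t ≤ S * M₁ * K₁ := by
    have := mul_le_mul_of_nonneg_left I₁ hS.le
    linarith [HS ρ hρ ε hε _ cg₁ ng₁]
  have hSP₂ : ∫ t in Icc (0 : ℝ) 1, slicePot ρ ε τ (fun x => f₂ x ^ s₂) t ≤ S * M₂ * K := by
    have := mul_le_mul_of_nonneg_left I₂ hS.le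
    linarith [HS ρ hρ ε hε _ cg₂ ng₂]
  have ht12 : X⁻¹ ≤ r' ^ 2 - r ^ 2 := by
    rw [hX, inv_inv, sq_sub_sq, show ρ - r' = r' - r by linarith]
    exact le_mul_of_one_le_left (by linarith) (by linarith)
  have hr'sq : r' ^ 2 ≤ 1 := pow_le_one₀ (by linarith) (by linarith)
  have hX0 : 0 < X⁻¹ := by positivity
  obtain ⟨g, cg, g0, g1, gs, gi⟩ := exists_slice_weight (slicePot_continuous hε ρ τ cg₁)
    (slicePot_continuous hε ρ τ cg₂) (slicePot_nonneg hε hρ ng₁) (slicePot_nonneg hε hρ ng₂)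
    (by positivity : 0 < S * M₁ * K₁) (by positivity : 0 < S * M₂ * K) hSP₁ hSP₂
    (t₁ := r ^ 2) (t₂ := r' ^ 2) (by positivity) (by linarith) hr'sq
  have hdiv : ∀ {A : ℝ}, 0 ≤ A → A / (r' ^ 2 - r ^ 2) ≤ A * X := fun {A} hA => by
    have := div_le_div_of_nonneg_left hA hX0 ht12
    rwa [div_inv_eq_mul] at this
  set w : EN N → ℝ := fun x => g (‖x‖ ^ 2) with hw
  have cw : Continuous w := cg.comp (continuous_norm.pow 2)
  have ws : ∀ x, w x ≠ 0 → ‖x‖ ≤ r' ∧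
      slicePot ρ ε τ (fun x => f₁ x ^ s₁) (‖x‖ ^ 2) ≤ M * X * K₁ ∧
      slicePot ρ ε τ (fun x => f₂ x ^ s₂) (‖x‖ ^ 2) ≤ M * X * K := fun x hx => by
    obtain ⟨h1, h2, h3, h4⟩ := gs _ hx
    refine ⟨?_, h3.trans ((hdiv (by positivity)).trans ?_),
        h4.trans ((hdiv (by positivity)).trans ?_)⟩
    · exact (pow_lt_pow_iff_left₀ (norm_nonneg x) (by linarith) two_ne_zero).1 h2 |>.le
    · rw [show 6 * (S * M₁ * K₁) * X = 6 * (S * M₁) * X * K₁ by ring]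
      gcongr; rw [hM]; linarith
    · rw [show 6 * (S * M₂ * K) * X = 6 * (S * M₂) * X * K by ring]
      gcongr; rw [hM]; linarith
  have hMK₁ : M₁ * K₁ ≤ M * K₁ := by gcongr; rw [hM]; linarith
  have hMK₂ : M₂ * K ≤ M * K := by gcongr; rw [hM]; linarith
  have ju0 : ∀ x, 0 ≤ jet u x := fun x =>
    add_nonneg (h.pu x).le (Finset.sum_nonneg fun i _ => abs_nonneg _)
  have jv0 : ∀ x, 0 ≤ jet v x := fun x =>
    add_nonneg (h.pv x).le (Finset.sum_nonneg fun i _ => abs_nonneg _)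
  have n1 : ∀ (k : ℝ) x, 0 ≤ ∫ y in closedBall 0 ρ, rker k ε x y * f₁ y := fun k x =>
    setIntegral_nonneg measurableSet_closedBall fun y hy =>
      mul_nonneg (rker_pos hε x y).le (nf₁ y (by rw [mem_closedBall_zero_iff] at hy; linarith))
  have n2 : ∀ (k : ℝ) x, 0 ≤ ∫ y in closedBall 0 ρ, rker k ε x y * f₂ y := fun k x =>
    setIntegral_nonneg measurableSet_closedBall fun y hy =>
      mul_nonneg (rker_pos hε x y).le (nf₂ y (by rw [mem_closedBall_zero_iff] at hy; linarith))
  have hDM' : D * X ^ ((N : ℝ) + 2) ≤ M * X ^ ((N : ℝ) + 2) := by gcongr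
  have W₁ := G₁ X K₁ ρ ε hX1 hK₁1 hρ hε hε1 f₁ cf₁ nf₁ (I₁.trans hMK₁) w cw
    (fun x => g0 _) (fun x => g1 _) (fun x hx => ⟨by linarith [(ws x hx).1], (ws x hx).2.1⟩)
    (jet u) (jet_continuous h.cu) ju0 (fun x hx => ((Du x (ws x hx).1).2).trans
      (mul_le_mul_of_nonneg_right hDM' (by linarith [n1 (((N : ℝ) - 1) / 2) x])))
  have W₂ := G₂ X K ρ ε hX1 hK1 hρ hε hε1 f₂ cf₂ nf₂ (I₂.trans hMK₂) w cw
    (fun x => g0 _) (fun x => g1 _) (fun x hx => ⟨by linarith [(ws x hx).1], (ws x hx).2.2⟩)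
    (jet v) (jet_continuous h.cv) jv0 (fun x hx => ((Dv x (ws x hx).1).2).trans
      (mul_le_mul_of_nonneg_right hDM' (by linarith [n2 (((N : ℝ) - 1) / 2) x])))
  have W₃ := G₃ X K₁ ρ ε hX1 hK₁1 hρ hε hε1 f₁ cf₁ nf₁ (I₁.trans hMK₁) w cw
    (fun x => g0 _) (fun x => g1 _) (fun x hx => ⟨by linarith [(ws x hx).1], (ws x hx).2.1⟩)
    u h.cu.continuous (fun x => (h.pu x).le) (fun x hx => ((Du x (ws x hx).1).1).trans
      (mul_le_mul_of_nonneg_right hDM' (by linarith [n1 (((N : ℝ) - 2) / 2) x])))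
  have W₄ := G₄ X K ρ ε hX1 hK1 hρ hε hε1 f₂ cf₂ nf₂ (I₂.trans hMK₂) w cw
    (fun x => g0 _) (fun x => g1 _) (fun x hx => ⟨by linarith [(ws x hx).1], (ws x hx).2.2⟩)
    v h.cv.continuous (fun x => (h.pv x).le) (fun x hx => ((Dv x (ws x hx).1).1).trans
      (mul_le_mul_of_nonneg_right hDM' (by linarith [n2 (((N : ℝ) - 2) / 2) x])))
  rw [hKz] at W₁ W₃
  rw [hes] at W₂ W₄
  have hBm : ∀ {Bi mi Z I : ℝ}, I ≤ Bi * X ^ mi * Z → 0 ≤ Z → Bi ≤ B → mi ≤ m →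
      I ≤ B * X ^ m * Z := fun {Bi mi Z I} hI hZ hBi hmi => by
    refine hI.trans (mul_le_mul_of_nonneg_right ?_ hZ)
    exact mul_le_mul hBi (Real.rpow_le_rpow_of_exponent_le hX1 hmi) (by positivity) hB0.le
  have hz : (1 / y).HolderConjugate (1 / (1 - y)) := by
    rw [Real.holderConjugate_iff]
    refine ⟨by rw [lt_div_iff₀ hy0]; linarith, ?_⟩
    rw [one_div, one_div, inv_inv, inv_inv]; ring
  have hfin := weighted_energy_bound (e := e) (e₁ := e₁) (b := b) (b₃ := b₃) (K := K)
    (Y := X ^ m) (C := B) cw (jet_continuous h.cu) (jet_continuous h.cv)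
    h.cu.continuous h.cv.continuous (fun x => g0 _) (fun x => g1 _) ju0 jv0 h.pv hp hq hz
    (z₃ := 1 / ω) (by rw [le_div_iff₀ hω]; linarith) hK1 (Real.one_le_rpow hX1 hm0) hB0.le
    ((le_max_left _ _).trans (le_max_left _ _)) ((le_max_right _ _).trans (le_max_left _ _))
    (le_max_right _ _)
    (by
      refine le_trans (le_of_eq ?_) (le_max_right (max (e₁ + e) (e₁ * (q + 1))) b₃)
      rw [hb3e, he₁]; field_simp; ring)
    (hBm W₁ (by positivity) (by linarith) (by linarith))
    (hBm W₂ (by positivity) (by linarith) (by linarith))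
    (hBm W₃ (by positivity) (by linarith) (by linarith))
    (hBm W₄ (by positivity) (by linarith) (by linarith)) (hvp1.trans (by linarith))
  have hpoh := h.pohozaev_inequality hp hq haa hδ0 (by linarith) (by linarith) hκ' cg g0
    (fun t ht => ⟨(gs t ht).1, (gs t ht).2.1.trans_le hr'sq⟩)
  have hX3 : X⁻¹ ^ 3 / 12 ≤ ∫ t in Icc (0 : ℝ) 1, g t := by
    refine le_trans ?_ gi
    gcongr
  have hEr := h.energy_nonneg r
  have key : δ / 4 * (X⁻¹ ^ 3 / 12 * energy p q u v r) ≤ L * (5 * B * X ^ m * K ^ b) := by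
    refine le_trans ?_ (hpoh.trans (mul_le_mul_of_nonneg_left hfin hL0.le))
    exact mul_le_mul_of_nonneg_left (mul_le_mul_of_nonneg_right hX3 hEr) (by positivity)
  rw [← hK]
  have hX3' : X ^ (m + 3) = X ^ m * X ^ 3 := by
    rw [Real.rpow_add (by positivity)]; norm_cast
  have hXm : X ^ (m + 3) = 2 ^ (m + 3) * ((ρ - r)⁻¹) ^ (m + 3) := by
    rw [hXr, Real.mul_rpow (by norm_num) (by rw [inv_nonneg]; linarith)]
  calc energy p q u v r
      = 4 / δ * 12 * X ^ 3 * (δ / 4 * (X⁻¹ ^ 3 / 12 * energy p q u v r)) := by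
        field_simp
    _ ≤ 4 / δ * 12 * X ^ 3 * (L * (5 * B * X ^ m * K ^ b)) := by gcongr
    _ = 4 / δ * 12 * (L * (5 * B)) * X ^ (m + 3) * K ^ b := by rw [hX3']; ring
    _ = _ := by rw [hXm]; ring

end EnergyStep

section EnergyBound

/-- Absorption of a sublinear term with a singular weight. -/
lemma exists_absorption_bound {C m b : ℝ} (hC : 0 < C) (hm : 0 ≤ m) (hb0 : 0 ≤ b) (hb1 : b < 1) :
    ∃ B > 0, ∀ (E : ℝ → ℝ) (A : ℝ), (∀ r, 0 ≤ E r) → (∀ r, r < 1 → E r ≤ A) →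
      (∀ r ρ : ℝ, 1 / 2 ≤ r → r < ρ → ρ ≤ 1 → E r ≤ C * ((ρ - r)⁻¹) ^ m * (1 + E ρ) ^ b) →
      E (1 / 2) ≤ B := by
  have hb : 0 < 1 - b := by linarith
  set μ := m / (1 - b) with hμ
  have hμ0 : 0 ≤ μ := div_nonneg hm hb.le
  have hμb : μ = m + μ * b := by
    have : m = μ * (1 - b) := by rw [hμ, div_mul_cancel₀ _ hb.ne']
    linarith
  set D := C * 2 ^ m * (2 ^ μ) ^ b with hD
  have hD0 : 0 < D := by positivity
  refine ⟨2 ^ μ * (1 + D) ^ (1 / (1 - b)), by positivity, fun E A hE hA hstep => ?_⟩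
  set G : Set ℝ := (fun r => (1 - r) ^ μ * E r) '' Ico (1 / 2) 1 with hG
  have hGb : BddAbove G := by
    refine ⟨A, ?_⟩
    rintro _ ⟨r, hr, rfl⟩
    have h1 : (1 - r) ^ μ ≤ 1 := Real.rpow_le_one (by linarith [hr.2]) (by linarith [hr.1]) hμ0
    exact (mul_le_of_le_one_left (hE r) h1).trans (hA r hr.2)
  have hG0 : G.Nonempty := ⟨_, 1 / 2, ⟨le_rfl, by norm_num⟩, rfl⟩
  set S := sSup G with hS
  have hSle : ∀ r, 1 / 2 ≤ r → r < 1 → (1 - r) ^ μ * E r ≤ S := fun r h1 h2 =>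
    le_csSup hGb ⟨r, ⟨h1, h2⟩, rfl⟩
  have hS0 : 0 ≤ S := le_trans (mul_nonneg (by positivity) (hE _))
    (hSle (1 / 2) le_rfl (by norm_num))
  have hmain : S ≤ D * (1 + S) ^ b := by
    refine csSup_le hG0 ?_
    rintro _ ⟨r, hr, rfl⟩
    have hr1 : 0 < 1 - r := by linarith [hr.2]
    have hρ : 1 - (1 + r) / 2 = (1 - r) / 2 := by ring
    have hs := hSle ((1 + r) / 2) (by linarith [hr.1]) (by linarith)
    have hst := hstep r ((1 + r) / 2) hr.1 (by linarith) (by linarith)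
    rw [show (1 + r) / 2 - r = (1 - r) / 2 by ring, inv_div,
      Real.div_rpow (by norm_num) hr1.le] at hst
    rw [hρ, Real.div_rpow hr1.le (by norm_num)] at hs
    have hE' := hE ((1 + r) / 2)
    have h3 : (1 - r) ^ μ * (1 + E ((1 + r) / 2)) ≤ 2 ^ μ * (1 + S) := by
      rw [div_mul_eq_mul_div, div_le_iff₀ (by positivity)] at hs
      have h4 : (1 - r) ^ μ ≤ 1 := Real.rpow_le_one hr1.le (by linarith [hr.1]) hμ0
      have h5 : (1 : ℝ) ≤ 2 ^ μ := Real.one_le_rpow (by norm_num) hμ0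
      linarith
    have h6 : (1 - r) ^ μ = (1 - r) ^ m * ((1 - r) ^ μ) ^ b := by
      rw [← Real.rpow_mul hr1.le, ← Real.rpow_add hr1, ← hμb]
    calc (1 - r) ^ μ * E r ≤ (1 - r) ^ μ * (C * (2 ^ m / (1 - r) ^ m) *
          (1 + E ((1 + r) / 2)) ^ b) := by gcongr
      _ = C * 2 ^ m * (((1 - r) ^ μ) ^ b * (1 + E ((1 + r) / 2)) ^ b) := by
          nth_rewrite 1 [h6]; field_simp
      _ = C * 2 ^ m * ((1 - r) ^ μ * (1 + E ((1 + r) / 2))) ^ b := by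
          rw [Real.mul_rpow (by positivity) (by positivity)]
      _ ≤ C * 2 ^ m * (2 ^ μ * (1 + S)) ^ b := by gcongr
      _ = D * (1 + S) ^ b := by
          rw [Real.mul_rpow (by positivity) (by positivity), hD]; ring
  have h1S : 1 ≤ (1 + S) ^ b := Real.one_le_rpow (by linarith) hb0
  have h2S : (1 + S) ^ (1 - b) ≤ 1 + D := by
    rw [Real.rpow_sub (by linarith), Real.rpow_one, div_le_iff₀ (by positivity)]
    linarith
  have h3S : 1 + S ≤ (1 + D) ^ (1 / (1 - b)) := by
    have := Real.rpow_le_rpow (by positivity) h2S (by positivity : 0 ≤ 1 / (1 - b))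
    rwa [← Real.rpow_mul (by linarith), mul_one_div_cancel hb.ne', Real.rpow_one] at this
  have hh := hSle (1 / 2) le_rfl (by norm_num)
  have h7 : E (1 / 2) = 2 ^ μ * ((1 - 1 / 2) ^ μ * E (1 / 2)) := by
    rw [← mul_assoc, ← Real.mul_rpow (by norm_num) (by norm_num)]
    norm_num
  rw [h7]
  exact mul_le_mul_of_nonneg_left (by linarith) (by positivity)

variable {N : ℕ} {p q : ℝ}

/-- Universal interior energy bound. -/
lemma exists_energy_bound (hN : 3 ≤ N) (hp : 0 < p) (hq : 0 < q) (hpq : 1 < p * q)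
    (hsub : (N : ℝ) - 2 < N / (p + 1) + N / (q + 1))
    (hα : (N : ℝ) - 3 < 2 * (p + 1) / (p * q - 1)) :
    ∃ κ₀ > 0, ∃ B > 0, ∀ (κ : ℝ) (c d u v : EN N → ℝ), κ ≤ κ₀ → Sol p q κ c d u v →
      energy p q u v (1 / 2) ≤ B := by
  obtain ⟨κ₀, hκ₀, C, hC, m, b, hm, hb0, hb1, H⟩ := exists_energy_step hN hp hq hpq hsub hα
  obtain ⟨B, hB, HB⟩ := exists_absorption_bound hC hm hb0 hb1
  refine ⟨κ₀, hκ₀, B, hB, fun κ c d u v hκ h => ?_⟩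
  refine HB (energy p q u v) (energy p q u v 1) h.energy_nonneg (fun r hr => ?_)
    (H κ c d u v hκ h)
  exact setIntegral_le_of_subset (closedBall_subset_closedBall hr.le) measurableSet_closedBall
    (h.energy_cont.integrableOn_closedBall 1) fun x _ =>
      add_nonneg (Real.rpow_nonneg (h.pu x).le _) (Real.rpow_nonneg (h.pv x).le _)

end EnergyBound

section Rescaling

variable {N : ℕ} {p q κ : ℝ} {c d u v : EN N → ℝ}

/-- Invariance of the system under rescaling. -/
lemma Sol.rescale (h : Sol p q κ c d u v) {α β : ℝ} (hα : β * p = α + 2) (hβ : α * q = β + 2)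
    {z : EN N} {s : ℝ} (hs0 : 0 < s) (hs1 : s ≤ 1) (hzs : ‖z‖ + 2 * s ≤ 2) :
    Sol p q κ (fun y => c (z + s • y)) (fun y => d (z + s • y))
      (fun y => s ^ α * u (z + s • y)) (fun y => s ^ β * v (z + s • y)) := by
  have hin : ∀ y : EN N, ‖y‖ < 2 → ‖z + s • y‖ < 2 := fun y hy => by
    refine (norm_add_le _ _).trans_lt ?_
    rw [norm_smul, Real.norm_of_nonneg hs0.le]
    nlinarith
  have haff : ∀ {n : WithTop ℕ∞}, ContDiff ℝ n fun y : EN N => z + s • y := fun {n} =>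
    contDiff_const.add (contDiff_id.const_smul s)
  have hgrad : ∀ {f : EN N → ℝ}, ContDiff ℝ 1 f → (∀ y, ‖y‖ < 2 → ∀ i, |pd i f y| ≤ κ) →
      ∀ y, ‖y‖ < 2 → ∀ i, |pd i (fun y => f (z + s • y)) y| ≤ κ := fun {f} hf hb y hy i => by
    rw [pd_comp_affine (hf.differentiable one_ne_zero), abs_mul, abs_of_pos hs0]
    exact (mul_le_of_le_one_left (abs_nonneg _) hs1).trans (hb _ (hin y hy) i)
  refine ⟨contDiff_const.mul (h.cu.comp haff), contDiff_const.mul (h.cv.comp haff),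
    fun y => mul_pos (by positivity) (h.pu _), fun y => mul_pos (by positivity) (h.pv _),
    h.cc.comp haff, h.cd.comp haff, fun y hy => h.bc _ (hin y hy), fun y hy => h.bd _ (hin y hy),
    hgrad h.cc h.gc, hgrad h.cd h.gd, fun y hy => ?_, fun y hy => ?_⟩
  · have := h.eu _ (hin y hy)
    rw [lapl_comp_affine h.cu, Real.mul_rpow (by positivity) (h.pv _).le, ← Real.rpow_mul hs0.le,
      hα, Real.rpow_add hs0, Real.rpow_two, ← mul_neg, this]
    ring
  · have := h.ev _ (hin y hy)
    rw [lapl_comp_affine h.cv, Real.mul_rpow (by positivity) (h.pu _).le, ← Real.rpow_mul hs0.le,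
      hβ, Real.rpow_add hs0, Real.rpow_two, ← mul_neg, this]
    ring

/-- Scaling of the energy. -/
lemma Sol.energy_rescale (h : Sol p q κ c d u v) {α β γ : ℝ} (hα : α * (q + 1) = γ)
    (hβ : β * (p + 1) = γ) {t : ℝ} (ht : 0 < t) (r : ℝ) :
    energy p q (fun y => t ^ α * u (0 + t • y)) (fun y => t ^ β * v (0 + t • y)) r
      = t ^ (γ - N) * energy p q u v (t * r) := by
  have h1 : ∀ y : EN N, (t ^ α * u (0 + t • y)) ^ (q + 1) + (t ^ β * v (0 + t • y)) ^ (p + 1)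
      = t ^ γ * (u (t • y) ^ (q + 1) + v (t • y) ^ (p + 1)) := fun y => by
    rw [zero_add, Real.mul_rpow (by positivity) (h.pu _).le,
      Real.mul_rpow (by positivity) (h.pv _).le, ← Real.rpow_mul ht.le, ← Real.rpow_mul ht.le,
      hα, hβ]
    ring
  unfold energy
  simp only [h1]
  rw [integral_const_mul, Measure.setIntegral_comp_smul_of_pos volume
    (fun x => u x ^ (q + 1) + v x ^ (p + 1)) _ ht, smul_closedBall' ht.ne', smul_zero,
    finrank_euclideanSpace_fin, Real.norm_of_nonneg ht.le, smul_eq_mul, Real.rpow_sub ht,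
    Real.rpow_natCast]
  ring

/-- Interior gradient bound for bounded solutions. -/
lemma exists_gradient_bound_of_bounded (hN : 3 ≤ N) (hp : 0 < p) (hq : 0 < q) (hpq : 1 < p * q)
    {A : ℝ} (hA : 0 < A) : ∃ G > 0, ∀ (κ : ℝ) (c d u v : EN N → ℝ), Sol p q κ c d u v →
      (∀ x, ‖x‖ ≤ 1 → v x ≤ A) → ∀ x, ‖x‖ ≤ 1 / 2 → ∀ i, |pd i u x| ≤ G := by
  obtain ⟨C, hC, H⟩ := representation hN
  obtain ⟨C₀, hC₀, H₀⟩ := apriori_half hN hp hq hpq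
  have hNR : (3 : ℝ) ≤ N := by exact_mod_cast hN
  obtain ⟨R, hR, HR⟩ := exists_rker_integral_bound hN (τ := (N - 1) / N)
    (div_pos (by linarith) (by linarith)) (by rw [div_lt_one (by linarith)]; linarith)
  refine ⟨1 + C * (2 * A ^ p * R) + C * (1 - 1 / 2) ^ (-(N + 2) : ℝ) * C₀, by positivity,
    fun κ c d u v h hv x hx i => ?_⟩
  obtain ⟨ε, hε, hε'⟩ := (H u h.cu (fun y _ => (h.pu y).le) h.lapl_nonneg (1 / 2) 1 le_rfl
    (by norm_num) le_rfl).exists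
  refine ((hε' x hx).2 i).trans ?_
  have h1 : ∫ y in closedBall 0 1, rker (((N : ℝ) - 1) / 2) ε x y * (-lapl u y)
      ≤ ∫ y in closedBall 0 1, rker (((N : ℝ) - 1) / 2) ε x y * (2 * A ^ p) := by
    refine setIntegral_mono_on
      (((rker_continuous _ hε x).mul (lapl_continuous h.cu).neg).integrableOn_closedBall 1)
      (((rker_continuous _ hε x).mul continuous_const).integrableOn_closedBall 1)
      measurableSet_closedBall fun y hy => ?_
    rw [mem_closedBall_zero_iff] at hy
    refine mul_le_mul_of_nonneg_left ((h.lapl_upper y (by linarith)).trans ?_) (rker_pos hε x y).le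
    have := Real.rpow_le_rpow (h.pv y).le (hv y hy) hp.le
    linarith
  rw [integral_mul_const] at h1
  have h2 := HR 1 le_rfl ε hε x (by linarith)
  rw [mul_div_cancel₀ _ (by linarith : (N : ℝ) ≠ 0)] at h2
  have h3 := (H₀ κ c d u v h).2
  have h4 : (∫ y in closedBall 0 1, rker (((N : ℝ) - 1) / 2) ε x y) * (2 * A ^ p)
      ≤ R * (2 * A ^ p) := by gcongr
  gcongr
  linarith

end Rescaling

section SupBound

variable {N : ℕ} {p q : ℝ}

lemma norm_fderiv_le_sum (f : EN N → ℝ) (x : EN N) : ‖fderiv ℝ f x‖ ≤ ∑ i, |pd i f x| := by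
  refine ContinuousLinearMap.opNorm_le_bound _ (Finset.sum_nonneg fun i _ => abs_nonneg _)
    fun y => ?_
  have hy : y = ∑ i, y i • EuclideanSpace.single i (1 : ℝ) := by
    have := (EuclideanSpace.basisFun (Fin N) ℝ).sum_repr y
    simpa using this.symm
  have h1 : fderiv ℝ f x y = ∑ i, y i * pd i f x := by
    conv_lhs => rw [hy, map_sum]
    refine Finset.sum_congr rfl fun i _ => ?_
    rw [map_smul, smul_eq_mul, pd]
  rw [h1, Finset.sum_mul]
  refine (Finset.abs_sum_le_sum_abs _ _).trans (Finset.sum_le_sum fun i _ => ?_)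
  rw [abs_mul, mul_comm]
  exact mul_le_mul_of_nonneg_left (abs_coord_le_norm y i) (abs_nonneg _)

/-- Bounded solutions which are not small at the origin carry some energy. -/
lemma exists_energy_lower_bound (hN : 3 ≤ N) (hp : 0 < p) (hq : 0 < q) (hpq : 1 < p * q)
    {A a : ℝ} (hA : 0 < A) (ha : 0 < a) : ∃ e > 0, ∀ (κ : ℝ) (c d u v : EN N → ℝ),
      Sol p q κ c d u v → (∀ x, ‖x‖ ≤ 1 → v x ≤ A) → a ≤ u 0 → e ≤ energy p q u v (1 / 2) := by
  obtain ⟨G, hG, H⟩ := exists_gradient_bound_of_bounded hN hp hq hpq hA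
  have hN0 : (0 : ℝ) < N := by positivity
  set η := min (1 / 2) (a / (2 * (N * G))) with hη
  have hη0 : 0 < η := by rw [hη]; positivity
  have hvol : 0 < volume.real (closedBall (0 : EN N) η) :=
    ENNReal.toReal_pos (measure_closedBall_pos volume _ hη0).ne'
      measure_closedBall_lt_top.ne
  refine ⟨volume.real (closedBall (0 : EN N) η) * (a / 2) ^ (q + 1), by positivity,
    fun κ c d u v h hv hu => ?_⟩
  have hlow : ∀ x ∈ closedBall (0 : EN N) η, a / 2 ≤ u x := fun x hx => by
    have hfd : ∀ y ∈ closedBall (0 : EN N) η, ‖fderiv ℝ u y‖ ≤ N * G := fun y hy => by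
      rw [mem_closedBall_zero_iff] at hy
      have h2 : ∑ i, |pd i u y| ≤ N * G := by
        refine (Finset.sum_le_card_nsmul _ _ _ fun i _ =>
          H κ c d u v h hv y (hy.trans (min_le_left _ _)) i).trans_eq ?_
        simp
      exact (norm_fderiv_le_sum u y).trans h2
    have := (convex_closedBall (0 : EN N) η).norm_image_sub_le_of_norm_fderiv_le
      (fun y _ => h.cu.differentiable two_ne_zero y) hfd (mem_closedBall_self hη0.le) hx
    rw [mem_closedBall_zero_iff] at hx
    rw [sub_zero, Real.norm_eq_abs] at this
    have h3 : N * G * ‖x‖ ≤ a / 2 := by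
      have h4 := hx.trans (min_le_right _ _)
      rw [le_div_iff₀ (by positivity)] at h4
      linarith
    linarith [(abs_le.1 this).1]
  have h1 : ∫ x in closedBall (0 : EN N) η, (a / 2) ^ (q + 1)
      ≤ ∫ x in closedBall (0 : EN N) η, u x ^ (q + 1) :=
    setIntegral_mono_on (continuous_const.integrableOn_closedBall η)
      ((h.upow_cont _).integrableOn_closedBall η) measurableSet_closedBall fun x hx =>
        Real.rpow_le_rpow (by positivity) (hlow x hx) (by linarith)
  rw [setIntegral_const, smul_eq_mul] at h1
  refine h1.trans (le_trans ?_ (h.energy_parts (1 / 2)).1)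
  exact setIntegral_le_of_subset (closedBall_subset_closedBall (min_le_left _ _))
    measurableSet_closedBall ((h.upow_cont _).integrableOn_closedBall _)
    fun x _ => Real.rpow_nonneg (h.pu x).le _

lemma scaling_exponent (h : p * q - 1 ≠ 0) :
    2 * (q + 1) / (p * q - 1) * p = 2 * (p + 1) / (p * q - 1) + 2 := by
  rw [div_mul_eq_mul_div, div_add' _ _ _ h]
  congr 1
  ring

lemma energy_swap (p q : ℝ) (u v : EN N → ℝ) (r : ℝ) : energy q p v u r = energy p q u v r := by
  unfold energy
  simp only [add_comm]

/-- Universal interior bound, by a doubling argument. -/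
lemma exists_sup_bound (hN : 3 ≤ N) (hp : 0 < p) (hq : 0 < q) (hpq : 1 < p * q)
    (hsub : (N : ℝ) - 2 < N / (p + 1) + N / (q + 1))
    (hα : (N : ℝ) - 3 < 2 * (p + 1) / (p * q - 1)) :
    ∃ κ₀ > 0, ∃ B > 0, ∀ (κ : ℝ) (c d u v : EN N → ℝ), κ ≤ κ₀ → Sol p q κ c d u v →
      ∀ x, ‖x‖ ≤ 1 / 2 → u x ≤ B ∧ v x ≤ B := by
  obtain ⟨κ₀, hκ₀, B, hB, HB⟩ := exists_energy_bound hN hp hq hpq hsub hα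
  have hpq1 : 0 < p * q - 1 := by linarith
  set α := 2 * (p + 1) / (p * q - 1) with hαd
  set β := 2 * (q + 1) / (p * q - 1) with hβd
  have hα0 : 0 < α := by positivity
  have hβ0 : 0 < β := by positivity
  have hβp : β * p = α + 2 := scaling_exponent hpq1.ne'
  have hαq : α * q = β + 2 := by rw [hαd, hβd]; field_simp; ring
  have hγ : β * (p + 1) = α * (q + 1) := by rw [hαd, hβd]; field_simp
  have hσ : 0 < α * (q + 1) - N := by
    have h1 : (N : ℝ) - 2 < N * (1 / (p + 1) + 1 / (q + 1)) := by
      rw [mul_add, mul_one_div, mul_one_div]; exact hsub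
    have h2 : (1 / (p + 1) + 1 / (q + 1)) * (α * (q + 1)) = α + β := by
      rw [hαd, hβd]; field_simp; ring
    have h3 : α * (q + 1) = α + β + 2 := by linarith
    have h4 : (1 / (p + 1) + 1 / (q + 1)) < 1 := by
      rw [div_add_div _ _ (by positivity) (by positivity), div_lt_one (by positivity)]
      nlinarith
    by_contra hcon
    have h5 : (α * (q + 1)) * (1 - (1 / (p + 1) + 1 / (q + 1)))
        ≤ N * (1 - (1 / (p + 1) + 1 / (q + 1))) :=
      mul_le_mul_of_nonneg_right (by linarith) (by linarith)
    linarith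
  set σ := α * (q + 1) - N with hσd
  obtain ⟨A, hA⟩ : ∃ A : ℝ, A = 2 ^ α + 2 ^ β := ⟨_, rfl⟩
  have hA0 : 0 < A := by rw [hA]; positivity
  obtain ⟨e₁, he₁, L₁⟩ := exists_energy_lower_bound (N := N) hN hp hq hpq hA0
    (by positivity : (0 : ℝ) < (1 / 2) ^ α)
  obtain ⟨e₂, he₂, L₂⟩ := exists_energy_lower_bound (N := N) hN hq hp (by rwa [mul_comm]) hA0
    (by positivity : (0 : ℝ) < (1 / 2) ^ β)
  obtain ⟨e, he⟩ : ∃ e, e = min e₁ e₂ := ⟨_, rfl⟩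
  have he0 : 0 < e := by rw [he]; exact lt_min he₁ he₂
  obtain ⟨k₀, hk₀⟩ : ∃ k₀, k₀ = 2 + 2 * (B / e) ^ (1 / σ) := ⟨_, rfl⟩
  have hk₀0 : 2 ≤ k₀ := by rw [hk₀]; exact le_add_of_nonneg_right (by positivity)
  refine ⟨κ₀, hκ₀, (2 * k₀) ^ α + (2 * k₀) ^ β, by positivity, fun κ c d u v hκ h => ?_⟩
  set M : EN N → ℝ := fun x => u x ^ (1 / α) + v x ^ (1 / β) with hM
  have hMc : Continuous M := (h.upow_cont _).add (h.vpow_cont _)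
  have hu1 : ∀ x, 0 < u x ^ (1 / α) := fun x => Real.rpow_pos_of_pos (h.pu x) _
  have hv1 : ∀ x, 0 < v x ^ (1 / β) := fun x => Real.rpow_pos_of_pos (h.pv x) _
  have hM0 : ∀ x, 0 < M x := fun x => add_pos (hu1 x) (hv1 x)
  have hu2 : ∀ x, (u x ^ (1 / α)) ^ α = u x := fun x => by
    rw [← Real.rpow_mul (h.pu x).le, one_div_mul_cancel hα0.ne', Real.rpow_one]
  have hv2 : ∀ x, (v x ^ (1 / β)) ^ β = v x := fun x => by
    rw [← Real.rpow_mul (h.pv x).le, one_div_mul_cancel hβ0.ne', Real.rpow_one]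
  have huM : ∀ x T, M x ≤ T → u x ≤ T ^ α := fun x T hT => by
    rw [← hu2 x]
    exact Real.rpow_le_rpow (hu1 x).le (by linarith [hv1 x, show M x = _ from rfl]) hα0.le
  have hvM : ∀ x T, M x ≤ T → v x ≤ T ^ β := fun x T hT => by
    rw [← hv2 x]
    exact Real.rpow_le_rpow (hv1 x).le (by linarith [hu1 x, show M x = _ from rfl]) hβ0.le
  obtain ⟨z, hz, hmax⟩ := (isCompact_closedBall (0 : EN N) 1).exists_isMaxOn ⟨0, by simp⟩
    ((continuous_const.sub continuous_norm).mul hMc :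
        Continuous fun x => (1 - ‖x‖) * M x).continuousOn
  have hmax' : ∀ x : EN N, ‖x‖ ≤ 1 → (1 - ‖x‖) * M x ≤ (1 - ‖z‖) * M z := fun x hx =>
    hmax (mem_closedBall_zero_iff.2 hx)
  obtain ⟨k, hk⟩ : ∃ k, k = (1 - ‖z‖) * M z := ⟨_, rfl⟩
  suffices hkk : k ≤ k₀ by
    intro x hx
    have h1 := hmax' x (by linarith)
    have h2 : M x ≤ 2 * k₀ := by
      have := hM0 x
      nlinarith
    have p1 : 0 ≤ (2 * k₀) ^ α := by positivity
    have p2 : 0 ≤ (2 * k₀) ^ β := by positivity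
    exact ⟨(huM x _ h2).trans (by linarith), (hvM x _ h2).trans (by linarith)⟩
  by_contra hcon
  have hk2 : k₀ < k := not_le.1 hcon
  have hz1 : 0 < 1 - ‖z‖ := by
    by_contra hz'
    have := mul_nonpos_of_nonpos_of_nonneg (not_lt.1 hz') (hM0 z).le
    linarith
  obtain ⟨l, hl⟩ : ∃ l, l = (1 - ‖z‖) / 2 := ⟨_, rfl⟩
  have hl0 : 0 < l := by linarith
  have hzn := norm_nonneg z
  have hU := h.rescale hβp hαq hl0 (by linarith) (by linarith : ‖z‖ + 2 * l ≤ 2)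
  set U : EN N → ℝ := fun y => l ^ α * u (z + l • y) with hUd
  set V : EN N → ℝ := fun y => l ^ β * v (z + l • y) with hVd
  obtain ⟨t, ht⟩ : ∃ t, t = 2 / k := ⟨_, rfl⟩
  have hk0 : 0 < k := by linarith
  have ht0 : 0 < t := by rw [ht]; positivity
  have ht1 : t ≤ 1 := by rw [ht, div_le_one hk0]; linarith
  have htl : t * l = 1 / M z := by
    rw [ht, hl, hk]; field_simp
  have hW := hU.rescale hβp hαq (z := 0) ht0 ht1 (by rw [norm_zero]; linarith)
  have hscale : ∀ y : EN N, ‖y‖ ≤ 1 → M (z + l • (0 + t • y)) ≤ 2 * M z := fun y hy => by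
    have h1 : ‖z + l • (0 + t • y)‖ ≤ ‖z‖ + l := by
      refine (norm_add_le _ _).trans ?_
      rw [zero_add, norm_smul, norm_smul, Real.norm_of_nonneg hl0.le, Real.norm_of_nonneg ht0.le]
      have : l * (t * ‖y‖) ≤ l * 1 :=
        mul_le_mul_of_nonneg_left (mul_le_one₀ ht1 (norm_nonneg y) hy) hl0.le
      linarith
    have h2 := hmax' (z + l • (0 + t • y)) (by linarith)
    have h3 : l ≤ 1 - ‖z + l • (0 + t • y)‖ := by linarith
    have h4 := mul_le_mul_of_nonneg_right h3 (hM0 (z + l • (0 + t • y))).le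
    rw [show 1 - ‖z‖ = 2 * l by linarith] at h2
    have h5 : l * M (z + l • (0 + t • y)) ≤ l * (2 * M z) := by linarith
    exact le_of_mul_le_mul_left h5 hl0
  have hMz := hM0 z
  have hWu : ∀ y : EN N, ‖y‖ ≤ 1 → t ^ α * U (0 + t • y) ≤ A := fun y hy => by
    have h1 := huM _ _ (hscale y hy)
    have h2 : t ^ α * U (0 + t • y) = (t * l) ^ α * u (z + l • (0 + t • y)) := by
      rw [Real.mul_rpow ht0.le hl0.le, hUd]; ring
    have h3 : (t * l) ^ α * (2 * M z) ^ α = 2 ^ α := by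
      rw [htl, ← Real.mul_rpow (by positivity) (by positivity)]
      congr 1; field_simp
    have h4 : 0 ≤ (2 : ℝ) ^ β := by positivity
    rw [h2, hA]
    have h5 := mul_le_mul_of_nonneg_left h1 (by positivity : 0 ≤ (t * l) ^ α)
    linarith
  have hWv : ∀ y : EN N, ‖y‖ ≤ 1 → t ^ β * V (0 + t • y) ≤ A := fun y hy => by
    have h1 := hvM _ _ (hscale y hy)
    have h2 : t ^ β * V (0 + t • y) = (t * l) ^ β * v (z + l • (0 + t • y)) := by
      rw [Real.mul_rpow ht0.le hl0.le, hVd]; ring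
    have h3 : (t * l) ^ β * (2 * M z) ^ β = 2 ^ β := by
      rw [htl, ← Real.mul_rpow (by positivity) (by positivity)]
      congr 1; field_simp
    have h4 : 0 ≤ (2 : ℝ) ^ α := by positivity
    rw [h2, hA]
    have h5 := mul_le_mul_of_nonneg_left h1 (by positivity : 0 ≤ (t * l) ^ β)
    linarith
  have hlow : e ≤ energy p q (fun y => t ^ α * U (0 + t • y)) (fun y => t ^ β * V (0 + t • y))
      (1 / 2) := by
    have hMzd : u z ^ (1 / α) + v z ^ (1 / β) = M z := rfl
    rcases le_total (M z / 2) (u z ^ (1 / α)) with hc | hc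
    · refine (he ▸ min_le_left e₁ e₂).trans (L₁ _ _ _ _ _ hW hWv ?_)
      have h1 : t ^ α * U (0 + t • (0 : EN N)) = (t * l * u z ^ (1 / α)) ^ α := by
        rw [Real.mul_rpow (by positivity) (hu1 z).le, hu2, Real.mul_rpow ht0.le hl0.le, hUd]
        simp only [smul_zero, add_zero]
        ring
      rw [h1]
      refine Real.rpow_le_rpow (by norm_num) ?_ hα0.le
      rw [htl, div_mul_eq_mul_div, one_mul, le_div_iff₀ hMz]
      linarith
    · rw [← energy_swap]
      refine (he ▸ min_le_right e₁ e₂).trans (L₂ _ _ _ _ _ hW.swap hWu ?_)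
      have h1 : t ^ β * V (0 + t • (0 : EN N)) = (t * l * v z ^ (1 / β)) ^ β := by
        rw [Real.mul_rpow (by positivity) (hv1 z).le, hv2, Real.mul_rpow ht0.le hl0.le, hVd]
        simp only [smul_zero, add_zero]
        ring
      rw [h1]
      refine Real.rpow_le_rpow (by norm_num) ?_ hβ0.le
      rw [htl, div_mul_eq_mul_div, one_mul, le_div_iff₀ hMz]
      linarith
  rw [hU.energy_rescale rfl hγ ht0] at hlow
  have hE1 : energy p q U V (t * (1 / 2)) ≤ B := by
    refine le_trans ?_ (HB _ _ _ _ _ hκ hU)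
    exact setIntegral_le_of_subset (closedBall_subset_closedBall (by linarith))
      measurableSet_closedBall (hU.energy_cont.integrableOn_closedBall _) fun x _ =>
        add_nonneg (Real.rpow_nonneg (hU.pu x).le _) (Real.rpow_nonneg (hU.pv x).le _)
  have hfin : e ≤ t ^ σ * B := hlow.trans (by gcongr)
  have h1 : (k / 2) ^ σ ≤ B / e := by
    rw [le_div_iff₀ he0]
    have h2 : (k / 2) ^ σ * t ^ σ = 1 := by
      rw [← Real.mul_rpow (by positivity) ht0.le, ht, div_mul_div_cancel₀ two_ne_zero,
        div_self hk0.ne', Real.one_rpow]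
    calc (k / 2) ^ σ * e ≤ (k / 2) ^ σ * (t ^ σ * B) := by gcongr
      _ = B := by rw [← mul_assoc, h2, one_mul]
  have h2 : k / 2 ≤ (B / e) ^ (1 / σ) := by
    have := Real.rpow_le_rpow (by positivity) h1 (by positivity : 0 ≤ 1 / σ)
    rwa [← Real.rpow_mul (by positivity), mul_one_div_cancel hσ.ne', Real.rpow_one] at this
  linarith

/-- Universal interior gradient bound. -/
lemma exists_gradient_bound (hN : 3 ≤ N) (hp : 0 < p) (hq : 0 < q) (hpq : 1 < p * q)
    (hsub : (N : ℝ) - 2 < N / (p + 1) + N / (q + 1))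
    (hα : (N : ℝ) - 3 < 2 * (p + 1) / (p * q - 1)) :
    ∃ κ₀ > 0, ∃ G > 0, ∀ (κ : ℝ) (c d u v : EN N → ℝ), κ ≤ κ₀ → Sol p q κ c d u v →
      ‖fderiv ℝ u 0‖ ≤ G ∧ ‖fderiv ℝ v 0‖ ≤ G := by
  obtain ⟨κ₀, hκ₀, B, hB, HB⟩ := exists_sup_bound hN hp hq hpq hsub hα
  have hpq1 : 0 < p * q - 1 := by linarith
  set α := 2 * (p + 1) / (p * q - 1) with hαd
  set β := 2 * (q + 1) / (p * q - 1) with hβd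
  have hα0 : 0 < α := by positivity
  have hβ0 : 0 < β := by positivity
  have hβp : β * p = α + 2 := scaling_exponent hpq1.ne'
  have hαq : α * q = β + 2 := by rw [hαd, hβd]; field_simp; ring
  obtain ⟨G₁, hG₁, H₁⟩ := exists_gradient_bound_of_bounded (N := N) hN hp hq hpq hB
  obtain ⟨G₂, hG₂, H₂⟩ := exists_gradient_bound_of_bounded (N := N) hN hq hp (by rwa [mul_comm]) hB
  have hN0 : (0 : ℝ) < N := by positivity
  have ha0 : (0 : ℝ) < (1 / 2) ^ α * (1 / 2) := by positivity
  have hb0 : (0 : ℝ) < (1 / 2) ^ β * (1 / 2) := by positivity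
  refine ⟨κ₀, hκ₀, N * (((1 / 2) ^ α * (1 / 2))⁻¹ * G₁) + N * (((1 / 2) ^ β * (1 / 2))⁻¹ * G₂),
    by positivity, fun κ c d u v hκ h => ?_⟩
  have hW := h.rescale hβp hαq (z := 0) (s := 1 / 2) (by norm_num) (by norm_num)
    (by rw [norm_zero]; norm_num)
  have hin : ∀ y : EN N, ‖y‖ ≤ 1 → ‖(0 : EN N) + (1 / 2 : ℝ) • y‖ ≤ 1 / 2 := fun y hy => by
    rw [zero_add, norm_smul, Real.norm_of_nonneg (by norm_num)]; linarith
  have hsc : ∀ (f : EN N → ℝ) (i : Fin N) (γ : ℝ), ContDiff ℝ 2 f →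
      pd i (fun y => (1 / 2 : ℝ) ^ γ * f (0 + (1 / 2 : ℝ) • y)) 0
        = (1 / 2) ^ γ * (1 / 2) * pd i f 0 := fun f i γ hf => by
    have hd : Differentiable ℝ f := hf.differentiable two_ne_zero
    rw [pd_const_mul, pd_comp_affine hd, smul_zero, add_zero]
    · ring
    · exact (hd.comp ((differentiable_const (0 : EN N)).add (differentiable_id.const_smul
        (1 / 2 : ℝ)))) 0
  have hle1 : ∀ {γ B : ℝ}, 0 < γ → 0 < B → ∀ {x : ℝ}, 0 < x → x ≤ B → (1 / 2 : ℝ) ^ γ * x ≤ B :=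
    fun {γ B} hγ hB {x} hx hxB =>
      (mul_le_of_le_one_left hx.le (Real.rpow_le_one (by norm_num) (by norm_num) hγ.le)).trans hxB
  have hsum : ∀ (f : EN N → ℝ) (γ G : ℝ), ContDiff ℝ 2 f →
      (∀ i, |pd i (fun y => (1 / 2 : ℝ) ^ γ * f (0 + (1 / 2 : ℝ) • y)) 0| ≤ G) →
      ‖fderiv ℝ f 0‖ ≤ N * (((1 / 2) ^ γ * (1 / 2))⁻¹ * G) := fun f γ G hf hG => by
    have hpos : (0 : ℝ) < (1 / 2) ^ γ * (1 / 2) := by positivity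
    refine (norm_fderiv_le_sum f 0).trans ?_
    refine (Finset.sum_le_card_nsmul _ _ (((1 / 2) ^ γ * (1 / 2))⁻¹ * G) fun i _ => ?_).trans_eq ?_
    · have := hG i
      rw [hsc f i γ hf, abs_mul, abs_of_pos hpos] at this
      rwa [le_inv_mul_iff₀ hpos]
    · simp
  have g1 := hsum u α G₁ h.cu fun i => H₁ κ _ _ _ _ hW
    (fun x hx => hle1 hβ0 hB (h.pv _) (HB κ c d u v hκ h _ (hin x hx)).2) 0 (by simp) i
  have g2 := hsum v β G₂ h.cv fun i => H₂ κ _ _ _ _ hW.swap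
    (fun x hx => hle1 hα0 hB (h.pu _) (HB κ c d u v hκ h _ (hin x hx)).1) 0 (by simp) i
  have p1 : 0 ≤ N * (((1 / 2 : ℝ) ^ α * (1 / 2))⁻¹ * G₁) := by positivity
  have p2 : 0 ≤ N * (((1 / 2 : ℝ) ^ β * (1 / 2))⁻¹ * G₂) := by positivity
  exact ⟨by linarith, by linarith⟩

end SupBound

section Transport

variable {N : ℕ}

/-- Extension of a positive function from a ball to the whole space. -/
lemma exists_positive_extension {n : WithTop ℕ∞} (hn : n ≤ 2) {f : EN N → ℝ}
    (hf : ContDiffOn ℝ n f (ball 0 4)) (hf0 : ∀ y ∈ ball (0 : EN N) 4, 0 < f y) :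
    ∃ F : EN N → ℝ, ContDiff ℝ n F ∧ (∀ y, 0 < F y) ∧ ∀ y, ‖y‖ < 2 → F y = f y := by
  obtain ⟨C, -, H⟩ := exists_cutoff N
  obtain ⟨ζ, hζ, h0, h1, hone, hzero, -⟩ := H 2 3 (by norm_num) (by norm_num) le_rfl
  refine ⟨fun y => ζ y * f y + (1 - ζ y), ?_, fun y => ?_, fun y hy => ?_⟩
  · rw [contDiff_iff_contDiffAt]
    intro y
    rcases lt_or_ge ‖y‖ 4 with hy | hy
    · have hfy : ContDiffAt ℝ n f y :=
        hf.contDiffAt (isOpen_ball.mem_nhds (mem_ball_zero_iff.2 hy))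
      have hζy : ContDiffAt ℝ n ζ y := (hζ.of_le hn).contDiffAt
      exact (hζy.mul hfy).add (contDiffAt_const.sub hζy)
    · refine (contDiffAt_const (c := (1 : ℝ))).congr_of_eventuallyEq ?_
      have : ∀ᶠ z : EN N in 𝓝 y, 3 < ‖z‖ :=
        continuous_norm.continuousAt.eventually (lt_mem_nhds (by linarith))
      filter_upwards [this] with z hz
      rw [hzero z hz.le]; ring
  · show 0 < ζ y * f y + (1 - ζ y)
    rcases lt_or_ge ‖y‖ 3 with hy | hy
    · have hfy := hf0 y (mem_ball_zero_iff.2 (by linarith))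
      rcases (h1 y).lt_or_eq with h | h
      · exact add_pos_of_nonneg_of_pos (mul_nonneg (h0 y) hfy.le) (by linarith)
      · rw [h]; linarith
    · rw [hzero y hy]; norm_num
  · simp only []
    rw [hone y hy.le]; ring

lemma lapl_congr {f g : EN N → ℝ} {x : EN N} (h : f =ᶠ[𝓝 x] g) : lapl f x = lapl g x := by
  have h1 : ∀ i, pd i f =ᶠ[𝓝 x] pd i g := fun i => by
    filter_upwards [h.fderiv (𝕜 := ℝ)] with y hy
    rw [pd, pd, hy]
  unfold lapl
  refine Finset.sum_congr rfl fun i _ => ?_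
  rw [pd, pd, (h1 i).fderiv_eq]

/-- Globally defined rescaled copy of a function given near a point. -/
lemma exists_rescaled_extension {u : EN N → ℝ} {x₀ : EN N} {s : ℝ} (hs : 0 < s)
    (hu : ContDiffOn ℝ 2 u (ball x₀ (4 * s))) (hu0 : ∀ x ∈ ball x₀ (4 * s), 0 < u x) :
    ∃ F : EN N → ℝ, ContDiff ℝ 2 F ∧ (∀ y, 0 < F y) ∧ (∀ y, ‖y‖ < 2 → F y = u (x₀ + s • y)) ∧
      (∀ y, ‖y‖ < 2 → lapl F y = s ^ 2 * lap u (x₀ + s • y)) ∧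
      ‖fderiv ℝ u x₀‖ ≤ s⁻¹ * ‖fderiv ℝ F 0‖ := by
  have hmap : ∀ y ∈ ball (0 : EN N) 4, x₀ + s • y ∈ ball x₀ (4 * s) := fun y hy => by
    rw [mem_ball_zero_iff] at hy
    rw [mem_ball_iff_norm, add_sub_cancel_left, norm_smul, Real.norm_of_nonneg hs.le, mul_comm]
    gcongr
  have haff : ContDiff ℝ 2 fun y : EN N => x₀ + s • y :=
    contDiff_const.add (contDiff_id.const_smul s)
  obtain ⟨F, hF, hF0, hFu⟩ := exists_positive_extension le_rfl
    (hu.comp haff.contDiffOn hmap) (fun y hy => hu0 _ (hmap y hy))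
  set G : EN N → ℝ := fun x => F (s⁻¹ • (x - x₀)) with hG
  have hback : ContDiff ℝ 2 fun x : EN N => s⁻¹ • (x - x₀) :=
    (contDiff_id.sub contDiff_const).const_smul s⁻¹
  have hGc : ContDiff ℝ 2 G := hF.comp hback
  have hGF : ∀ y, G (x₀ + s • y) = F y := fun y => by
    rw [hG]
    simp only [add_sub_cancel_left, smul_smul, inv_mul_cancel₀ hs.ne', one_smul]
  have hGu : ∀ x ∈ ball x₀ (2 * s), G x = u x := fun x hx => by
    rw [mem_ball_iff_norm] at hx
    have h1 : ‖s⁻¹ • (x - x₀)‖ < 2 := by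
      rw [norm_smul, Real.norm_of_nonneg (by positivity), inv_mul_lt_iff₀ hs]; linarith
    rw [hG]
    simp only []
    rw [hFu _ h1]
    simp [smul_smul, mul_inv_cancel₀ hs.ne']
  have hGev : ∀ x ∈ ball x₀ (2 * s), G =ᶠ[𝓝 x] u := fun x hx => by
    filter_upwards [isOpen_ball.mem_nhds hx] with z hz using hGu z hz
  refine ⟨F, hF, hF0, fun y hy => hFu y hy, fun y hy => ?_, ?_⟩
  · have hx : x₀ + s • y ∈ ball x₀ (2 * s) := by
      rw [mem_ball_iff_norm, add_sub_cancel_left, norm_smul, Real.norm_of_nonneg hs.le, mul_comm]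
      gcongr
    have hcu : ContDiffAt ℝ 2 u (x₀ + s • y) :=
      hGc.contDiffAt.congr_of_eventuallyEq (hGev _ hx).symm
    have h1 := lapl_comp_affine hGc 1 x₀ s y
    simp only [hGF, one_mul] at h1
    rw [h1, lap_eq_lapl hcu, lapl_congr (hGev _ hx)]
  · have h2 : HasFDerivAt (fun x : EN N => s⁻¹ • (x - x₀))
        (s⁻¹ • ContinuousLinearMap.id ℝ (EN N)) x₀ :=
      ((hasFDerivAt_id x₀).sub_const x₀).const_smul s⁻¹
    have h3 : HasFDerivAt F (fderiv ℝ F 0) (s⁻¹ • (x₀ - x₀)) := by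
      rw [sub_self, smul_zero]
      exact (hF.differentiable two_ne_zero 0).hasFDerivAt
    have h4 := (h3.comp x₀ h2).fderiv
    have h5 : fderiv ℝ u x₀ = fderiv ℝ G x₀ :=
      (hGev x₀ (mem_ball_self (by positivity))).fderiv_eq.symm
    rw [h5, hG, show (fun x => F (s⁻¹ • (x - x₀))) = F ∘ fun x => s⁻¹ • (x - x₀) from rfl, h4,
      ContinuousLinearMap.comp_smul, ContinuousLinearMap.comp_id, norm_smul,
      Real.norm_of_nonneg (by positivity)]

lemma rpow_le_four_rpow_abs {T e : ℝ} (h1 : 1 / 4 ≤ T) (h2 : T ≤ 4) : T ^ e ≤ 4 ^ |e| := by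
  have hT : 0 < T := by linarith
  rcases le_total 0 e with he | he
  · rw [abs_of_nonneg he]; exact Real.rpow_le_rpow hT.le h2 he
  · rw [abs_of_nonpos he]
    have h3 : T ^ e = (T⁻¹) ^ (-e) := by
      rw [Real.inv_rpow hT.le, Real.rpow_neg hT.le, inv_inv]
    rw [h3]
    refine Real.rpow_le_rpow (by positivity) ?_ (by linarith)
    rw [inv_le_comm₀ hT (by norm_num)]
    linarith

/-- Far from the origin, normalised power weights are nearly constant. -/
lemma eventually_weight_bounds (N : ℕ) (a : ℝ) {κ : ℝ} (hκ : 0 < κ) :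
    ∀ᶠ L : ℝ in atTop, ∀ z : EN N, ‖z‖ = L → ∀ y : EN N, ‖y‖ < 2 →
      (1 / 2 ≤ (L⁻¹ ^ 2 * ‖y - z‖ ^ 2) ^ (a / 2) ∧ (L⁻¹ ^ 2 * ‖y - z‖ ^ 2) ^ (a / 2) ≤ 2) ∧
      ∀ i, |pd i (fun y => (L⁻¹ ^ 2 * ‖y - z‖ ^ 2) ^ (a / 2)) y| ≤ κ := by
  have hcont : Tendsto (fun T : ℝ => T ^ (a / 2)) (𝓝 1) (𝓝 1) := by
    have := (Real.continuousAt_rpow_const 1 (a / 2) (Or.inl one_ne_zero)).tendsto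
    rwa [Real.one_rpow] at this
  obtain ⟨δ, hδ, H⟩ := Metric.eventually_nhds_iff.1
    (hcont.eventually (Icc_mem_nhds (by norm_num : (1 / 2 : ℝ) < 1) (by norm_num : (1 : ℝ) < 2)))
  set D := |a / 2| * 4 ^ |a / 2 - 1| * 4 with hD
  have hD0 : 0 ≤ D := by positivity
  filter_upwards [eventually_ge_atTop (max 4 (max (7 / δ) (D / κ)))] with L hL z hz y hy
  simp only [max_le_iff] at hL
  obtain ⟨hL4, hLδ, hLκ⟩ := hL
  rw [div_le_iff₀ hδ] at hLδ
  rw [div_le_iff₀ hκ] at hLκ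
  have hL0 : 0 < L := by linarith
  have n1 : ‖y - z‖ ≤ L + 2 := by have := norm_sub_le y z; linarith
  have n2 : L - 2 ≤ ‖y - z‖ := by
    have := norm_sub_norm_le z y
    rw [norm_sub_rev] at this
    linarith
  obtain ⟨w, hw⟩ : ∃ w, w = L⁻¹ * ‖y - z‖ := ⟨_, rfl⟩
  have hwL : w * L = ‖y - z‖ := by rw [hw]; field_simp
  have hT : L⁻¹ ^ 2 * ‖y - z‖ ^ 2 = w ^ 2 := by rw [hw]; ring
  have w1 : 1 / 2 ≤ w := by
    by_contra hc
    nlinarith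
  have w2 : w ≤ 3 / 2 := by
    by_contra hc
    nlinarith
  have hT4 : 1 / 4 ≤ w ^ 2 := by nlinarith
  have hT5 : w ^ 2 ≤ 4 := by nlinarith
  constructor
  · rw [hT]
    refine H ?_
    rw [Real.dist_eq]
    have h1 : |w - 1| * L ≤ 2 := by
      rw [show |w - 1| * L = |(w - 1) * L| by rw [abs_mul, abs_of_pos hL0], sub_mul, hwL, one_mul,
        abs_le]
      constructor <;> linarith
    have h2 : |w ^ 2 - 1| = |w - 1| * (w + 1) := by
      rw [show w ^ 2 - 1 = (w - 1) * (w + 1) by ring, abs_mul, abs_of_pos (by linarith : 0 < w + 1)]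
    rw [h2]
    have h3 := abs_nonneg (w - 1)
    have h4 : |w - 1| * (w + 1) ≤ |w - 1| * 3 := mul_le_mul_of_nonneg_left (by linarith) h3
    have h5 : |w - 1| * 3 * L < δ * L := by nlinarith
    exact h4.trans_lt (lt_of_mul_lt_mul_right h5 hL0.le)
  · intro i
    have hpos : L⁻¹ ^ 2 * ‖y - z‖ ^ 2 ≠ 0 := by rw [hT]; positivity
    have hd : DifferentiableAt ℝ (fun y : EN N => ‖y - z‖ ^ 2) y :=
      ((contDiff_normSq (n := 2) z).differentiable two_ne_zero) y
    have hdf : DifferentiableAt ℝ (fun y : EN N => L⁻¹ ^ 2 * ‖y - z‖ ^ 2) y := hd.const_mul _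
    have h1 : pd i (fun y => (L⁻¹ ^ 2 * ‖y - z‖ ^ 2) ^ (a / 2)) y
        = a / 2 * (w ^ 2) ^ (a / 2 - 1) * (L⁻¹ ^ 2 * (2 * (y i - z i))) := by
      have hh := Real.hasDerivAt_rpow_const (p := a / 2) (Or.inl hpos)
      have h2 := pd_comp (i := i) hh.differentiableAt hdf
      rw [h2, hh.deriv, pd_const_mul _ hd, pd_normSq, hT]
    rw [h1, abs_mul, abs_mul]
    have h2 : |(w ^ 2) ^ (a / 2 - 1)| ≤ 4 ^ |a / 2 - 1| := by
      rw [abs_of_nonneg (by positivity)]; exact rpow_le_four_rpow_abs hT4 hT5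
    have h3 : |L⁻¹ ^ 2 * (2 * (y i - z i))| ≤ L⁻¹ * 4 := by
      have h4 : |y i - z i| ≤ w * L := by
        rw [hwL]; exact abs_coord_le_norm (y - z) i
      rw [abs_mul, abs_mul, abs_of_pos (by positivity : 0 < L⁻¹ ^ 2), abs_two]
      calc L⁻¹ ^ 2 * (2 * |y i - z i|) ≤ L⁻¹ ^ 2 * (2 * (2 * L)) := by
            gcongr; nlinarith
        _ = L⁻¹ * 4 := by field_simp; norm_num
    calc |a / 2| * |(w ^ 2) ^ (a / 2 - 1)| * |L⁻¹ ^ 2 * (2 * (y i - z i))|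
        ≤ |a / 2| * 4 ^ |a / 2 - 1| * (L⁻¹ * 4) := by gcongr
      _ = L⁻¹ * D := by rw [hD]; ring
      _ ≤ κ := by rw [inv_mul_le_iff₀ hL0]; linarith

end Transport

section LocalBound

variable {N : ℕ}

/-- A normalised power weight, extended to a smooth positive coefficient. -/
lemma exists_coefficient {a κ L : ℝ} (hL : 8 ≤ L) {z : EN N} (hz : ‖z‖ = L)
    (H : ∀ y : EN N, ‖y‖ < 2 →
      (1 / 2 ≤ (L⁻¹ ^ 2 * ‖y - z‖ ^ 2) ^ (a / 2) ∧ (L⁻¹ ^ 2 * ‖y - z‖ ^ 2) ^ (a / 2) ≤ 2) ∧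
      ∀ i, |pd i (fun y => (L⁻¹ ^ 2 * ‖y - z‖ ^ 2) ^ (a / 2)) y| ≤ κ) :
    ∃ c : EN N → ℝ, ContDiff ℝ 1 c ∧
      (∀ y, ‖y‖ < 2 → c y = (L⁻¹ ^ 2 * ‖y - z‖ ^ 2) ^ (a / 2)) ∧
      (∀ y, ‖y‖ < 2 → 1 / 2 ≤ c y ∧ c y ≤ 2) ∧ ∀ y, ‖y‖ < 2 → ∀ i, |pd i c y| ≤ κ := by
  have hL0 : 0 < L := by linarith
  have hpos : ∀ y ∈ ball (0 : EN N) 4, 0 < L⁻¹ ^ 2 * ‖y - z‖ ^ 2 := fun y hy => by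
    rw [mem_ball_zero_iff] at hy
    have h1 := norm_sub_norm_le z y
    rw [norm_sub_rev] at h1
    have h2 : 0 < ‖y - z‖ := by linarith
    positivity
  obtain ⟨c, hc, -, hcw⟩ := exists_positive_extension (n := 1) one_le_two
    (f := fun y : EN N => (L⁻¹ ^ 2 * ‖y - z‖ ^ 2) ^ (a / 2))
    (fun y hy => ((contDiffAt_const.mul (contDiff_normSq z).contDiffAt).rpow_const_of_ne
      (hpos y hy).ne').contDiffWithinAt)
    (fun y hy => Real.rpow_pos_of_pos (hpos y hy) _)
  refine ⟨c, hc, hcw, fun y hy => by rw [hcw y hy]; exact (H y hy).1, fun y hy i => ?_⟩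
  have hev : c =ᶠ[𝓝 y] fun y => (L⁻¹ ^ 2 * ‖y - z‖ ^ 2) ^ (a / 2) := by
    filter_upwards [continuous_norm.continuousAt.eventually (gt_mem_nhds hy)] with w hw
      using hcw w hw
  have := (H y hy).2 i
  rwa [pd, ← hev.fderiv_eq] at this

lemma norm_add_smul_rpow {x₀ y : EN N} (a : ℝ) {L : ℝ} (hL : 0 < L) (hx : x₀ ≠ 0) :
    ‖x₀ + (‖x₀‖ / L) • y‖ ^ a
      = ‖x₀‖ ^ a * (L⁻¹ ^ 2 * ‖y - -((‖x₀‖ / L)⁻¹ • x₀)‖ ^ 2) ^ (a / 2) := by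
  have hR : 0 < ‖x₀‖ := norm_pos_iff.2 hx
  have hs : 0 < ‖x₀‖ / L := by positivity
  have h1 : x₀ + (‖x₀‖ / L) • y = (‖x₀‖ / L) • (y - -((‖x₀‖ / L)⁻¹ • x₀)) := by
    rw [sub_neg_eq_add, smul_add, smul_smul, mul_inv_cancel₀ hs.ne', one_smul, add_comm]
  rw [h1, norm_smul, Real.norm_of_nonneg hs.le, ← mul_pow, div_eq_mul_inv, mul_assoc,
    Real.mul_rpow hR.le (by positivity), ← Real.rpow_natCast (_ * _) 2,
    ← Real.rpow_mul (by positivity)]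
  congr 2
  push_cast
  ring

lemma rescaling_constant {R L : ℝ} (hR : 0 < R) (hL : 0 < L) (α A : ℝ) :
    (R / L)⁻¹ * ((R / L) ^ α * R ^ A)⁻¹ = L ^ (α + 1) * R ^ (-α - 1 - A) := by
  rw [Real.rpow_sub hR, Real.rpow_sub hR, Real.rpow_neg hR.le, Real.rpow_add hL, Real.rpow_one,
    Real.rpow_one, Real.div_rpow hR.le hL.le]
  have h1 := (Real.rpow_pos_of_pos hR α).ne'
  have h2 := (Real.rpow_pos_of_pos hL α).ne'
  have h3 := (Real.rpow_pos_of_pos hR A).ne'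
  field_simp

lemma rescaling_equation {s R α β A B a p : ℝ} (hs : 0 < s) (hR : 0 < R) (h1 : β * p = α + 2)
    (h2 : B * p = A + a) : s ^ α * R ^ A * s ^ 2 * R ^ a = (s ^ β * R ^ B) ^ p := by
  rw [Real.mul_rpow (by positivity) (by positivity), ← Real.rpow_mul hs.le, ← Real.rpow_mul hR.le,
    h1, h2, Real.rpow_add hs, Real.rpow_add hR, Real.rpow_two]
  ring

lemma norm_fderiv_le_of_rescaled {u F : EN N → ℝ} {x₀ : EN N} {s l G : ℝ} (hs : 0 < s)
    (hl : 0 < l) (hF : ContDiff ℝ 2 F) (h1 : ‖fderiv ℝ u x₀‖ ≤ s⁻¹ * ‖fderiv ℝ F 0‖)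
    (h2 : ‖fderiv ℝ (fun y => l * F y) 0‖ ≤ G) : ‖fderiv ℝ u x₀‖ ≤ G * (s⁻¹ * l⁻¹) := by
  rw [fderiv_const_mul (hF.differentiable two_ne_zero 0), norm_smul, Real.norm_of_nonneg hl.le]
    at h2
  have h3 : ‖fderiv ℝ F 0‖ ≤ l⁻¹ * G := by rwa [← div_eq_inv_mul, le_div_iff₀' hl]
  calc ‖fderiv ℝ u x₀‖ ≤ s⁻¹ * ‖fderiv ℝ F 0‖ := h1
    _ ≤ s⁻¹ * (l⁻¹ * G) := by gcongr
    _ = G * (s⁻¹ * l⁻¹) := by ring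

lemma rescaled_equation {u v F H c : EN N → ℝ} {x₀ y : EN N} {s l m w a p : ℝ} (hm : 0 < m)
    (hF : ContDiff ℝ 2 F) (hH : 0 < H y)
    (hFu : lapl F y = s ^ 2 * lap u (x₀ + s • y)) (hHv : H y = v (x₀ + s • y))
    (hu : -lap u (x₀ + s • y) = ‖x₀ + s • y‖ ^ a * v (x₀ + s • y) ^ p)
    (hw : ‖x₀ + s • y‖ ^ a = w * c y) (hlm : l * s ^ 2 * w = m ^ p) :
    -lapl (fun y => l * F y) y = c y * (m * H y) ^ p := by
  have h := lapl_comp_affine hF l 0 1 y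
  simp only [zero_add, one_smul] at h
  rw [h, hFu, Real.mul_rpow hm.le hH.le, ← hlm, hHv]
  linear_combination l * s ^ 2 * hu + l * s ^ 2 * v (x₀ + s • y) ^ p * hw

/-- Scale-invariant gradient bound for solutions near a point away from the origin. -/
theorem exists_local_gradient_bound (hN : 3 ≤ N) {p q : ℝ} (a b : ℝ) (hp : 0 < p) (hq : 0 < q)
    (hpq : 1 < p * q) (hsub : (N : ℝ) - 2 < N / (p + 1) + N / (q + 1))
    (hα : (N : ℝ) - 3 < 2 * (p + 1) / (p * q - 1)) :
    ∃ C > 0, ∀ (u v : EN N → ℝ) (x₀ : EN N), x₀ ≠ 0 →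
      ContDiffOn ℝ 2 u (ball x₀ (‖x₀‖ / 2)) → ContDiffOn ℝ 2 v (ball x₀ (‖x₀‖ / 2)) →
      (∀ x ∈ ball x₀ (‖x₀‖ / 2), 0 < u x) → (∀ x ∈ ball x₀ (‖x₀‖ / 2), 0 < v x) →
      (∀ x ∈ ball x₀ (‖x₀‖ / 2), -lap u x = ‖x‖ ^ a * v x ^ p) →
      (∀ x ∈ ball x₀ (‖x₀‖ / 2), -lap v x = ‖x‖ ^ b * u x ^ q) →
      ‖fderiv ℝ u x₀‖ ≤
          C * ‖x₀‖ ^ (-(2 * (p + 1) / (p * q - 1)) - 1 - (a + b * p) / (p * q - 1)) ∧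
        ‖fderiv ℝ v x₀‖ ≤
          C * ‖x₀‖ ^ (-(2 * (q + 1) / (p * q - 1)) - 1 - (b + a * q) / (p * q - 1)) := by
  obtain ⟨κ₀, hκ₀, G, hG, HG⟩ := exists_gradient_bound hN hp hq hpq hsub hα
  obtain ⟨L, ⟨hLa, hLb⟩, hL8⟩ := (((eventually_weight_bounds N a hκ₀).and
    (eventually_weight_bounds N b hκ₀)).and (eventually_ge_atTop 8)).exists
  have hL0 : 0 < L := by linarith
  have hpq0 : p * q - 1 ≠ 0 := by linarith
  set α := 2 * (p + 1) / (p * q - 1) with hαd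
  set β := 2 * (q + 1) / (p * q - 1) with hβd
  set A := (a + b * p) / (p * q - 1) with hAd
  set B := (b + a * q) / (p * q - 1) with hBd
  have e1 : β * p = α + 2 := by rw [hαd, hβd, div_mul_eq_mul_div, div_add' _ _ _ hpq0]; ring
  have e2 : α * q = β + 2 := by rw [hαd, hβd, div_mul_eq_mul_div, div_add' _ _ _ hpq0]; ring
  have e3 : B * p = A + a := by rw [hAd, hBd, div_mul_eq_mul_div, div_add' _ _ _ hpq0]; ring
  have e4 : A * q = B + b := by rw [hAd, hBd, div_mul_eq_mul_div, div_add' _ _ _ hpq0]; ring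
  refine ⟨G * L ^ (α + 1) + G * L ^ (β + 1), by positivity,
    fun u v x₀ hx₀ hu hv hu0 hv0 hequ heqv => ?_⟩
  have hR : 0 < ‖x₀‖ := norm_pos_iff.2 hx₀
  obtain ⟨s, hsd⟩ : ∃ s, s = ‖x₀‖ / L := ⟨_, rfl⟩
  have hs : 0 < s := by rw [hsd]; positivity
  have hz : ‖-((‖x₀‖ / L)⁻¹ • x₀)‖ = L := by
    rw [norm_neg, norm_smul, norm_inv, Real.norm_of_nonneg (by positivity)]
    field_simp
  have hsub' : ball x₀ (4 * s) ⊆ ball x₀ (‖x₀‖ / 2) := by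
    refine ball_subset_ball ?_
    rw [hsd, mul_div_assoc', div_le_div_iff₀ hL0 two_pos]
    nlinarith
  have hmem : ∀ y : EN N, ‖y‖ < 2 → x₀ + s • y ∈ ball x₀ (‖x₀‖ / 2) := fun y hy => hsub' <| by
    rw [mem_ball_iff_norm, add_sub_cancel_left, norm_smul, Real.norm_of_nonneg hs.le]
    nlinarith
  obtain ⟨F, hF, hF0, hFu, hFl, hFd⟩ := exists_rescaled_extension hs (hu.mono hsub')
    fun x hx => hu0 x (hsub' hx)
  obtain ⟨H, hH, hH0, hHv, hHl, hHd⟩ := exists_rescaled_extension hs (hv.mono hsub')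
    fun x hx => hv0 x (hsub' hx)
  obtain ⟨c, hc, hcw, hcb, hcg⟩ := exists_coefficient hL8 hz (hLa _ hz)
  obtain ⟨d, hd, hdw, hdb, hdg⟩ := exists_coefficient hL8 hz (hLb _ hz)
  have hl : 0 < s ^ α * ‖x₀‖ ^ A := by positivity
  have hm : 0 < s ^ β * ‖x₀‖ ^ B := by positivity
  have hsol : Sol p q κ₀ c d (fun y => s ^ α * ‖x₀‖ ^ A * F y)
      (fun y => s ^ β * ‖x₀‖ ^ B * H y) :=
    ⟨contDiff_const.mul hF, contDiff_const.mul hH, fun y => mul_pos hl (hF0 y),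
      fun y => mul_pos hm (hH0 y), hc, hd, hcb, hdb, hcg, hdg,
      fun y hy => rescaled_equation hm hF (hH0 y) (hFl y hy) (hHv y hy) (hequ _ (hmem y hy))
        (by rw [hcw y hy, hsd, norm_add_smul_rpow a hL0 hx₀]) (rescaling_equation hs hR e1 e3),
      fun y hy => rescaled_equation hl hH (hF0 y) (hHl y hy) (hFu y hy) (heqv _ (hmem y hy))
        (by rw [hdw y hy, hsd, norm_add_smul_rpow b hL0 hx₀]) (rescaling_equation hs hR e2 e4)⟩
  obtain ⟨b1, b2⟩ := HG κ₀ c d _ _ le_rfl hsol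
  have g1 := norm_fderiv_le_of_rescaled hs hl hF hFd b1
  have g2 := norm_fderiv_le_of_rescaled hs hm hH hHd b2
  rw [hsd, rescaling_constant hR hL0, ← mul_assoc] at g1 g2
  constructor
  · refine g1.trans ?_
    gcongr
    exact le_add_of_nonneg_right (by positivity)
  · refine g2.trans ?_
    gcongr
    exact le_add_of_nonneg_left (by positivity)

lemma norm_gradient_eq (u : EN N → ℝ) (x : EN N) : ‖gradient u x‖ = ‖fderiv ℝ u x‖ :=
  LinearIsometryEquiv.norm_map _ _

lemma norm_mem_Ioo_of_mem_ball {x₀ x : EN N} (hx : x ∈ ball x₀ (‖x₀‖ / 2)) :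
    ‖x₀‖ / 2 < ‖x‖ ∧ ‖x‖ < 2 * ‖x₀‖ := by
  rw [mem_ball_iff_norm] at hx
  have h1 := norm_sub_norm_le x x₀
  have h2 := norm_sub_norm_le x₀ x
  rw [norm_sub_rev] at h2
  constructor <;> linarith [norm_nonneg (x - x₀)]

end LocalBound
/-- Proposition 4.2: gradient singularity and decay estimates for positive solutions of
the Hardy–Hénon system on punctured balls and exterior domains. -/
theorem gradient_estimates
    (N : ℕ) (hN : 3 ≤ N) (a b p q : ℝ) (ha : -2 < a) (hb : -2 < b)
    (hq : 0 < q) (hqp : q ≤ p) (hpq : 1 < p * q)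
    (hhyper : (N : ℝ) / (p + 1) + (N : ℝ) / (q + 1) > (N : ℝ) - 2)
    (halpha : 2 * (p + 1) / (p * q - 1) > (N : ℝ) - 3) :
    ∃ C > 0,
      (∀ ρ > (0 : ℝ), ∀ u v : EuclideanSpace ℝ (Fin N) → ℝ,
        IsHHSol a b p q {x : EuclideanSpace ℝ (Fin N) | 0 < ‖x‖ ∧ ‖x‖ < ρ} u v →
        ∀ x : EuclideanSpace ℝ (Fin N), 0 < ‖x‖ → ‖x‖ < ρ / 2 →
          ‖gradient u x‖ ≤
            C * ‖x‖ ^ (-(2 * (p + 1) / (p * q - 1)) - 1 - (a + b * p) / (p * q - 1)) ∧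
          ‖gradient v x‖ ≤
            C * ‖x‖ ^ (-(2 * (q + 1) / (p * q - 1)) - 1 - (b + a * q) / (p * q - 1))) ∧
      (∀ ρ : ℝ, 0 ≤ ρ → ∀ u v : EuclideanSpace ℝ (Fin N) → ℝ,
        IsHHSol a b p q {x : EuclideanSpace ℝ (Fin N) | ρ < ‖x‖} u v →
        ∀ x : EuclideanSpace ℝ (Fin N), 2 * ρ < ‖x‖ →
          ‖gradient u x‖ ≤
            C * ‖x‖ ^ (-(2 * (p + 1) / (p * q - 1)) - 1 - (a + b * p) / (p * q - 1)) ∧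
          ‖gradient v x‖ ≤
            C * ‖x‖ ^ (-(2 * (q + 1) / (p * q - 1)) - 1 - (b + a * q) / (p * q - 1))) := by

  obtain ⟨C, hC, H⟩ := exists_local_gradient_bound hN a b (hq.trans_le hqp) hq hpq hhyper halpha
  have key : ∀ (Ω : Set (EuclideanSpace ℝ (Fin N))) (u v : EuclideanSpace ℝ (Fin N) → ℝ)
      (x : EuclideanSpace ℝ (Fin N)), IsHHSol a b p q Ω u v → x ≠ 0 →
      ball x (‖x‖ / 2) ⊆ Ω → _ ∧ _ := fun Ω u v x h hx hsub => by
    have hsub' : ball x (‖x‖ / 2) ⊆ Ω \ {0} := fun y hy => by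
      refine ⟨hsub hy, fun h0 => ?_⟩
      have h1 := (norm_mem_Ioo_of_mem_ball hy).1
      rw [mem_singleton_iff.1 h0, norm_zero] at h1
      linarith [norm_nonneg x]
    obtain ⟨-, -, hu, hv, hu0, hv0, heu, hev⟩ := h
    have := H u v x hx (hu.mono hsub') (hv.mono hsub') (fun y hy => hu0 y (hsub hy))
      (fun y hy => hv0 y (hsub hy)) (fun y hy => heu y (hsub' hy)) fun y hy => hev y (hsub' hy)
    rwa [← norm_gradient_eq, ← norm_gradient_eq] at this
  refine ⟨C, hC, fun ρ hρ u v h x hx0 hxρ => ?_, fun ρ hρ u v h x hx => ?_⟩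
  · refine key _ u v x h (norm_pos_iff.1 hx0) fun y hy => ?_
    obtain ⟨h1, h2⟩ := norm_mem_Ioo_of_mem_ball hy
    constructor <;> linarith
  · refine key _ u v x h (norm_pos_iff.1 (by linarith)) fun y hy => ?_
    obtain ⟨h1, h2⟩ := norm_mem_Ioo_of_mem_ball hy
    show ρ < ‖y‖
    linarith
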